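/- Suppose ℋ is a hereditary 3-graph property with VC₂(ℋ)=∞. Then there is C>0 such that for all sufficiently small ε₁>0 and all ε₂:ℕ→(0,1] tending to 0 sufficiently fast, L_ℋ(ε₁,ε₂) ≥ 2^{ε₁^{-C}}. -/

import Mathlib

open scoped Classical
open Finset

set_option maxHeartbeats 1000000

/-- A 3-uniform hypergraph on a finite vertex set of naturals. -/
structure ThreeGraph where
  verts : Finset ℕ
  edges : Finset (Finset ℕ)
  edges_sub : ∀ e ∈ edges, e ⊆ verts ∧ e.card = 3

/-- The set `Ē` of ordered triples corresponding to edges. -/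
def ThreeGraph.obar (H : ThreeGraph) : Finset (ℕ × ℕ × ℕ) :=
  (H.verts ×ˢ H.verts ×ˢ H.verts).filter fun p => ({p.1, p.2.1, p.2.2} : Finset ℕ) ∈ H.edges

/-- A bigraph `(U,V;E)`. -/
structure Bigraph where
  left : Finset ℕ
  right : Finset ℕ
  edges : Finset (ℕ × ℕ)
  edges_sub : edges ⊆ left ×ˢ right

noncomputable def Bigraph.density (B : Bigraph) : ℝ :=
  (B.edges.card : ℝ) / ((B.left.card : ℝ) * (B.right.card : ℝ))

noncomputable def Bigraph.gfun (B : Bigraph) (u w : ℕ) : ℝ :=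
  if (u, w) ∈ B.edges then 1 - B.density else -B.density

noncomputable def Bigraph.devSum (B : Bigraph) : ℝ :=
  ∑ u₀ ∈ B.left, ∑ u₁ ∈ B.left, ∑ w₀ ∈ B.right, ∑ w₁ ∈ B.right,
    B.gfun u₀ w₀ * B.gfun u₀ w₁ * B.gfun u₁ w₀ * B.gfun u₁ w₁

/-- `B` has `dev₂(ε,d)`. -/
def Bigraph.dev2 (B : Bigraph) (ε d : ℝ) : Prop :=
  |B.density - d| ≤ ε ∧ B.devSum ≤ ε * (B.left.card : ℝ) ^ 2 * (B.right.card : ℝ) ^ 2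

/-- `B` has `dev₂(ε)`, i.e. `dev₂(ε, d_B)`. -/
def Bigraph.dev2self (B : Bigraph) (ε : ℝ) : Prop := B.dev2 ε B.density

noncomputable def Bigraph.dBetween (B : Bigraph) (X Y : Finset ℕ) : ℝ :=
  ((B.edges ∩ X ×ˢ Y).card : ℝ) / ((X.card : ℝ) * (Y.card : ℝ))

/-- `ε`-regularity for a bigraph. -/
def Bigraph.EpsRegular (B : Bigraph) (ε : ℝ) : Prop :=
  ∀ X ⊆ B.left, ∀ Y ⊆ B.right,
    ε * (B.left.card : ℝ) ≤ (X.card : ℝ) → ε * (B.right.card : ℝ) ≤ (Y.card : ℝ) →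
      |B.density - B.dBetween X Y| ≤ ε

/-- Irreducibility: distinct vertices have distinct neighborhoods, on both sides. -/
def Bigraph.Irreducible (B : Bigraph) : Prop :=
  (∀ u ∈ B.left, ∀ u' ∈ B.left, (∀ v : ℕ, (u, v) ∈ B.edges ↔ (u', v) ∈ B.edges) → u = u') ∧
  (∀ v ∈ B.right, ∀ v' ∈ B.right, (∀ u : ℕ, (u, v) ∈ B.edges ↔ (u, v') ∈ B.edges) → v = v')

def Bigraph.leftNbhd (B : Bigraph) (v : ℕ) : Finset ℕ :=
  B.left.filter fun u => (u, v) ∈ B.edges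

/-- `B` contains an induced copy of the abstract bigraph on `Fin k × Fin k` given by `F`. -/
def Bigraph.HasInducedPattern (B : Bigraph) (k : ℕ) (F : Fin k → Fin k → Prop) : Prop :=
  ∃ u v : Fin k → ℕ, (∀ a, u a ∈ B.left) ∧ (∀ b, v b ∈ B.right) ∧
    ∀ a b, ((u a, v b) ∈ B.edges ↔ F a b)

/-- A triad `(X,Y,Z; E_XY, E_YZ, E_XZ)`. -/
structure Triad where
  X : Finset ℕ
  Y : Finset ℕ
  Z : Finset ℕ
  EXY : Finset (ℕ × ℕ)
  EYZ : Finset (ℕ × ℕ)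
  EXZ : Finset (ℕ × ℕ)
  hXY : EXY ⊆ X ×ˢ Y
  hYZ : EYZ ⊆ Y ×ˢ Z
  hXZ : EXZ ⊆ X ×ˢ Z

def Triad.K3 (G : Triad) : Finset (ℕ × ℕ × ℕ) :=
  (G.X ×ˢ G.Y ×ˢ G.Z).filter fun p =>
    (p.1, p.2.1) ∈ G.EXY ∧ (p.2.1, p.2.2) ∈ G.EYZ ∧ (p.1, p.2.2) ∈ G.EXZ

def Triad.bXY (G : Triad) : Bigraph := ⟨G.X, G.Y, G.EXY, G.hXY⟩
def Triad.bYZ (G : Triad) : Bigraph := ⟨G.Y, G.Z, G.EYZ, G.hYZ⟩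
def Triad.bXZ (G : Triad) : Bigraph := ⟨G.X, G.Z, G.EXZ, G.hXZ⟩

/-- `d_H(G)` where the (tri)graph is given by its set `R` of ordered triples. -/
noncomputable def relDensity (R : Finset (ℕ × ℕ × ℕ)) (G : Triad) : ℝ :=
  ((R ∩ G.K3).card : ℝ) / (G.K3.card : ℝ)

noncomputable def hFun (R : Finset (ℕ × ℕ × ℕ)) (G : Triad) (x y z : ℕ) : ℝ :=
  if (x, y, z) ∈ G.K3 then
    (if (x, y, z) ∈ R then 1 - relDensity R G else -(relDensity R G))
  else 0

noncomputable def devSum3 (R : Finset (ℕ × ℕ × ℕ)) (G : Triad) : ℝ :=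
  ∑ u₀ ∈ G.X, ∑ u₁ ∈ G.X, ∑ w₀ ∈ G.Y, ∑ w₁ ∈ G.Y, ∑ z₀ ∈ G.Z, ∑ z₁ ∈ G.Z,
    hFun R G u₀ w₀ z₀ * hFun R G u₀ w₀ z₁ * hFun R G u₀ w₁ z₀ * hFun R G u₀ w₁ z₁ *
      hFun R G u₁ w₀ z₀ * hFun R G u₁ w₀ z₁ * hFun R G u₁ w₁ z₀ * hFun R G u₁ w₁ z₁

/-- `(H,G)` has `dev_{2,3}(ε₁,ε₂)`, where the trigraph/3-graph is given by triples `R`. -/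
def dev23 (R : Finset (ℕ × ℕ × ℕ)) (G : Triad) (ε₁ ε₂ : ℝ) : Prop :=
  ∃ dXY dYZ dXZ : ℝ, 0 < dXY ∧ 0 < dYZ ∧ 0 < dXZ ∧
    G.bXY.dev2 ε₂ dXY ∧ G.bXZ.dev2 ε₂ dXZ ∧ G.bYZ.dev2 ε₂ dYZ ∧
    devSum3 R G ≤ ε₁ * dXY ^ 4 * dYZ ^ 4 * dXZ ^ 4 *
      (G.X.card : ℝ) ^ 2 * (G.Y.card : ℝ) ^ 2 * (G.Z.card : ℝ) ^ 2

/-- `G` is `μ`-homogeneous with respect to the triples `R`: `d_H(G) ∈ [0,μ) ∪ (1-μ,1]`. -/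
def homTriad (R : Finset (ℕ × ℕ × ℕ)) (G : Triad) (μ : ℝ) : Prop :=
  relDensity R G < μ ∨ 1 - μ < relDensity R G

/-- A `(t,ℓ)`-decomposition of `V`, with part-indices `ι` and pair-indices `κ`. -/
structure Decomp (V : Finset ℕ) (ι κ : Type) where
  part : ι → Finset ℕ
  part_sub : ∀ i, part i ⊆ V
  part_disj : ∀ i j, i ≠ j → Disjoint (part i) (part j)
  part_cover : ∀ x ∈ V, ∃ i, x ∈ part i
  pairs : ι → ι → κ → Finset (ℕ × ℕ)
  pairs_sub : ∀ i j α, pairs i j α ⊆ part i ×ˢ part j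
  pairs_disj : ∀ i j α β, α ≠ β → Disjoint (pairs i j α) (pairs i j β)
  pairs_cover : ∀ i j, ∀ p ∈ part i ×ˢ part j, ∃ α, p ∈ pairs i j α

def Decomp.pairBG {V : Finset ℕ} {ι κ : Type} (P : Decomp V ι κ) (i j : ι) (α : κ) : Bigraph :=
  ⟨P.part i, P.part j, P.pairs i j α, P.pairs_sub i j α⟩

/-- The triad `G^{ijk}_{α,β,γ} = (V_i,V_j,V_k; P^α_{ij}, P^β_{ik}, P^γ_{jk})`. -/
def Decomp.triadOf {V : Finset ℕ} {ι κ : Type} (P : Decomp V ι κ) (i j k : ι) (α β γ : κ) :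
    Triad :=
  ⟨P.part i, P.part j, P.part k, P.pairs i j α, P.pairs j k γ, P.pairs i k β,
    P.pairs_sub i j α, P.pairs_sub j k γ, P.pairs_sub i k β⟩

/-- `P` is a `(t,ℓ,ε₁,ε₂)`-decomposition. -/
def Decomp.isReg {V : Finset ℕ} {ι κ : Type} (P : Decomp V ι κ) (ε₁ ε₂ : ℝ) : Prop :=
  (1 - ε₁) * (V.card : ℝ) ^ 2 ≤
    (((V ×ˢ V).filter fun p =>
      ∃ i j α, p ∈ P.pairs i j α ∧ (P.pairBG i j α).dev2self ε₂).card : ℝ)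

/-- `P` is equitable. -/
def Decomp.isEquitable {V : Finset ℕ} {ι κ : Type} [Fintype κ]
    (P : Decomp V ι κ) (ε₁ ε₂ : ℝ) : Prop :=
  (∀ i j, (P.part i).card ≤ (P.part j).card + 1) ∧
  (1 - ε₁) * (V.card : ℝ) ^ 2 ≤
    (((V ×ˢ V).filter fun p =>
      ∃ i j α, p ∈ P.pairs i j α ∧
        (P.pairBG i j α).dev2 ε₂ (1 / (Fintype.card κ : ℝ))).card : ℝ)

/-- `P` is `dev_{2,3}(ε₁,ε₂)`-regular with respect to the triples `R`. -/
def Decomp.regWrt {V : Finset ℕ} {ι κ : Type} (P : Decomp V ι κ)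
    (R : Finset (ℕ × ℕ × ℕ)) (ε₁ ε₂ : ℝ) : Prop :=
  (1 - ε₁) * (V.card : ℝ) ^ 3 ≤
    (((V ×ˢ V ×ˢ V).filter fun p =>
      ∃ i j k α β γ, p ∈ (P.triadOf i j k α β γ).K3 ∧
        dev23 R (P.triadOf i j k α β γ) ε₁ ε₂).card : ℝ)

/-- The triad `G^{ijk}_{α,β,γ}` of `P` is `μ`-non-trivial. -/
def Decomp.nonTrivTriad {V : Finset ℕ} {t ℓ : ℕ} (P : Decomp V (Fin t) (Fin ℓ)) (μ : ℝ)
    (i j k : Fin t) (α β γ : Fin ℓ) : Prop :=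
  μ * (V.card : ℝ) / (t : ℝ) ≤ ((P.part i).card : ℝ) ∧
  μ * (V.card : ℝ) / (t : ℝ) ≤ ((P.part j).card : ℝ) ∧
  μ * (V.card : ℝ) / (t : ℝ) ≤ ((P.part k).card : ℝ) ∧
  μ * ((P.part i).card : ℝ) * ((P.part j).card : ℝ) / (ℓ : ℝ) ≤ ((P.pairs i j α).card : ℝ) ∧
  μ * ((P.part i).card : ℝ) * ((P.part k).card : ℝ) / (ℓ : ℝ) ≤ ((P.pairs i k β).card : ℝ) ∧
  μ * ((P.part j).card : ℝ) * ((P.part k).card : ℝ) / (ℓ : ℝ) ≤ ((P.pairs j k γ).card : ℝ)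

/-- `H` has a `dev_{2,3}(ε₁,ε₂)`-regular `(t,ℓ,ε₁,ε₂)`-decomposition. -/
def GoodDecomp (H : ThreeGraph) (t ℓ : ℕ) (ε₁ ε₂ : ℝ) : Prop :=
  ∃ P : Decomp H.verts (Fin t) (Fin ℓ), P.isReg ε₁ ε₂ ∧ P.regWrt H.obar ε₁ ε₂

def ThreeGraph.Iso (H₁ H₂ : ThreeGraph) : Prop :=
  ∃ f : ℕ → ℕ, Set.BijOn f ↑H₁.verts ↑H₂.verts ∧
    ∀ x ∈ H₁.verts, ∀ y ∈ H₁.verts, ∀ z ∈ H₁.verts,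
      (({x, y, z} : Finset ℕ) ∈ H₁.edges ↔ ({f x, f y, f z} : Finset ℕ) ∈ H₂.edges)

def ThreeGraph.induce (H : ThreeGraph) (W : Finset ℕ) : ThreeGraph where
  verts := H.verts ∩ W
  edges := H.edges.filter fun e => e ⊆ W
  edges_sub := by
    intro e he
    rw [Finset.mem_filter] at he
    obtain ⟨hsub, hcard⟩ := H.edges_sub e he.1
    exact ⟨fun x hx => Finset.mem_inter.mpr ⟨hsub hx, he.2 hx⟩, hcard⟩

/-- A hereditary property of 3-graphs. -/
def Hereditary (ℋ : Set ThreeGraph) : Prop :=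
  (∀ H₁ H₂ : ThreeGraph, ThreeGraph.Iso H₁ H₂ → H₁ ∈ ℋ → H₂ ∈ ℋ) ∧
  (∀ H ∈ ℋ, ∀ W : Finset ℕ, H.induce W ∈ ℋ)

/-- The statement `ψ(ε₁,ε₂,T,L,ℋ)`. -/
def psi (ε₁ : ℝ) (ε₂ : ℕ → ℝ) (T L : ℕ) (ℋ : Set ThreeGraph) : Prop :=
  ∃ n₀ : ℕ, ∀ H ∈ ℋ, n₀ ≤ H.verts.card →
    ∃ t ℓ : ℕ, 1 ≤ t ∧ t ≤ T ∧ 1 ≤ ℓ ∧ ℓ ≤ L ∧ GoodDecomp H t ℓ ε₁ (ε₂ ℓ)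

/-- `L_ℋ(ε₁,ε₂)`: minimal `L` such that `ψ(ε₁,ε₂,T,L,ℋ)` holds for some `T ≥ 1`. -/
noncomputable def Lfun (ℋ : Set ThreeGraph) (ε₁ : ℝ) (ε₂ : ℕ → ℝ) : ℕ :=
  sInf {L : ℕ | ∃ T : ℕ, 1 ≤ T ∧ psi ε₁ ε₂ T L ℋ}

def InZeroOne (f : ℕ → ℝ) : Prop := ∀ x, 0 < f x ∧ f x ≤ 1

/-- "For all sufficiently small `ε₁ > 0` and all `ε₂` tending to `0` sufficiently fast, `Φ`". -/
def SmallEps (Φ : ℝ → (ℕ → ℝ) → Prop) : Prop :=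
  ∃ e₁ : ℝ, 0 < e₁ ∧ ∀ ε₁ : ℝ, 0 < ε₁ → ε₁ < e₁ →
    ∃ δ : ℕ → ℝ, InZeroOne δ ∧
      ∀ ε₂ : ℕ → ℝ, InZeroOne ε₂ → (∀ x, ε₂ x ≤ δ x) → Φ ε₁ ε₂

/-- The `VC₂`-dimension of `H` is at least `k`. -/
def ThreeGraph.VC2AtLeast (H : ThreeGraph) (k : ℕ) : Prop :=
  ∃ a b : Fin k → ℕ, ∃ c : Finset (Fin k × Fin k) → ℕ,
    (∀ i, a i ∈ H.verts) ∧ (∀ i, b i ∈ H.verts) ∧ (∀ S, c S ∈ H.verts) ∧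
    ∀ (i j : Fin k) (S : Finset (Fin k × Fin k)),
      (({a i, b j, c S} : Finset ℕ) ∈ H.edges ↔ (i, j) ∈ S)

/-- `K₃[A,B,C]`: the triples meeting each of `A`, `B`, `C`. -/
def K3Parts (A B C : Finset ℕ) : Finset (Finset ℕ) :=
  (A ×ˢ B ×ˢ C).image fun p => ({p.1, p.2.1, p.2.2} : Finset ℕ)

/-- Neighborhood of `u` in the pair-set `W`, inside ambient set `V`. -/
def Nbhd (V : Finset ℕ) (W : Finset (ℕ × ℕ)) (u : ℕ) : Finset ℕ :=
  V.filter fun v => (u, v) ∈ W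

/-- An edge-colored bigraph `(U,V;E₀,E₁,E₂)`. -/
structure ECBigraph where
  left : Finset ℕ
  right : Finset ℕ
  E0 : Finset (ℕ × ℕ)
  E1 : Finset (ℕ × ℕ)
  E2 : Finset (ℕ × ℕ)
  disj01 : Disjoint E0 E1
  disj02 : Disjoint E0 E2
  disj12 : Disjoint E1 E2
  cover : E0 ∪ E1 ∪ E2 = left ×ˢ right

/-- `G` contains an `E₀/E₁`-copy of `U_bg(k)`. -/
def ECBigraph.CopyUbg (G : ECBigraph) (k : ℕ) : Prop :=
  ∃ u : Finset (Fin k) → ℕ, ∃ v : Fin k → ℕ,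
    (∀ S, u S ∈ G.left) ∧ (∀ i, v i ∈ G.right) ∧
    ∀ (S : Finset (Fin k)) (i : Fin k),
      (i ∈ S → (u S, v i) ∈ G.E1) ∧ (i ∉ S → (u S, v i) ∈ G.E0)

/-- `G` contains an `E₀/E₁`-copy of the bigraph `R`. -/
def ECBigraph.Copy01 (G : ECBigraph) (R : Bigraph) : Prop :=
  ∃ u v : ℕ → ℕ,
    (∀ a ∈ R.left, u a ∈ G.left) ∧ (∀ b ∈ R.right, v b ∈ G.right) ∧
    ∀ a ∈ R.left, ∀ b ∈ R.right,
      ((a, b) ∈ R.edges → (u a, v b) ∈ G.E1) ∧ ((a, b) ∉ R.edges → (u a, v b) ∈ G.E0)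

/-- `K₂[A,B]`: the crossing (unordered) pairs. -/
def pairsAB (A B : Finset ℕ) : Finset (Finset ℕ) :=
  (A ×ˢ B).image fun p => ({p.1, p.2} : Finset ℕ)

/-- A bipartite `U`-colored graph `Γ = (A ∪ B, (P_u)_{u ∈ U})`. -/
structure BipColored (U : Finset ℕ) where
  A : Finset ℕ
  B : Finset ℕ
  disjAB : Disjoint A B
  P : ℕ → Finset (Finset ℕ)
  P_disj : ∀ u ∈ U, ∀ u' ∈ U, u ≠ u' → Disjoint (P u) (P u')
  P_cover : U.biUnion P = pairsAB A B

/-- The bipartite graph `(A ∪ B, P_u)` of a color, as a bigraph (ordered pairs `P̄_u`). -/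
def BipColored.colorBG {U : Finset ℕ} (Γ : BipColored U) (u : ℕ) : Bigraph where
  left := Γ.A
  right := Γ.B
  edges := (Γ.A ×ˢ Γ.B).filter fun p => ({p.1, p.2} : Finset ℕ) ∈ Γ.P u
  edges_sub := Finset.filter_subset _ _

/-- `H` is an `(n,Γ)`-blowup of `G` with the explicit family `Cfam` of new vertex classes. -/
def IsBlowupWith (G : Bigraph) (n : ℕ) (Γ : BipColored G.left) (Cfam : ℕ → Finset ℕ)
    (H : ThreeGraph) : Prop :=
  (∀ v ∈ G.right, (Cfam v).card = n) ∧
  (∀ v ∈ G.right, ∀ v' ∈ G.right, v ≠ v' → Disjoint (Cfam v) (Cfam v')) ∧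
  (∀ v ∈ G.right, Disjoint (Cfam v) (Γ.A ∪ Γ.B)) ∧
  H.verts = Γ.A ∪ Γ.B ∪ G.right.biUnion Cfam ∧
  ∀ u ∈ G.left, ∀ v ∈ G.right, ∀ e ∈ Γ.P u, ∀ z ∈ Cfam v,
    (((u, v) ∈ G.edges → insert z e ∈ H.edges) ∧ ((u, v) ∉ G.edges → insert z e ∉ H.edges))

def IsBlowup (G : Bigraph) (n : ℕ) (Γ : BipColored G.left) (H : ThreeGraph) : Prop :=
  ∃ Cfam : ℕ → Finset ℕ, IsBlowupWith G n Γ Cfam H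

def ThreeGraph.ContainsInduced (H H' : ThreeGraph) : Prop :=
  ∃ W : Finset ℕ, ThreeGraph.Iso (H.induce W) H'

/-- The `G`-dimension of `H` is at least `n`. -/
def GDimAtLeast (G : Bigraph) (H : ThreeGraph) (n : ℕ) : Prop :=
  ∀ Γ : BipColored G.left, Γ.A.card = n → Γ.B.card = n →
    ∃ H' : ThreeGraph, IsBlowup G n Γ H' ∧ H.ContainsInduced H'

/-- `G ∈ B_ℋ`: `G` is irreducible and `ℋ` has infinite `G`-dimension. -/
def InBH (ℋ : Set ThreeGraph) (G : Bigraph) : Prop :=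
  G.Irreducible ∧ ∀ m : ℕ, ∃ H ∈ ℋ, GDimAtLeast G H m

/-- An encoding of the bigraph `R` in `(H,P)`, where `Rtrip = Ē(H)`. -/
def Encoding {V : Finset ℕ} {t ℓ : ℕ} (R : Bigraph) (Rtrip : Finset (ℕ × ℕ × ℕ))
    (P : Decomp V (Fin t) (Fin ℓ)) (ε₂ : ℝ) : Prop :=
  ∃ j₀ k₀ : Fin t, j₀ ≠ k₀ ∧
    ∃ f : ℕ → Fin ℓ, ∃ g : ℕ → Fin t × Fin ℓ × Fin ℓ,
      (∀ u ∈ R.left, (P.pairBG j₀ k₀ (f u)).dev2 ε₂ (1 / (ℓ : ℝ))) ∧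
      (∀ v ∈ R.right,
        (P.pairBG (g v).1 j₀ (g v).2.1).dev2 ε₂ (1 / (ℓ : ℝ)) ∧
        (P.pairBG (g v).1 k₀ (g v).2.2).dev2 ε₂ (1 / (ℓ : ℝ))) ∧
      ∀ u ∈ R.left, ∀ v ∈ R.right,
        (((u, v) ∈ R.edges →
          ((P.triadOf (g v).1 j₀ k₀ (g v).2.1 (g v).2.2 (f u)).K3.card : ℝ) / 2 ≤
            ((Rtrip ∩ (P.triadOf (g v).1 j₀ k₀ (g v).2.1 (g v).2.2 (f u)).K3).card : ℝ)) ∧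
         ((u, v) ∉ R.edges →
          ((Rtrip ∩ (P.triadOf (g v).1 j₀ k₀ (g v).2.1 (g v).2.2 (f u)).K3).card : ℝ) <
            ((P.triadOf (g v).1 j₀ k₀ (g v).2.1 (g v).2.2 (f u)).K3.card : ℝ) / 2))

def encodeSet (S : Finset ℕ) : ℕ := ∑ i ∈ S, 2 ^ i

/-- The bigraph `U_bg(k)` realized on `ℕ`, with subsets of `[k]` encoded in binary. -/
def Ubg (k : ℕ) : Bigraph where
  left := ((Finset.range k).powerset).image encodeSet
  right := Finset.range k
  edges := ((Finset.range k).powerset).biUnion fun S => S.image fun i => (encodeSet S, i)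
  edges_sub := by
    intro p hp
    simp only [Finset.mem_biUnion, Finset.mem_image, Finset.mem_powerset] at hp
    obtain ⟨S, hS, i, hi, rfl⟩ := hp
    refine Finset.mem_product.mpr ⟨?_, ?_⟩
    · exact Finset.mem_image.mpr ⟨S, Finset.mem_powerset.mpr hS, rfl⟩
    · exact hS hi

/-- The octahedral sum of `F` over `X × Y × Z`. -/
noncomputable def octSum (X Y Z : Finset ℕ) (F : ℕ → ℕ → ℕ → ℝ) : ℝ :=
  ∑ u₀ ∈ X, ∑ u₁ ∈ X, ∑ w₀ ∈ Y, ∑ w₁ ∈ Y, ∑ z₀ ∈ Z, ∑ z₁ ∈ Z,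
    F u₀ w₀ z₀ * F u₀ w₀ z₁ * F u₀ w₁ z₀ * F u₀ w₁ z₁ *
      F u₁ w₀ z₀ * F u₁ w₀ z₁ * F u₁ w₁ z₀ * F u₁ w₁ z₁

/-- The number of (possibly degenerate) four-cycles, weighted by `c`. -/
noncomputable def fourCycleSum (X Z : Finset ℕ) (c : ℕ → ℕ → ℝ) : ℝ :=
  ∑ x₀ ∈ X, ∑ x₁ ∈ X, ∑ z₀ ∈ Z, ∑ z₁ ∈ Z, c x₀ z₀ * c x₀ z₁ * c x₁ z₀ * c x₁ z₁

lemma sq_sum_eq_sum_sum (s : Finset ℕ) (f : ℕ → ℝ) :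
    (∑ i ∈ s, f i) ^ 2 = ∑ i ∈ s, ∑ j ∈ s, f i * f j := by
  rw [sq, Finset.sum_mul_sum]

lemma fourCycleSum_eq_sum_sq (X Z : Finset ℕ) (c : ℕ → ℕ → ℝ) :
    fourCycleSum X Z c = ∑ z₀ ∈ Z, ∑ z₁ ∈ Z, (∑ x ∈ X, c x z₀ * c x z₁) ^ 2 := by
  unfold fourCycleSum
  simp_rw [sq_sum_eq_sum_sum]
  rw [Finset.sum_comm' (t' := X) (s' := fun _ => X) (by simp)]
  rw [Finset.sum_congr rfl fun x _ => Finset.sum_comm]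
  rw [Finset.sum_comm]
  refine Finset.sum_congr rfl fun z₀ _ => ?_
  rw [Finset.sum_congr rfl fun x _ => Finset.sum_comm]
  rw [Finset.sum_comm]
  refine Finset.sum_congr rfl fun z₁ _ => ?_
  refine Finset.sum_congr rfl fun x₀ _ => Finset.sum_congr rfl fun x₁ _ => by ring

lemma cauchy_schwarz_two (s t : Finset ℕ) (f g : ℕ → ℕ → ℝ) :
    (∑ i ∈ s, ∑ j ∈ t, f i j * g i j) ^ 2 ≤
      (∑ i ∈ s, ∑ j ∈ t, f i j ^ 2) * ∑ i ∈ s, ∑ j ∈ t, g i j ^ 2 := by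
  simp_rw [← Finset.sum_product']
  exact Finset.sum_mul_sq_le_sq_mul_sq _ _ _

lemma cauchy_schwarz_three (s t r : Finset ℕ) (f g : ℕ → ℕ → ℕ → ℝ) :
    (∑ i ∈ s, ∑ j ∈ t, ∑ k ∈ r, f i j k * g i j k) ^ 2 ≤
      (∑ i ∈ s, ∑ j ∈ t, ∑ k ∈ r, f i j k ^ 2) * ∑ i ∈ s, ∑ j ∈ t, ∑ k ∈ r, g i j k ^ 2 := by
  simp_rw [← Finset.sum_product']
  exact Finset.sum_mul_sq_le_sq_mul_sq _ _ _

lemma cauchy_schwarz_four (s t r q : Finset ℕ) (f g : ℕ → ℕ → ℕ → ℕ → ℝ) :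
    (∑ i ∈ s, ∑ j ∈ t, ∑ k ∈ r, ∑ l ∈ q, f i j k l * g i j k l) ^ 2 ≤
      (∑ i ∈ s, ∑ j ∈ t, ∑ k ∈ r, ∑ l ∈ q, f i j k l ^ 2) *
        ∑ i ∈ s, ∑ j ∈ t, ∑ k ∈ r, ∑ l ∈ q, g i j k l ^ 2 := by
  simp_rw [← Finset.sum_product']
  exact Finset.sum_mul_sq_le_sq_mul_sq _ _ _

/-- The Gowers–Cauchy–Schwarz inequality for a function of triples against pair functions. -/
theorem gowers_cauchy_schwarz (X Y Z : Finset ℕ) (F : ℕ → ℕ → ℕ → ℝ) (a b c : ℕ → ℕ → ℝ) :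
    (∑ x ∈ X, ∑ y ∈ Y, ∑ z ∈ Z, F x y z * a x y * b y z * c x z) ^ 8 ≤
      (∑ x ∈ X, ∑ y ∈ Y, a x y ^ 2) ^ 4 *
      (∑ y ∈ Y, ∑ z₀ ∈ Z, ∑ z₁ ∈ Z, (b y z₀ * b y z₁) ^ 2) ^ 2 *
      (∑ x₀ ∈ X, ∑ x₁ ∈ X, ∑ z₀ ∈ Z, ∑ z₁ ∈ Z, (c x₀ z₀ * c x₀ z₁ * c x₁ z₀ * c x₁ z₁) ^ 2) *
      octSum X Y Z F := by
  set S := ∑ x ∈ X, ∑ y ∈ Y, ∑ z ∈ Z, F x y z * a x y * b y z * c x z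
  set Q₁ := ∑ x ∈ X, ∑ y ∈ Y, (∑ z ∈ Z, F x y z * b y z * c x z) ^ 2 with hQ₁
  set Q₂ := ∑ y ∈ Y, ∑ z₀ ∈ Z, ∑ z₁ ∈ Z,
    (∑ x ∈ X, F x y z₀ * F x y z₁ * c x z₀ * c x z₁) ^ 2 with hQ₂
  set A := ∑ x ∈ X, ∑ y ∈ Y, a x y ^ 2
  set B := ∑ y ∈ Y, ∑ z₀ ∈ Z, ∑ z₁ ∈ Z, (b y z₀ * b y z₁) ^ 2
  set D := ∑ x₀ ∈ X, ∑ x₁ ∈ X, ∑ z₀ ∈ Z, ∑ z₁ ∈ Z,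
    (c x₀ z₀ * c x₀ z₁ * c x₁ z₀ * c x₁ z₁) ^ 2
  have hS : S ^ 2 ≤ A * Q₁ := by
    have h := cauchy_schwarz_two X Y a (fun x y => ∑ z ∈ Z, F x y z * b y z * c x z)
    refine le_trans (le_of_eq ?_) h
    congr 1
    refine Finset.sum_congr rfl fun x _ => Finset.sum_congr rfl fun y _ => ?_
    rw [Finset.mul_sum]
    exact Finset.sum_congr rfl fun z _ => by ring
  have e₁ : Q₁ = ∑ y ∈ Y, ∑ z₀ ∈ Z, ∑ z₁ ∈ Z,
      (b y z₀ * b y z₁) * ∑ x ∈ X, F x y z₀ * F x y z₁ * c x z₀ * c x z₁ := by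
    rw [hQ₁, Finset.sum_comm]
    refine Finset.sum_congr rfl fun y _ => ?_
    simp_rw [sq_sum_eq_sum_sum]
    rw [Finset.sum_comm]
    refine Finset.sum_congr rfl fun z₀ _ => ?_
    rw [Finset.sum_comm]
    refine Finset.sum_congr rfl fun z₁ _ => ?_
    rw [Finset.mul_sum]
    exact Finset.sum_congr rfl fun x _ => by ring
  have h₁ : Q₁ ^ 2 ≤ B * Q₂ := by
    rw [e₁]
    exact cauchy_schwarz_three Y Z Z _ _
  have e₂ : Q₂ = ∑ x₀ ∈ X, ∑ x₁ ∈ X, ∑ z₀ ∈ Z, ∑ z₁ ∈ Z,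
      (c x₀ z₀ * c x₀ z₁ * c x₁ z₀ * c x₁ z₁) *
        ∑ y ∈ Y, F x₀ y z₀ * F x₀ y z₁ * F x₁ y z₀ * F x₁ y z₁ := by
    rw [hQ₂]
    simp_rw [sq_sum_eq_sum_sum, Finset.mul_sum, ← Finset.sum_product']
    refine Finset.sum_nbij' (fun p => ⟨p.2.2.2.1, p.2.2.2.2, p.2.1, p.2.2.1, p.1⟩)
      (fun p => ⟨p.2.2.2.2, p.2.2.1, p.2.2.2.1, p.1, p.2.1⟩) ?_ ?_ ?_ ?_ ?_
    · simp only [Finset.mem_product]; tauto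
    · simp only [Finset.mem_product]; tauto
    · intros; rfl
    · intros; rfl
    · intros; ring
  have e₃ : ∑ x₀ ∈ X, ∑ x₁ ∈ X, ∑ z₀ ∈ Z, ∑ z₁ ∈ Z,
      (∑ y ∈ Y, F x₀ y z₀ * F x₀ y z₁ * F x₁ y z₀ * F x₁ y z₁) ^ 2 = octSum X Y Z F := by
    unfold octSum
    refine Finset.sum_congr rfl fun x₀ _ => Finset.sum_congr rfl fun x₁ _ => ?_
    simp_rw [sq_sum_eq_sum_sum, ← Finset.sum_product']
    refine Finset.sum_nbij' (fun p => ⟨p.2.2.1, p.2.2.2, p.1, p.2.1⟩)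
      (fun p => ⟨p.2.2.1, p.2.2.2, p.1, p.2.1⟩) ?_ ?_ ?_ ?_ ?_
    · simp only [Finset.mem_product]; tauto
    · simp only [Finset.mem_product]; tauto
    · intros; rfl
    · intros; rfl
    · intros; ring
  have h₂ : Q₂ ^ 2 ≤ D * octSum X Y Z F := by
    rw [e₂, ← e₃]
    exact cauchy_schwarz_four X X Z Z _ _
  have hA : 0 ≤ A := Finset.sum_nonneg fun _ _ => Finset.sum_nonneg fun _ _ => sq_nonneg _
  have hB : 0 ≤ B := Finset.sum_nonneg fun _ _ => Finset.sum_nonneg fun _ _ =>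
    Finset.sum_nonneg fun _ _ => sq_nonneg _
  have hQ₁0 : 0 ≤ Q₁ := Finset.sum_nonneg fun _ _ => Finset.sum_nonneg fun _ _ => sq_nonneg _
  have hQ₂0 : 0 ≤ Q₂ := Finset.sum_nonneg fun _ _ => Finset.sum_nonneg fun _ _ =>
    Finset.sum_nonneg fun _ _ => sq_nonneg _
  calc S ^ 8 = (S ^ 2) ^ 4 := by ring
    _ ≤ (A * Q₁) ^ 4 := by gcongr
    _ = A ^ 4 * (Q₁ ^ 2) ^ 2 := by ring
    _ ≤ A ^ 4 * (B * Q₂) ^ 2 := by gcongr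
    _ = A ^ 4 * B ^ 2 * Q₂ ^ 2 := by ring
    _ ≤ A ^ 4 * B ^ 2 * (D * octSum X Y Z F) := by gcongr
    _ = _ := by ring

/-- A bigraph with small deviation has few four-cycles. -/
theorem fourCycleSum_le_of_dev (X Y : Finset ℕ) (g : ℕ → ℕ → ℝ) (d e : ℝ)
    (hd : 0 ≤ d) (he : 0 ≤ e)
    (hdev : fourCycleSum X Y g ≤ e ^ 4 * (X.card : ℝ) ^ 2 * (Y.card : ℝ) ^ 2) :
    fourCycleSum X Y (fun x y => d + g x y) ≤
      4 * (d + e) ^ 4 * (X.card : ℝ) ^ 2 * (Y.card : ℝ) ^ 2 := by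
  set G : ℕ → ℝ := fun z => ∑ x ∈ X, g x z with hG
  set D : ℝ := fourCycleSum X Y g with hD
  have hD' : D = ∑ z₀ ∈ Y, ∑ z₁ ∈ Y, (∑ x ∈ X, g x z₀ * g x z₁) ^ 2 :=
    fourCycleSum_eq_sum_sq X Y g
  have hD'' : D = ∑ x₀ ∈ X, ∑ x₁ ∈ X, (∑ z ∈ Y, g x₀ z * g x₁ z) ^ 2 := by
    rw [hD]; unfold fourCycleSum
    refine Finset.sum_congr rfl fun x₀ _ => Finset.sum_congr rfl fun x₁ _ => ?_
    rw [sq_sum_eq_sum_sum]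
    exact Finset.sum_congr rfl fun z₀ _ => Finset.sum_congr rfl fun z₁ _ => by ring
  have hGsum : ∑ z ∈ Y, G z ^ 2 ≤ e ^ 2 * (X.card : ℝ) ^ 2 * (Y.card : ℝ) := by
    have h1 : ∑ z ∈ Y, G z ^ 2 = ∑ x₀ ∈ X, ∑ x₁ ∈ X, 1 * ∑ z ∈ Y, g x₀ z * g x₁ z := by
      simp_rw [hG, sq_sum_eq_sum_sum, one_mul]
      rw [Finset.sum_comm]
      exact Finset.sum_congr rfl fun x₀ _ => Finset.sum_comm
    have h2 : (∑ z ∈ Y, G z ^ 2) ^ 2 ≤ (e ^ 2 * (X.card : ℝ) ^ 2 * (Y.card : ℝ)) ^ 2 := by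
      rw [h1]
      refine (cauchy_schwarz_two X X (fun _ _ => 1) _).trans ?_
      rw [← hD'']
      simp only [one_pow, Finset.sum_const, nsmul_eq_mul, mul_one]
      calc (X.card : ℝ) * X.card * D
          ≤ (X.card : ℝ) * X.card * (e ^ 4 * (X.card : ℝ) ^ 2 * (Y.card : ℝ) ^ 2) := by gcongr
        _ = _ := by ring
    exact le_of_sq_le_sq h2 (by positivity)
  rw [fourCycleSum_eq_sum_sq]
  have key : ∀ z₀ z₁ : ℕ, (∑ x ∈ X, (d + g x z₀) * (d + g x z₁)) ^ 2 ≤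
      4 * (d ^ 4 * (X.card : ℝ) ^ 2 + d ^ 2 * G z₀ ^ 2 + d ^ 2 * G z₁ ^ 2 +
        (∑ x ∈ X, g x z₀ * g x z₁) ^ 2) := by
    intro z₀ z₁
    have : ∑ x ∈ X, (d + g x z₀) * (d + g x z₁) =
        d ^ 2 * X.card + d * G z₀ + d * G z₁ + ∑ x ∈ X, g x z₀ * g x z₁ := by
      simp_rw [hG, Finset.mul_sum]
      rw [← nsmul_eq_mul' (d ^ 2) X.card, ← Finset.sum_const, ← Finset.sum_add_distrib,
        ← Finset.sum_add_distrib, ← Finset.sum_add_distrib]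
      exact Finset.sum_congr rfl fun x _ => by ring
    rw [this]
    generalize ∑ x ∈ X, g x z₀ * g x z₁ = s
    generalize G z₀ = u
    generalize G z₁ = v
    generalize (X.card : ℝ) = n
    nlinarith [sq_nonneg (d ^ 2 * n - d * u), sq_nonneg (d ^ 2 * n - d * v),
      sq_nonneg (d ^ 2 * n - s), sq_nonneg (d * u - d * v), sq_nonneg (d * u - s),
      sq_nonneg (d * v - s)]
  calc ∑ z₀ ∈ Y, ∑ z₁ ∈ Y, (∑ x ∈ X, (d + g x z₀) * (d + g x z₁)) ^ 2
      ≤ ∑ z₀ ∈ Y, ∑ z₁ ∈ Y, 4 * (d ^ 4 * (X.card : ℝ) ^ 2 + d ^ 2 * G z₀ ^ 2 + d ^ 2 * G z₁ ^ 2 +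
        (∑ x ∈ X, g x z₀ * g x z₁) ^ 2) :=
        Finset.sum_le_sum fun _ _ => Finset.sum_le_sum fun _ _ => key _ _
    _ = 4 * (d ^ 4 * (X.card : ℝ) ^ 2 * (Y.card : ℝ) ^ 2 +
          2 * (d ^ 2 * Y.card * ∑ z ∈ Y, G z ^ 2) + D) := by
        rw [hD']
        simp_rw [← Finset.mul_sum, Finset.sum_add_distrib, ← Finset.mul_sum, Finset.sum_const,
          nsmul_eq_mul, ← Finset.mul_sum]
        ring
    _ ≤ 4 * (d ^ 4 * (X.card : ℝ) ^ 2 * (Y.card : ℝ) ^ 2 +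
          2 * (d ^ 2 * Y.card * (e ^ 2 * (X.card : ℝ) ^ 2 * (Y.card : ℝ))) +
          e ^ 4 * (X.card : ℝ) ^ 2 * (Y.card : ℝ) ^ 2) := by gcongr
    _ = 4 * (d ^ 2 + e ^ 2) ^ 2 * (X.card : ℝ) ^ 2 * (Y.card : ℝ) ^ 2 := by ring
    _ ≤ 4 * ((d + e) ^ 2) ^ 2 * (X.card : ℝ) ^ 2 * (Y.card : ℝ) ^ 2 := by
        gcongr
        nlinarith [mul_nonneg hd he]
    _ = _ := by ring

lemma Bigraph.density_nonneg (B : Bigraph) : 0 ≤ B.density := by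
  unfold Bigraph.density; positivity

lemma Bigraph.card_edges_eq (B : Bigraph) :
    (B.edges.card : ℝ) = B.density * ((B.left.card : ℝ) * B.right.card) := by
  unfold Bigraph.density
  by_cases h : (B.left.card : ℝ) * B.right.card = 0
  · have h1 : B.edges.card ≤ B.left.card * B.right.card := by
      rw [← Finset.card_product]; exact Finset.card_le_card B.edges_sub
    have h2 : (B.edges.card : ℝ) ≤ (B.left.card : ℝ) * B.right.card := by exact_mod_cast h1
    rw [h] at h2 ⊢
    have : (0 : ℝ) ≤ B.edges.card := by positivity
    linarith
  · rw [div_mul_cancel₀ _ h]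

/-- The indicator function of the edge set of a bigraph. -/
noncomputable def Bigraph.ind (B : Bigraph) (x y : ℕ) : ℝ := if (x, y) ∈ B.edges then 1 else 0

lemma Bigraph.ind_nonneg (B : Bigraph) (x y : ℕ) : 0 ≤ B.ind x y := by
  unfold Bigraph.ind; split_ifs <;> norm_num

lemma Bigraph.ind_sq (B : Bigraph) (x y : ℕ) : B.ind x y ^ 2 = B.ind x y := by
  unfold Bigraph.ind; split_ifs <;> norm_num

lemma Bigraph.ind_eq (B : Bigraph) : B.ind = fun x y => B.density + B.gfun x y := by
  funext x y
  unfold Bigraph.ind Bigraph.gfun; split_ifs <;> ring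

lemma Bigraph.sum_ind (B : Bigraph) :
    ∑ x ∈ B.left, ∑ y ∈ B.right, B.ind x y = B.density * ((B.left.card : ℝ) * B.right.card) := by
  rw [← B.card_edges_eq, ← Finset.sum_product']
  unfold Bigraph.ind
  rw [Finset.sum_ite_mem, Finset.inter_eq_right.mpr B.edges_sub]
  simp

lemma Bigraph.fourCycleSum_ind_le (B : Bigraph) (ε d e : ℝ) (he : 0 ≤ e) (hε : ε ≤ e ^ 4)
    (h : B.dev2 ε d) :
    fourCycleSum B.left B.right B.ind ≤
      4 * (B.density + e) ^ 4 * (B.left.card : ℝ) ^ 2 * (B.right.card : ℝ) ^ 2 := by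
  rw [B.ind_eq]
  refine fourCycleSum_le_of_dev _ _ _ _ _ B.density_nonneg he ?_
  refine le_trans h.2 ?_
  gcongr

lemma Bigraph.cherry_sq_le (B : Bigraph) :
    (∑ y ∈ B.left, ∑ z₀ ∈ B.right, ∑ z₁ ∈ B.right, B.ind y z₀ * B.ind y z₁) ^ 2 ≤
      (B.right.card : ℝ) ^ 2 * fourCycleSum B.left B.right B.ind := by
  rw [fourCycleSum_eq_sum_sq]
  have h := cauchy_schwarz_two B.right B.right (fun _ _ => 1)
    (fun z₀ z₁ => ∑ y ∈ B.left, B.ind y z₀ * B.ind y z₁)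
  have e1 : ∑ y ∈ B.left, ∑ z₀ ∈ B.right, ∑ z₁ ∈ B.right, B.ind y z₀ * B.ind y z₁ =
      ∑ z₀ ∈ B.right, ∑ z₁ ∈ B.right, 1 * ∑ y ∈ B.left, B.ind y z₀ * B.ind y z₁ := by
    rw [Finset.sum_comm]
    refine Finset.sum_congr rfl fun z₀ _ => ?_
    rw [Finset.sum_comm]
    simp
  rw [e1]
  refine h.trans (le_of_eq ?_)
  simp only [one_pow, Finset.sum_const, nsmul_eq_mul, mul_one]
  ring

/-- The normalising factor of a triad, with a margin `e` in each density. -/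
noncomputable def Triad.weight (G : Triad) (e : ℝ) : ℝ :=
  ((G.bXY.density + e) * (G.bYZ.density + e) * (G.bXZ.density + e)) *
    ((G.X.card : ℝ) * G.Y.card * G.Z.card)

lemma Triad.weight_nonneg (G : Triad) (e : ℝ) (he : 0 ≤ e) : 0 ≤ G.weight e := by
  unfold Triad.weight
  have := G.bXY.density_nonneg
  have := G.bYZ.density_nonneg
  have := G.bXZ.density_nonneg
  positivity

lemma hFun_mul_ind (R : Finset (ℕ × ℕ × ℕ)) (G : Triad) (x y z : ℕ) :
    hFun R G x y z * (G.bXY.ind x y * G.bYZ.ind y z * G.bXZ.ind x z) = hFun R G x y z := by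
  unfold hFun
  by_cases h : (x, y, z) ∈ G.K3
  · have h' := (Finset.mem_filter.mp h).2
    simp only at h'
    have h1 : G.bXY.ind x y = 1 := if_pos h'.1
    have h2 : G.bYZ.ind y z = 1 := if_pos h'.2.1
    have h3 : G.bXZ.ind x z = 1 := if_pos h'.2.2
    rw [h1, h2, h3]; ring
  · simp [h]

/-- A regular triad has no correlation with a product of a pair function and a vertex function. -/
theorem abs_sum_hFun_le (R : Finset (ℕ × ℕ × ℕ)) (G : Triad) (ε₁ ε₂ θ e : ℝ) (hθ : 0 ≤ θ)
    (he : 0 ≤ e) (he1 : e ≤ 1) (h1 : ε₁ ≤ θ ^ 8) (h2 : ε₂ ≤ e ^ 4) (hG : dev23 R G ε₁ ε₂)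
    (w : ℕ → ℕ → ℝ) (v : ℕ → ℝ) (hw0 : ∀ x y, 0 ≤ w x y) (hw1 : ∀ x y, w x y ≤ 1)
    (hv0 : ∀ z, 0 ≤ v z) (hv1 : ∀ z, v z ≤ 1) :
    |∑ x ∈ G.X, ∑ y ∈ G.Y, ∑ z ∈ G.Z, hFun R G x y z * (w x y * v z)| ≤ 2 * θ * G.weight e := by
  obtain ⟨dXY, dYZ, dXZ, p1, p2, p3, hXY, hXZ, hYZ, hdev⟩ := hG
  set D1 := G.bXY.density with hD1
  set D2 := G.bYZ.density with hD2
  set D3 := G.bXZ.density with hD3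
  have n1 : 0 ≤ D1 := G.bXY.density_nonneg
  have n2 : 0 ≤ D2 := G.bYZ.density_nonneg
  have n3 : 0 ≤ D3 := G.bXZ.density_nonneg
  have he4 : e ^ 4 ≤ e := by
    calc e ^ 4 ≤ e ^ 1 := pow_le_pow_of_le_one he he1 (by norm_num)
      _ = e := pow_one e
  have b1 : dXY ≤ D1 + e := by have := (abs_le.mp hXY.1).1; linarith
  have b2 : dYZ ≤ D2 + e := by have := (abs_le.mp hYZ.1).1; linarith
  have b3 : dXZ ≤ D3 + e := by have := (abs_le.mp hXZ.1).1; linarith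
  have gcs := gowers_cauchy_schwarz G.X G.Y G.Z (hFun R G)
    (fun x y => G.bXY.ind x y * w x y) (fun y z => G.bYZ.ind y z * v z) (fun x z => G.bXZ.ind x z)
  have eS : ∑ x ∈ G.X, ∑ y ∈ G.Y, ∑ z ∈ G.Z, hFun R G x y z * (w x y * v z) =
      ∑ x ∈ G.X, ∑ y ∈ G.Y, ∑ z ∈ G.Z, hFun R G x y z * (G.bXY.ind x y * w x y) *
        (G.bYZ.ind y z * v z) * G.bXZ.ind x z := by
    refine Finset.sum_congr rfl fun x _ => Finset.sum_congr rfl fun y _ =>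
      Finset.sum_congr rfl fun z _ => ?_
    calc hFun R G x y z * (w x y * v z) =
          hFun R G x y z * (G.bXY.ind x y * G.bYZ.ind y z * G.bXZ.ind x z) * (w x y * v z) := by
          rw [hFun_mul_ind]
      _ = _ := by ring
  rw [eS]
  set S := ∑ x ∈ G.X, ∑ y ∈ G.Y, ∑ z ∈ G.Z, hFun R G x y z * (G.bXY.ind x y * w x y) *
        (G.bYZ.ind y z * v z) * G.bXZ.ind x z
  have f1 : ∑ x ∈ G.X, ∑ y ∈ G.Y, (G.bXY.ind x y * w x y) ^ 2 ≤
      (D1 + e) * ((G.X.card : ℝ) * G.Y.card) := by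
    calc _ ≤ ∑ x ∈ G.X, ∑ y ∈ G.Y, G.bXY.ind x y := by
          refine Finset.sum_le_sum fun x _ => Finset.sum_le_sum fun y _ => ?_
          rw [mul_pow, Bigraph.ind_sq]
          exact mul_le_of_le_one_right (Bigraph.ind_nonneg _ _ _)
            (pow_le_one₀ (hw0 x y) (hw1 x y))
      _ = D1 * ((G.X.card : ℝ) * G.Y.card) := G.bXY.sum_ind
      _ ≤ _ := by gcongr; linarith
  have f2 : (∑ y ∈ G.Y, ∑ z₀ ∈ G.Z, ∑ z₁ ∈ G.Z,
      (G.bYZ.ind y z₀ * v z₀ * (G.bYZ.ind y z₁ * v z₁)) ^ 2) ^ 2 ≤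
      (G.Z.card : ℝ) ^ 2 * (4 * (D2 + e) ^ 4 * (G.Y.card : ℝ) ^ 2 * (G.Z.card : ℝ) ^ 2) := by
    calc _ ≤ (∑ y ∈ G.Y, ∑ z₀ ∈ G.Z, ∑ z₁ ∈ G.Z, G.bYZ.ind y z₀ * G.bYZ.ind y z₁) ^ 2 := by
          refine pow_le_pow_left₀ ?_ ?_ 2
          · exact Finset.sum_nonneg fun _ _ => Finset.sum_nonneg fun _ _ =>
              Finset.sum_nonneg fun _ _ => sq_nonneg _
          refine Finset.sum_le_sum fun y _ => Finset.sum_le_sum fun z₀ _ =>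
            Finset.sum_le_sum fun z₁ _ => ?_
          rw [mul_pow, mul_pow, mul_pow, Bigraph.ind_sq, Bigraph.ind_sq]
          refine mul_le_mul ?_ ?_ ?_ (Bigraph.ind_nonneg _ _ _)
          · exact mul_le_of_le_one_right (Bigraph.ind_nonneg _ _ _)
              (pow_le_one₀ (hv0 _) (hv1 _))
          · exact mul_le_of_le_one_right (Bigraph.ind_nonneg _ _ _)
              (pow_le_one₀ (hv0 _) (hv1 _))
          · exact mul_nonneg (Bigraph.ind_nonneg _ _ _) (sq_nonneg _)
      _ ≤ (G.Z.card : ℝ) ^ 2 * fourCycleSum G.Y G.Z G.bYZ.ind := G.bYZ.cherry_sq_le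
      _ ≤ _ := by
          have := G.bYZ.fourCycleSum_ind_le ε₂ dYZ e he h2 hYZ
          exact mul_le_mul_of_nonneg_left this (by positivity)
  have f3 : ∑ x₀ ∈ G.X, ∑ x₁ ∈ G.X, ∑ z₀ ∈ G.Z, ∑ z₁ ∈ G.Z,
      (G.bXZ.ind x₀ z₀ * G.bXZ.ind x₀ z₁ * G.bXZ.ind x₁ z₀ * G.bXZ.ind x₁ z₁) ^ 2 ≤
      4 * (D3 + e) ^ 4 * (G.X.card : ℝ) ^ 2 * (G.Z.card : ℝ) ^ 2 := by
    have := G.bXZ.fourCycleSum_ind_le ε₂ dXZ e he h2 hXZ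
    simp_rw [mul_pow, Bigraph.ind_sq]
    exact this
  have f4 : octSum G.X G.Y G.Z (hFun R G) ≤ θ ^ 8 * (D1 + e) ^ 4 * (D2 + e) ^ 4 * (D3 + e) ^ 4 *
      (G.X.card : ℝ) ^ 2 * (G.Y.card : ℝ) ^ 2 * (G.Z.card : ℝ) ^ 2 := by
    refine le_trans hdev ?_
    gcongr
  have key : S ^ 8 ≤ (2 * θ * G.weight e) ^ 8 := by
    refine gcs.trans ?_
    have o1 : 0 ≤ ∑ x ∈ G.X, ∑ y ∈ G.Y, (G.bXY.ind x y * w x y) ^ 2 :=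
      Finset.sum_nonneg fun _ _ => Finset.sum_nonneg fun _ _ => sq_nonneg _
    have o3 : 0 ≤ ∑ x₀ ∈ G.X, ∑ x₁ ∈ G.X, ∑ z₀ ∈ G.Z, ∑ z₁ ∈ G.Z,
      (G.bXZ.ind x₀ z₀ * G.bXZ.ind x₀ z₁ * G.bXZ.ind x₁ z₀ * G.bXZ.ind x₁ z₁) ^ 2 :=
      Finset.sum_nonneg fun _ _ => Finset.sum_nonneg fun _ _ =>
      Finset.sum_nonneg fun _ _ => Finset.sum_nonneg fun _ _ => sq_nonneg _
    have s1 := pow_le_pow_left₀ o1 f1 4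
    have s2 := mul_le_mul s1 f2 (sq_nonneg _) (by positivity)
    have s3 := mul_le_mul s2 f3 o3 (by positivity)
    have s4 := mul_le_mul_of_nonneg_left f4
      (mul_nonneg (mul_nonneg (pow_nonneg o1 4) (sq_nonneg (∑ y ∈ G.Y, ∑ z₀ ∈ G.Z, ∑ z₁ ∈ G.Z,
      (G.bYZ.ind y z₀ * v z₀ * (G.bYZ.ind y z₁ * v z₁)) ^ 2))) o3)
    refine s4.trans ((mul_le_mul_of_nonneg_right s3 (by positivity)).trans ?_)
    unfold Triad.weight
    rw [← hD1, ← hD2, ← hD3]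
    generalize D1 + e = q1 at *
    generalize D2 + e = q2 at *
    generalize D3 + e = q3 at *
    calc _ = 16 * (θ * (q1 * q2 * q3 * ((G.X.card : ℝ) * G.Y.card * G.Z.card))) ^ 8 := by ring
      _ ≤ 256 * (θ * (q1 * q2 * q3 * ((G.X.card : ℝ) * G.Y.card * G.Z.card))) ^ 8 := by
          have : 0 ≤ (θ * (q1 * q2 * q3 * ((G.X.card : ℝ) * G.Y.card * G.Z.card))) ^ 8 :=
            Even.pow_nonneg (by decide) _
          linarith
      _ = _ := by ring
  have hW : 0 ≤ 2 * θ * G.weight e := mul_nonneg (by positivity) (G.weight_nonneg e he)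
  have : |S| ^ 8 ≤ (2 * θ * G.weight e) ^ 8 := by
    rwa [Even.pow_abs (by decide)]
  exact le_of_pow_le_pow_left₀ (by norm_num) hW this

/-- In a regular triad, a relation depending only on pairs is nearly constant. -/
theorem card_minority_le (R : Finset (ℕ × ℕ × ℕ)) (G : Triad) (ε₁ ε₂ θ e : ℝ) (hθ : 0 ≤ θ)
    (he : 0 ≤ e) (he1 : e ≤ 1) (h1 : ε₁ ≤ θ ^ 8) (h2 : ε₂ ≤ e ^ 4) (hG : dev23 R G ε₁ ε₂)
    (A B C : Finset ℕ) (w : ℕ → ℕ → Prop)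
    (hw : ∀ x ∈ A, ∀ y ∈ B, ∀ z ∈ C, ((x, y, z) ∈ R ↔ w x y)) :
    (((A ×ˢ B ×ˢ C).filter fun p => p ∈ G.K3 ∧
      ¬(w p.1 p.2.1 ↔ 1 / 2 < relDensity R G)).card : ℝ) ≤ 4 * θ * G.weight e := by
  set d := relDensity R G with hd
  set σ : Prop := 1 / 2 < d with hσ
  have base := abs_sum_hFun_le R G ε₁ ε₂ θ e hθ he he1 h1 h2 hG
    (fun x y => if x ∈ A ∧ y ∈ B ∧ ¬(w x y ↔ σ) then 1 else 0) (fun z => if z ∈ C then 1 else 0)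
    (fun x y => by split_ifs <;> norm_num) (fun x y => by split_ifs <;> norm_num)
    (fun z => by split_ifs <;> norm_num) (fun z => by split_ifs <;> norm_num)
  set M := (A ×ˢ B ×ˢ C).filter fun p => p ∈ G.K3 ∧ ¬(w p.1 p.2.1 ↔ σ) with hM
  have hMs : M ⊆ G.X ×ˢ G.Y ×ˢ G.Z := by
    intro p hp
    exact (Finset.mem_filter.mp (Finset.mem_filter.mp hp).2.1).1
  have hsum : ∑ x ∈ G.X, ∑ y ∈ G.Y, ∑ z ∈ G.Z, hFun R G x y z *
      ((if x ∈ A ∧ y ∈ B ∧ ¬(w x y ↔ σ) then 1 else 0) * (if z ∈ C then 1 else 0)) =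
      M.card * (if σ then -d else 1 - d) := by
    rw [← nsmul_eq_mul, ← Finset.sum_const]
    rw [← Finset.inter_eq_right.mpr hMs, ← Finset.sum_ite_mem]
    simp_rw [← Finset.sum_product']
    refine Finset.sum_congr rfl fun p _ => ?_
    obtain ⟨x, y, z⟩ := p
    by_cases hp : (x, y, z) ∈ M
    · rw [if_pos hp]
      have hp' := Finset.mem_filter.mp hp
      simp only [Finset.mem_product] at hp'
      obtain ⟨⟨hx, hy, hz⟩, hK, hn⟩ := hp'
      rw [if_pos ⟨hx, hy, hn⟩, if_pos hz]
      have := hw x hx y hy z hz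
      unfold hFun
      rw [if_pos hK]
      by_cases hs : σ
      · have : (x, y, z) ∉ R := by tauto
        rw [if_neg this, if_pos hs]; ring
      · have : (x, y, z) ∈ R := by tauto
        rw [if_pos this, if_neg hs]; ring
    · rw [if_neg hp]
      by_cases hK : (x, y, z) ∈ G.K3
      · have : ¬ ((x ∈ A ∧ y ∈ B ∧ ¬(w x y ↔ σ)) ∧ z ∈ C) := by
          intro h
          exact hp (Finset.mem_filter.mpr ⟨by
            simp only [Finset.mem_product]; tauto, hK, h.1.2.2⟩)
        by_cases hz : z ∈ C
        · rw [if_neg (by tauto)]; ring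
        · rw [if_neg hz]; ring
      · unfold hFun; rw [if_neg hK]; ring
  rw [hsum] at base
  have hhalf : (1 : ℝ) / 2 ≤ |if σ then -d else 1 - d| := by
    by_cases hs : σ
    · rw [if_pos hs, abs_neg]
      exact le_trans (le_of_lt hs) (le_abs_self d)
    · rw [if_neg hs]
      have : d ≤ 1 / 2 := not_lt.mp hs
      exact le_trans (by linarith) (le_abs_self _)
  rw [abs_mul, Nat.abs_cast] at base
  have : (M.card : ℝ) * (1 / 2) ≤ M.card * |if σ then -d else 1 - d| := by gcongr
  linarith

lemma Decomp.sum_density_le {V : Finset ℕ} {t ℓ : ℕ} (P : Decomp V (Fin t) (Fin ℓ))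
    (i j : Fin t) : ∑ α, (P.pairBG i j α).density ≤ 1 := by
  have h : ∑ α, ((P.pairs i j α).card : ℝ) ≤ ((P.part i).card : ℝ) * (P.part j).card := by
    rw [← Nat.cast_sum, ← Finset.card_biUnion fun α _ β _ h => P.pairs_disj i j α β h,
      ← Nat.cast_mul, ← Finset.card_product]
    exact_mod_cast Finset.card_le_card (Finset.biUnion_subset.mpr fun α _ => P.pairs_sub i j α)
  have : ∑ α, (P.pairBG i j α).density =
      (∑ α, ((P.pairs i j α).card : ℝ)) / (((P.part i).card : ℝ) * (P.part j).card) := by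
    rw [Finset.sum_div]; rfl
  rw [this]
  exact div_le_one_of_le₀ h (by positivity)

lemma Decomp.sum_card_part_le {V : Finset ℕ} {t ℓ : ℕ} (P : Decomp V (Fin t) (Fin ℓ)) :
    ∑ i, ((P.part i).card : ℝ) ≤ V.card := by
  rw [← Nat.cast_sum, ← Finset.card_biUnion fun i _ j _ h => P.part_disj i j h]
  exact_mod_cast Finset.card_le_card (Finset.biUnion_subset.mpr fun i _ => P.part_sub i)

lemma Decomp.sum_weight_le {V : Finset ℕ} {t ℓ : ℕ} (P : Decomp V (Fin t) (Fin ℓ)) (e : ℝ)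
    (he : 0 ≤ e) (hle : ℓ * e ≤ 1) :
    ∑ i, ∑ j, ∑ k, ∑ α, ∑ β, ∑ γ, (P.triadOf i j k α β γ).weight e ≤ 8 * (V.card : ℝ) ^ 3 := by
  have hs : ∀ i j, ∑ α, ((P.pairBG i j α).density + e) ≤ 2 := by
    intro i j
    rw [Finset.sum_add_distrib]
    have := P.sum_density_le i j
    simp only [Finset.sum_const, Finset.card_univ, Fintype.card_fin, nsmul_eq_mul]
    linarith
  have hs0 : ∀ i j, 0 ≤ ∑ α, ((P.pairBG i j α).density + e) := fun i j =>
    Finset.sum_nonneg fun α _ => add_nonneg (Bigraph.density_nonneg _) he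
  have hin : ∀ i j k, ∑ α, ∑ β, ∑ γ, (P.triadOf i j k α β γ).weight e ≤
      8 * (((P.part i).card : ℝ) * (P.part j).card * (P.part k).card) := by
    intro i j k
    have : ∑ α, ∑ β, ∑ γ, (P.triadOf i j k α β γ).weight e =
        ((∑ α, ((P.pairBG i j α).density + e)) * (∑ γ, ((P.pairBG j k γ).density + e)) *
          (∑ β, ((P.pairBG i k β).density + e))) *
          (((P.part i).card : ℝ) * (P.part j).card * (P.part k).card) := by
      rw [mul_assoc (∑ α, ((P.pairBG i j α).density + e)), Finset.sum_mul, Finset.sum_mul]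
      refine Finset.sum_congr rfl fun α _ => ?_
      rw [mul_comm (∑ γ, ((P.pairBG j k γ).density + e)), Finset.sum_mul, Finset.mul_sum,
        Finset.sum_mul]
      refine Finset.sum_congr rfl fun β _ => ?_
      rw [Finset.mul_sum, Finset.mul_sum, Finset.sum_mul]
      refine Finset.sum_congr rfl fun γ _ => ?_
      change (((P.pairBG i j α).density + e) * ((P.pairBG j k γ).density + e) *
        ((P.pairBG i k β).density + e)) * _ = _
      change _ * (((P.part i).card : ℝ) * (P.part j).card * (P.part k).card) = _
      ring
    rw [this]
    refine mul_le_mul_of_nonneg_right ?_ (by positivity)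
    calc _ ≤ (2 : ℝ) * 2 * 2 := by
          refine mul_le_mul (mul_le_mul (hs _ _) (hs _ _) (hs0 _ _) (by norm_num)) (hs _ _)
            (hs0 _ _) (by norm_num)
      _ = 8 := by norm_num
  calc _ ≤ ∑ i, ∑ j, ∑ k, 8 * (((P.part i).card : ℝ) * (P.part j).card * (P.part k).card) :=
        Finset.sum_le_sum fun i _ => Finset.sum_le_sum fun j _ => Finset.sum_le_sum fun k _ =>
          hin i j k
    _ = 8 * (∑ i, ((P.part i).card : ℝ)) ^ 3 := by
        simp_rw [← Finset.mul_sum, ← Finset.sum_mul]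
        simp_rw [← Finset.mul_sum, ← Finset.sum_mul]
        ring
    _ ≤ _ := by
        have := P.sum_card_part_le
        gcongr

/-- A regular decomposition predicts, up to few errors, every relation that only depends on
two of the three coordinates. -/
theorem Decomp.card_mispredicted_le {V : Finset ℕ} {t ℓ : ℕ} (P : Decomp V (Fin t) (Fin ℓ))
    (R : Finset (ℕ × ℕ × ℕ)) (ε₁ ε₂ θ e : ℝ) (hθ : 0 ≤ θ)
    (he : 0 ≤ e) (he1 : e ≤ 1) (h1 : ε₁ ≤ θ ^ 8) (h2 : ε₂ ≤ e ^ 4) (hle : ℓ * e ≤ 1)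
    (hP : P.regWrt R ε₁ ε₂) (pt : ℕ → Fin t) (col : ℕ → ℕ → Fin ℓ)
    (hpt : ∀ x ∈ V, x ∈ P.part (pt x))
    (hcol : ∀ x ∈ V, ∀ y ∈ V, (x, y) ∈ P.pairs (pt x) (pt y) (col x y))
    (A B C : Finset ℕ) (hA : A ⊆ V) (hB : B ⊆ V) (hC : C ⊆ V) (w : ℕ → ℕ → Prop)
    (hw : ∀ x ∈ A, ∀ y ∈ B, ∀ z ∈ C, ((x, y, z) ∈ R ↔ w x y)) :
    (((A ×ˢ B ×ˢ C).filter fun p =>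
      ¬(w p.1 p.2.1 ↔ 1 / 2 < relDensity R (P.triadOf (pt p.1) (pt p.2.1) (pt p.2.2)
        (col p.1 p.2.1) (col p.1 p.2.2) (col p.2.1 p.2.2)))).card : ℝ) ≤
      (ε₁ + 32 * θ) * (V.card : ℝ) ^ 3 := by
  set good := (V ×ˢ V ×ˢ V).filter fun p =>
      ∃ i j k α β γ, p ∈ (P.triadOf i j k α β γ).K3 ∧
        dev23 R (P.triadOf i j k α β γ) ε₁ ε₂ with hgood
  set irr := (V ×ˢ V ×ˢ V) \ good with hirr
  have cirr : (irr.card : ℝ) ≤ ε₁ * (V.card : ℝ) ^ 3 := by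
    have h3 : irr.card + good.card = (V ×ˢ V ×ˢ V).card :=
      Finset.card_sdiff_add_card_eq_card (Finset.filter_subset _ _)
    have h4 : (irr.card : ℝ) + good.card = (V.card : ℝ) ^ 3 := by
      rw [← Nat.cast_add, h3, Finset.card_product, Finset.card_product]; push_cast; ring
    have h5 : (1 - ε₁) * (V.card : ℝ) ^ 3 ≤ good.card := by
      unfold Decomp.regWrt at hP
      convert hP
    linarith
  set M : Fin t × Fin t × Fin t × Fin ℓ × Fin ℓ × Fin ℓ → Finset (ℕ × ℕ × ℕ) := fun q =>
    if dev23 R (P.triadOf q.1 q.2.1 q.2.2.1 q.2.2.2.1 q.2.2.2.2.1 q.2.2.2.2.2) ε₁ ε₂ then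
      (A ×ˢ B ×ˢ C).filter fun p =>
        p ∈ (P.triadOf q.1 q.2.1 q.2.2.1 q.2.2.2.1 q.2.2.2.2.1 q.2.2.2.2.2).K3 ∧
        ¬(w p.1 p.2.1 ↔ 1 / 2 <
          relDensity R (P.triadOf q.1 q.2.1 q.2.2.1 q.2.2.2.1 q.2.2.2.2.1 q.2.2.2.2.2))
    else ∅ with hM
  have hMc : ∀ q, ((M q).card : ℝ) ≤ 4 * θ *
      (P.triadOf q.1 q.2.1 q.2.2.1 q.2.2.2.1 q.2.2.2.2.1 q.2.2.2.2.2).weight e := by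
    intro q
    simp only [hM]
    split_ifs with hd
    · exact card_minority_le R _ ε₁ ε₂ θ e hθ he he1 h1 h2 hd A B C w hw
    · rw [Finset.card_empty, Nat.cast_zero]
      exact mul_nonneg (by positivity) (Triad.weight_nonneg _ _ he)
  have upt : ∀ x ∈ V, ∀ i, x ∈ P.part i → i = pt x := by
    intro x hx i hi
    by_contra hne
    exact Finset.disjoint_left.mp (P.part_disj i (pt x) hne) hi (hpt x hx)
  have ucol : ∀ x ∈ V, ∀ y ∈ V, ∀ α, (x, y) ∈ P.pairs (pt x) (pt y) α → α = col x y := by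
    intro x hx y hy α hα
    by_contra hne
    exact Finset.disjoint_left.mp (P.pairs_disj _ _ α (col x y) hne) hα (hcol x hx y hy)
  have hsub : ((A ×ˢ B ×ˢ C).filter fun p =>
      ¬(w p.1 p.2.1 ↔ 1 / 2 < relDensity R (P.triadOf (pt p.1) (pt p.2.1) (pt p.2.2)
        (col p.1 p.2.1) (col p.1 p.2.2) (col p.2.1 p.2.2)))) ⊆
      irr ∪ Finset.univ.biUnion M := by
    rintro ⟨x, y, z⟩ hp
    rw [Finset.mem_filter] at hp
    obtain ⟨hABC, hn⟩ := hp
    have hABC' := hABC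
    simp only [Finset.mem_product] at hABC'
    obtain ⟨hx, hy, hz⟩ := hABC'
    have hx := hA hx
    have hy := hB hy
    have hz := hC hz
    have hV : (x, y, z) ∈ V ×ˢ V ×ˢ V := by simp [hx, hy, hz]
    by_cases hg : (x, y, z) ∈ good
    · refine Finset.mem_union_right _ ?_
      obtain ⟨i, j, k, α, β, γ, hK, hd⟩ := (Finset.mem_filter.mp hg).2
      have hK' := Finset.mem_filter.mp hK
      simp only [Decomp.triadOf, Finset.mem_product] at hK'
      obtain ⟨⟨hi, hj, hk⟩, hα, hγ, hβ⟩ := hK'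
      obtain rfl := upt x hx i hi
      obtain rfl := upt y hy j hj
      obtain rfl := upt z hz k hk
      obtain rfl := ucol x hx y hy α hα
      obtain rfl := ucol x hx z hz β hβ
      obtain rfl := ucol y hy z hz γ hγ
      refine Finset.mem_biUnion.mpr ⟨(pt x, pt y, pt z, col x y, col x z, col y z),
        Finset.mem_univ _, ?_⟩
      simp only [hM]
      rw [if_pos hd]
      exact Finset.mem_filter.mpr ⟨hABC, hK, hn⟩
    · exact Finset.mem_union_left _ (Finset.mem_sdiff.mpr ⟨hV, hg⟩)
  have hsum : ∑ q, ((M q).card : ℝ) ≤ 32 * θ * (V.card : ℝ) ^ 3 := by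
    calc _ ≤ ∑ q : Fin t × Fin t × Fin t × Fin ℓ × Fin ℓ × Fin ℓ, 4 * θ *
        (P.triadOf q.1 q.2.1 q.2.2.1 q.2.2.2.1 q.2.2.2.2.1 q.2.2.2.2.2).weight e :=
          Finset.sum_le_sum fun q _ => hMc q
      _ = 4 * θ * ∑ i, ∑ j, ∑ k, ∑ α, ∑ β, ∑ γ, (P.triadOf i j k α β γ).weight e := by
          rw [← Finset.mul_sum]
          simp_rw [Fintype.sum_prod_type]
      _ ≤ 4 * θ * (8 * (V.card : ℝ) ^ 3) :=
          mul_le_mul_of_nonneg_left (P.sum_weight_le e he hle) (by positivity)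
      _ = _ := by ring
  have hc1 := (Finset.card_le_card hsub).trans (Finset.card_union_le _ _)
  have hc2 := Finset.card_biUnion_le (s := Finset.univ) (t := M)
  have hc3 : ((((A ×ˢ B ×ˢ C).filter fun p =>
      ¬(w p.1 p.2.1 ↔ 1 / 2 < relDensity R (P.triadOf (pt p.1) (pt p.2.1) (pt p.2.2)
        (col p.1 p.2.1) (col p.1 p.2.2) (col p.2.1 p.2.2)))).card : ℕ) : ℝ) ≤
      irr.card + ∑ q, ((M q).card : ℝ) := by
    exact_mod_cast hc1.trans (Nat.add_le_add_left hc2 _)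
  linarith

lemma Decomp.exists_coloring {V : Finset ℕ} {t ℓ : ℕ} (ht : 1 ≤ t) (hℓ : 1 ≤ ℓ)
    (P : Decomp V (Fin t) (Fin ℓ)) : ∃ (pt : ℕ → Fin t) (col : ℕ → ℕ → Fin ℓ),
    (∀ x ∈ V, x ∈ P.part (pt x)) ∧
    (∀ x ∈ V, ∀ y ∈ V, (x, y) ∈ P.pairs (pt x) (pt y) (col x y)) := by
  have h1 : ∀ x, ∃ i, x ∈ V → x ∈ P.part i := by
    intro x
    by_cases hx : x ∈ V
    · obtain ⟨i, hi⟩ := P.part_cover x hx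
      exact ⟨i, fun _ => hi⟩
    · exact ⟨⟨0, ht⟩, fun h => absurd h hx⟩
  choose pt hpt using h1
  have h2 : ∀ x y, ∃ α, x ∈ V → y ∈ V → (x, y) ∈ P.pairs (pt x) (pt y) α := by
    intro x y
    by_cases hx : x ∈ V ∧ y ∈ V
    · obtain ⟨α, hα⟩ := P.pairs_cover (pt x) (pt y) (x, y)
        (Finset.mem_product.mpr ⟨hpt x hx.1, hpt y hx.2⟩)
      exact ⟨α, fun _ _ => hα⟩
    · exact ⟨⟨0, hℓ⟩, fun h h' => absurd ⟨h, h'⟩ hx⟩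
  choose col hcol using h2
  exact ⟨pt, col, hpt, fun x hx y hy => hcol x y hx hy⟩

/-- The patterns on `n × n × k` realised by a bounded structure up to a quarter of the entries in
each layer. -/
def Approximable (n k T L : ℕ) (F : Fin k → Fin n → Fin n → Bool) : Prop :=
  ∃ (α : Fin n → Fin n → Fin L) (u v : Fin k → Fin n → Fin T × Fin L)
    (σ : Fin k → Fin T × Fin L → Fin T × Fin L → Fin L → Bool),
    ∀ s, 4 * (Finset.univ.filter fun p : Fin n × Fin n =>
      F s p.1 p.2 ≠ σ s (u s p.1) (v s p.2) (α p.1 p.2)).card ≤ n ^ 2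

lemma Approximable.mono {n k t ℓ T L : ℕ} (ht : 1 ≤ t) (hℓ : 1 ≤ ℓ) (htT : t ≤ T) (hℓL : ℓ ≤ L)
    {F : Fin k → Fin n → Fin n → Bool} (h : Approximable n k t ℓ F) : Approximable n k T L F := by
  obtain ⟨α, u, v, σ, h⟩ := h
  have : Nonempty (Fin t) := ⟨⟨0, ht⟩⟩
  have : Nonempty (Fin ℓ) := ⟨⟨0, hℓ⟩⟩
  have ij := Function.leftInverse_invFun (Fin.castLE_injective htT)
  have iℓ := Function.leftInverse_invFun (Fin.castLE_injective hℓL)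
  set it := Function.invFun (Fin.castLE htT)
  set il := Function.invFun (Fin.castLE hℓL)
  refine ⟨fun x y => Fin.castLE hℓL (α x y),
    fun s x => (Fin.castLE htT (u s x).1, Fin.castLE hℓL (u s x).2),
    fun s x => (Fin.castLE htT (v s x).1, Fin.castLE hℓL (v s x).2),
    fun s p q a => σ s (it p.1, il p.2) (it q.1, il q.2) (il a), fun s => ?_⟩
  convert h s using 4
  simp only [ij _, iℓ _]

/-- A 3-graph with a regular decomposition containing a pattern makes the pattern approximable. -/
theorem approximable_of_goodDecomp (H : ThreeGraph) (t ℓ n k : ℕ) (ht : 1 ≤ t) (hℓ : 1 ≤ ℓ)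
    (hn : 1 ≤ n) (ε₁ ε₂ θ e : ℝ) (hθ : 0 ≤ θ) (hθ1 : 132 * θ * ((k : ℝ) + 2) ^ 3 ≤ 1)
    (he : 0 ≤ e) (he1 : e ≤ 1) (h1 : ε₁ ≤ θ ^ 8) (h2 : ε₂ ≤ e ^ 4) (hle : ℓ * e ≤ 1)
    (hH : GoodDecomp H t ℓ ε₁ ε₂) (hN : H.verts.card ≤ (k + 2) * n)
    (F : Fin k → Fin n → Fin n → Bool) (a b : Fin n → ℕ) (c : Fin k → Fin n → ℕ)
    (ha : ∀ x, a x ∈ H.verts) (hb : ∀ x, b x ∈ H.verts) (hc : ∀ s r, c s r ∈ H.verts)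
    (ia : Function.Injective a) (ib : Function.Injective b) (ic : ∀ s, Function.Injective (c s))
    (hF : ∀ s x y r, ({a x, b y, c s r} : Finset ℕ) ∈ H.edges ↔ F s x y = true) :
    Approximable n k t ℓ F := by
  obtain ⟨P, -, hP⟩ := hH
  obtain ⟨pt, col, hpt, hcol⟩ := P.exists_coloring ht hℓ
  have key : ∀ s, ∃ r, 4 * (Finset.univ.filter fun p : Fin n × Fin n =>
      F s p.1 p.2 ≠ decide (1 / 2 < relDensity H.obar (P.triadOf (pt (a p.1)) (pt (b p.2))
        (pt (c s r)) (col (a p.1) (b p.2)) (col (a p.1) (c s r)) (col (b p.2) (c s r))))).card ≤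
        n ^ 2 := by
    intro s
    by_contra! hcon
    set τ : ℕ → ℕ → ℕ → Prop := fun x y z => 1 / 2 < relDensity H.obar
      (P.triadOf (pt x) (pt y) (pt z) (col x y) (col x z) (col y z)) with hτ
    set w : ℕ → ℕ → Prop := fun x y => ∃ i j, a i = x ∧ b j = y ∧ F s i j = true with hw
    have hwab : ∀ i j, w (a i) (b j) ↔ F s i j = true := by
      intro i j
      constructor
      · rintro ⟨i', j', h, h', h''⟩
        rw [ia h, ib h'] at h''; exact h''
      · exact fun h => ⟨i, j, rfl, rfl, h⟩
    have bound := P.card_mispredicted_le H.obar ε₁ ε₂ θ e hθ he he1 h1 h2 hle hP pt col hpt hcol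
      (Finset.univ.image a) (Finset.univ.image b) (Finset.univ.image (c s))
      (by intro x hx; simp only [Finset.mem_image, Finset.mem_univ, true_and] at hx
          obtain ⟨i, rfl⟩ := hx; exact ha i)
      (by intro x hx; simp only [Finset.mem_image, Finset.mem_univ, true_and] at hx
          obtain ⟨i, rfl⟩ := hx; exact hb i)
      (by intro x hx; simp only [Finset.mem_image, Finset.mem_univ, true_and] at hx
          obtain ⟨i, rfl⟩ := hx; exact hc s i) w
      (by
        intro x hx y hy z hz
        simp only [Finset.mem_image, Finset.mem_univ, true_and] at hx hy hz
        obtain ⟨i, rfl⟩ := hx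
        obtain ⟨j, rfl⟩ := hy
        obtain ⟨r, rfl⟩ := hz
        rw [hwab, ← hF s i j r]
        simp [ThreeGraph.obar, ha, hb, hc])
    set bad := ((Finset.univ.image a ×ˢ Finset.univ.image b ×ˢ Finset.univ.image (c s)).filter
      fun p => ¬(w p.1 p.2.1 ↔ 1 / 2 < relDensity H.obar (P.triadOf (pt p.1) (pt p.2.1) (pt p.2.2)
        (col p.1 p.2.1) (col p.1 p.2.2) (col p.2.1 p.2.2)))) with hbad
    set E : Fin n → Finset (Fin n × Fin n) := fun r => Finset.univ.filter fun p : Fin n × Fin n =>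
      F s p.1 p.2 ≠ decide (τ (a p.1) (b p.2) (c s r)) with hE
    have hle2 : ∑ r, (E r).card ≤ bad.card := by
      rw [← Finset.card_sigma]
      refine Finset.card_le_card_of_injOn (fun q => (a q.2.1, b q.2.2, c s q.1)) ?_ ?_
      · rintro ⟨r, x, y⟩ hq
        simp only [Finset.coe_sigma, Set.mem_sigma_iff, Finset.mem_coe, hE, Finset.mem_filter,
          Finset.mem_univ, true_and] at hq
        simp only [hbad, Finset.coe_filter, Set.mem_ofPred_eq, Finset.mem_product,
          Finset.mem_image, Finset.mem_univ, true_and, exists_apply_eq_apply]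
        rw [hwab]
        intro hiff
        apply hq
        rw [Bool.eq_iff_iff, decide_eq_true_iff]
        exact hiff
      · rintro ⟨r, x, y⟩ _ ⟨r', x', y'⟩ _ h
        simp only [Prod.mk.injEq] at h
        obtain rfl := ia h.1
        obtain rfl := ib h.2.1
        obtain rfl := ic s h.2.2
        rfl
    have bound' : (bad.card : ℝ) ≤ (ε₁ + 32 * θ) * (H.verts.card : ℝ) ^ 3 := by convert bound
    have hlow : n * (n ^ 2 + 1) ≤ 4 * bad.card := by
      calc n * (n ^ 2 + 1) = ∑ _r : Fin n, (n ^ 2 + 1) := by simp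
        _ ≤ ∑ r, 4 * (E r).card := Finset.sum_le_sum fun r _ => hcon r
        _ = 4 * ∑ r, (E r).card := by rw [Finset.mul_sum]
        _ ≤ _ := Nat.mul_le_mul_left _ hle2
    have hlow' : (n : ℝ) * ((n : ℝ) ^ 2 + 1) ≤ 4 * (bad.card : ℝ) := by exact_mod_cast hlow
    have hn' : (1 : ℝ) ≤ n := by exact_mod_cast hn
    have hN' : (H.verts.card : ℝ) ≤ ((k : ℝ) + 2) * n := by exact_mod_cast hN
    have hk : (0 : ℝ) ≤ k := by positivity
    have hθle : θ ≤ 1 := by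
      by_contra hh
      push Not at hh
      have : (1 : ℝ) ≤ ((k : ℝ) + 2) ^ 3 := one_le_pow₀ (by linarith)
      nlinarith
    have hεθ : ε₁ ≤ θ := h1.trans (by
      calc θ ^ 8 ≤ θ ^ 1 := pow_le_pow_of_le_one hθ hθle (by norm_num)
        _ = θ := pow_one θ)
    have h5 : (ε₁ + 32 * θ) * (H.verts.card : ℝ) ^ 3 ≤ (33 * θ) * (((k : ℝ) + 2) * n) ^ 3 := by
      refine mul_le_mul (by linarith) (pow_le_pow_left₀ (by positivity) hN' 3) (by positivity)
        (by positivity)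
    have h6 : 4 * (33 * θ * (((k : ℝ) + 2) * n) ^ 3) ≤ (n : ℝ) ^ 3 := by
      calc _ = (132 * θ * ((k : ℝ) + 2) ^ 3) * (n : ℝ) ^ 3 := by ring
        _ ≤ 1 * (n : ℝ) ^ 3 := by gcongr
        _ = _ := one_mul _
    nlinarith
  choose r hr using key
  refine ⟨fun x y => col (a x) (b y), fun s x => (pt (a x), col (a x) (c s (r s))),
    fun s y => (pt (b y), col (b y) (c s (r s))),
    fun s p q α => decide (1 / 2 < relDensity H.obar (P.triadOf p.1 q.1
        (pt (c s (r s))) α p.2 q.2)), fun s => hr s⟩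

lemma card_small_subsets_le (β : Type*) [Fintype β] :
    (Fintype.card {S : Finset β // 4 * S.card ≤ Fintype.card β} : ℝ) ^ 4 ≤
      (81 / 8) ^ Fintype.card β := by
  set m := Fintype.card β with hm
  have h1 : ∑ S : Finset β, ((1 : ℝ) / 2) ^ S.card = (3 / 2) ^ m := by
    have := Finset.sum_pow_mul_eq_add_pow ((1 : ℝ) / 2) 1 (Finset.univ : Finset β)
    simp only [Finset.powerset_univ, one_pow, mul_one, Finset.card_univ] at this
    rw [this, ← hm]; norm_num
  have h2 : (Fintype.card {S : Finset β // 4 * S.card ≤ m} : ℝ) * (1 / 2) ^ (m / 4) ≤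
      (3 / 2) ^ m := by
    rw [← h1, Fintype.card_subtype, ← nsmul_eq_mul, ← Finset.sum_const]
    refine le_trans (Finset.sum_le_sum fun S hS => ?_)
      (Finset.sum_le_univ_sum_of_nonneg fun S => by positivity)
    have : S.card ≤ m / 4 := by have := (Finset.mem_filter.mp hS).2; omega
    exact pow_le_pow_of_le_one (by norm_num) (by norm_num) this
  set v : ℝ := (Fintype.card {S : Finset β // 4 * S.card ≤ m} : ℝ) with hv
  have h3 : v ≤ (3 / 2) ^ m * 2 ^ (m / 4) := by
    have : v = v * (1 / 2) ^ (m / 4) * 2 ^ (m / 4) := by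
      rw [mul_assoc, ← mul_pow]; norm_num
    rw [this]
    gcongr
  calc v ^ 4 ≤ ((3 / 2) ^ m * 2 ^ (m / 4)) ^ 4 := by gcongr
    _ = (3 / 2) ^ (4 * m) * 2 ^ (4 * (m / 4)) := by
        rw [mul_pow, ← pow_mul, ← pow_mul, mul_comm m 4, mul_comm (m / 4) 4]
    _ ≤ (3 / 2) ^ (4 * m) * 2 ^ m := by
        gcongr
        · norm_num
        · omega
    _ = (81 / 8) ^ m := by
        rw [pow_mul, ← mul_pow]; norm_num

set_option synthInstance.maxHeartbeats 400000 in
set_option synthInstance.maxSize 1000 in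
/-- If all patterns are approximable then the number of codes is large. -/
theorem card_patterns_le (n j T L : ℕ) (h : ∀ F, Approximable n (4 * j) T L F) :
    (2 : ℝ) ^ (4 * j * n ^ 2) ≤ (L : ℝ) ^ (n ^ 2) * ((T * L : ℝ) ^ (4 * j * n)) ^ 2 *
      2 ^ (4 * j * (T * L) ^ 2 * L) * (81 / 8) ^ (j * n ^ 2) := by
  choose α u v σ h using h
  let D : (Fin (4 * j) → Fin n → Fin n → Bool) → Fin (4 * j) →
      {S : Finset (Fin n × Fin n) // 4 * S.card ≤ Fintype.card (Fin n × Fin n)} := fun F s =>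
    ⟨Finset.univ.filter fun p : Fin n × Fin n =>
      F s p.1 p.2 ≠ σ F s (u F s p.1) (v F s p.2) (α F p.1 p.2), by
      have h1 : Fintype.card (Fin n × Fin n) = n ^ 2 := by simp [sq]
      rw [h1]
      convert h F s⟩
  have inj : Function.Injective fun F => (α F, u F, v F, σ F, D F) := by
    intro F G hFG
    simp only [Prod.mk.injEq] at hFG
    obtain ⟨e1, e2, e3, e4, e5⟩ := hFG
    funext s x y
    have e6 := congrArg Subtype.val (congrFun e5 s)
    simp only [D] at e6
    rw [e1, e2, e3, e4] at e6
    have e7 := Finset.ext_iff.mp e6 (x, y)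
    simp only [Finset.mem_filter, Finset.mem_univ, true_and] at e7
    generalize σ G s (u G s x) (v G s y) (α G x y) = q at e7
    revert e7
    cases F s x y <;> cases G s x y <;> cases q <;> simp
  have hc := Fintype.card_le_of_injective _ inj
  simp only [Fintype.card_prod, Fintype.card_fun, Fintype.card_fin, Fintype.card_bool] at hc
  have hv := card_small_subsets_le (Fin n × Fin n)
  simp only [Fintype.card_prod, Fintype.card_fin] at hv
  set w := Fintype.card {S : Finset (Fin n × Fin n) // 4 * S.card ≤ n * n} with hw
  have hc' : (2 : ℝ) ^ (4 * j * n ^ 2) ≤ (L : ℝ) ^ (n ^ 2) * ((T * L : ℝ) ^ (4 * j * n)) ^ 2 *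
      2 ^ (4 * j * (T * L) ^ 2 * L) * (w : ℝ) ^ (4 * j) := by
    have e : 2 ^ (4 * j * n ^ 2) ≤ L ^ (n ^ 2) * ((T * L) ^ (4 * j * n)) ^ 2 *
      2 ^ (4 * j * (T * L) ^ 2 * L) * w ^ (4 * j) := by
      calc _ = ((2 ^ n) ^ n) ^ (4 * j) := by rw [← pow_mul, ← pow_mul]; congr 1; ring
        _ ≤ _ := hc
        _ = _ := by
          simp only [← pow_mul]
          rw [show n * n = n ^ 2 by ring, show n * (4 * j) = 4 * j * n by ring,
            show L * (T * L) * (T * L) * (4 * j) = 4 * j * (T * L) ^ 2 * L by ring]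
          ring
    exact_mod_cast e
  refine hc'.trans ?_
  have : (w : ℝ) ^ (4 * j) ≤ (81 / 8) ^ (j * n ^ 2) := by
    calc (w : ℝ) ^ (4 * j) = ((w : ℝ) ^ 4) ^ j := by rw [pow_mul]
      _ ≤ ((81 / 8) ^ (n * n)) ^ j := by gcongr
      _ = _ := by rw [← pow_mul]; congr 1; ring
  gcongr

/-- For few colours and many layers, some pattern is not approximable. -/
theorem exists_not_approximable (j T L : ℕ) (hj : 1 ≤ j) (hL : (2 : ℝ) * L < (3 / 2) ^ j) (n₀ : ℕ) :
    ∃ n, n₀ ≤ n ∧ 1 ≤ n ∧ ∃ F, ¬ Approximable n (4 * j) T L F := by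
  set A := 8 * j * (T * L) + 4 * j * (T * L) ^ 2 * L + 1 with hA
  refine ⟨n₀ + A, by omega, by omega, ?_⟩
  set n := n₀ + A with hn
  have hn1 : 1 ≤ n := by omega
  by_contra! hcon
  have h := card_patterns_le n j T L hcon
  have hnA : 8 * j * (T * L) + 4 * j * (T * L) ^ 2 * L < n := by omega
  have h1 : ((T * L : ℝ) ^ (4 * j * n)) ^ 2 ≤ 2 ^ (8 * j * (T * L) * n) := by
    have : (T * L : ℝ) ≤ 2 ^ (T * L) := by
      have := (Nat.lt_two_pow_self (n := T * L)).le
      exact_mod_cast this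
    calc ((T * L : ℝ) ^ (4 * j * n)) ^ 2 ≤ ((2 ^ (T * L)) ^ (4 * j * n)) ^ 2 := by gcongr
      _ = _ := by rw [← pow_mul, ← pow_mul]; congr 1; ring
  have h2 : (2 : ℝ) ^ (8 * j * (T * L) * n) * 2 ^ (4 * j * (T * L) ^ 2 * L) ≤ 2 ^ (n ^ 2) := by
    rw [← pow_add]
    refine pow_le_pow_right₀ (by norm_num) ?_
    nlinarith [Nat.zero_le (4 * j * (T * L) ^ 2 * L)]
  have h3 : (2 : ℝ) ^ (4 * j * n ^ 2) < ((3 / 2) ^ j) ^ (n ^ 2) * (81 / 8) ^ (j * n ^ 2) := by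
    calc (2 : ℝ) ^ (4 * j * n ^ 2) ≤ (L : ℝ) ^ (n ^ 2) * ((T * L : ℝ) ^ (4 * j * n)) ^ 2 *
          2 ^ (4 * j * (T * L) ^ 2 * L) * (81 / 8) ^ (j * n ^ 2) := h
      _ ≤ (L : ℝ) ^ (n ^ 2) * (2 ^ (8 * j * (T * L) * n) * 2 ^ (4 * j * (T * L) ^ 2 * L)) *
          (81 / 8) ^ (j * n ^ 2) := by
          rw [mul_assoc ((L : ℝ) ^ (n ^ 2))]
          gcongr
      _ ≤ (L : ℝ) ^ (n ^ 2) * 2 ^ (n ^ 2) * (81 / 8) ^ (j * n ^ 2) := by gcongr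
      _ = (2 * L : ℝ) ^ (n ^ 2) * (81 / 8) ^ (j * n ^ 2) := by rw [mul_pow]; ring
      _ < _ := by
          refine mul_lt_mul_of_pos_right ?_ (by positivity)
          exact pow_lt_pow_left₀ hL (by positivity) (by positivity)
  have h4 : ((3 / 2 : ℝ) ^ j) ^ (n ^ 2) * (81 / 8) ^ (j * n ^ 2) ≤ 2 ^ (4 * j * n ^ 2) := by
    rw [← pow_mul, ← mul_pow, mul_assoc 4, pow_mul 2 4]
    exact pow_le_pow_left₀ (by norm_num) (by norm_num) _
  linarith

lemma ThreeGraph.VC2AtLeast.transfer {H : ThreeGraph} {I : Type} [Fintype I]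
    (h : H.VC2AtLeast (Fintype.card I)) :
    ∃ a b : I → ℕ, ∃ c : Set (I × I) → ℕ,
    (∀ i, a i ∈ H.verts) ∧ (∀ i, b i ∈ H.verts) ∧ (∀ S, c S ∈ H.verts) ∧
    ∀ (i j : I) (S : Set (I × I)), (({a i, b j, c S} : Finset ℕ) ∈ H.edges ↔ (i, j) ∈ S) := by
  obtain ⟨a, b, c, ha, hb, hc, hE⟩ := h
  let f := Fintype.equivFin I
  refine ⟨a ∘ f, b ∘ f, fun S => c (Finset.univ.filter fun q => (f.symm q.1, f.symm q.2) ∈ S),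
    fun i => ha _, fun i => hb _, fun S => hc _, fun i j S => ?_⟩
  simp only [Function.comp_apply]
  rw [hE]
  simp

lemma ThreeGraph.distinct_of_mem_edges {H : ThreeGraph} {x y z : ℕ}
    (h : ({x, y, z} : Finset ℕ) ∈ H.edges) : x ≠ y ∧ x ≠ z ∧ y ≠ z := by
  have h3 := (H.edges_sub _ h).2
  refine ⟨?_, ?_, ?_⟩ <;> rintro rfl <;> revert h3
  · rw [Finset.insert_idem]
    have := Finset.card_le_two (a := x) (b := z)
    omega
  · rw [Finset.pair_comm y x, Finset.insert_idem]
    have := Finset.card_le_two (a := x) (b := y)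
    omega
  · rw [Finset.pair_eq_singleton]
    have := Finset.card_le_two (a := x) (b := y)
    omega

/-- A hereditary property of infinite `VC₂`-dimension contains every pattern. -/
theorem exists_pattern_graph (ℋ : Set ThreeGraph) (hH : Hereditary ℋ)
    (hVC : ∀ k : ℕ, ∃ H ∈ ℋ, H.VC2AtLeast k) (n k : ℕ) (F : Fin k → Fin n → Fin n → Bool) :
    ∃ H ∈ ℋ, H.verts.card = (k + 2) * n ∧ ∃ (a b : Fin n → ℕ) (c : Fin k → Fin n → ℕ),
      (∀ x, a x ∈ H.verts) ∧ (∀ x, b x ∈ H.verts) ∧ (∀ s r, c s r ∈ H.verts) ∧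
      Function.Injective a ∧ Function.Injective b ∧ (∀ s, Function.Injective (c s)) ∧
      ∀ s x y r, ({a x, b y, c s r} : Finset ℕ) ∈ H.edges ↔ F s x y = true := by
  obtain ⟨H, hHℋ, hvc⟩ := hVC (Fintype.card (Fin n ⊕ Option (Fin k × Fin n)))
  obtain ⟨a, b, c, ha, hb, hc, hE⟩ := hvc.transfer
  set S : Fin k → Fin n → Set ((Fin n ⊕ Option (Fin k × Fin n)) ×
      (Fin n ⊕ Option (Fin k × Fin n))) := fun s r => {p |
    (∃ i j, p = (Sum.inl i, Sum.inl j) ∧ F s i j = true) ∨ (∃ i, p = (Sum.inl i, Sum.inr none)) ∨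
    (∃ j, p = (Sum.inr none, Sum.inl j)) ∨ p = (Sum.inr (some (s, r)), Sum.inr none)} with hS
  have iab : ∀ p q, a p ≠ b q := fun p q =>
    (H.distinct_of_mem_edges ((hE p q {(p, q)}).mpr rfl)).1
  have ia : Function.Injective a := by
    intro p p' hp
    have h1 := (hE p p {(p, p)}).mpr rfl
    rw [hp, hE] at h1
    exact (congrArg Prod.fst h1).symm
  have ib : Function.Injective b := by
    intro p p' hp
    have h1 := (hE p p {(p, p)}).mpr rfl
    rw [hp, hE] at h1
    exact (congrArg Prod.snd h1).symm
  have iac : ∀ i s r, a (Sum.inl i) ≠ c (S s r) := fun i s r =>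
    (H.distinct_of_mem_edges ((hE (Sum.inl i) (Sum.inr none) (S s r)).mpr
      (Or.inr (Or.inl ⟨i, rfl⟩)))).2.1
  have ibc : ∀ i s r, b (Sum.inl i) ≠ c (S s r) := fun i s r =>
    (H.distinct_of_mem_edges ((hE (Sum.inr none) (Sum.inl i) (S s r)).mpr
      (Or.inr (Or.inr (Or.inl ⟨i, rfl⟩))))).2.2
  have ic : ∀ s r s' r', c (S s r) = c (S s' r') → (s, r) = (s', r') := by
    intro s r s' r' h
    have h1 := (hE (Sum.inr (some (s, r))) (Sum.inr none) (S s r)).mpr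
      (Or.inr (Or.inr (Or.inr rfl)))
    rw [h, hE] at h1
    simpa [hS] using h1
  set A := Finset.univ.image fun i : Fin n => a (Sum.inl i) with hA
  set B := Finset.univ.image fun i : Fin n => b (Sum.inl i) with hB
  set C := Finset.univ.image fun q : Fin k × Fin n => c (S q.1 q.2) with hC
  have mA : ∀ i, a (Sum.inl i) ∈ A := fun i => Finset.mem_image_of_mem _ (Finset.mem_univ i)
  have mB : ∀ i, b (Sum.inl i) ∈ B := fun i => Finset.mem_image_of_mem _ (Finset.mem_univ i)
  have mC : ∀ s r, c (S s r) ∈ C := fun s r =>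
    Finset.mem_image_of_mem (fun q : Fin k × Fin n => c (S q.1 q.2)) (Finset.mem_univ (s, r))
  have cA : A.card = n := by
    rw [hA, Finset.card_image_of_injective]
    · simp
    · exact ia.comp Sum.inl_injective
  have cB : B.card = n := by
    rw [hB, Finset.card_image_of_injective]
    · simp
    · exact ib.comp Sum.inl_injective
  have cC : C.card = k * n := by
    rw [hC, Finset.card_image_of_injective]
    · simp
    · rintro ⟨s, r⟩ ⟨s', r'⟩ h
      exact ic s r s' r' h
  have dAB : Disjoint A B := by
    rw [Finset.disjoint_left]
    intro x hx hx'
    obtain ⟨i, -, rfl⟩ := Finset.mem_image.mp hx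
    obtain ⟨j, -, h⟩ := Finset.mem_image.mp hx'
    exact iab _ _ h.symm
  have dABC : Disjoint (A ∪ B) C := by
    rw [Finset.disjoint_left]
    intro x hx hx'
    obtain ⟨q, -, h⟩ := Finset.mem_image.mp hx'
    rcases Finset.mem_union.mp hx with hx | hx
    · obtain ⟨i, -, rfl⟩ := Finset.mem_image.mp hx
      exact iac _ _ _ h.symm
    · obtain ⟨i, -, rfl⟩ := Finset.mem_image.mp hx
      exact ibc _ _ _ h.symm
  have hsub : A ∪ B ∪ C ⊆ H.verts := by
    refine Finset.union_subset (Finset.union_subset ?_ ?_) ?_ <;>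
    · intro x hx
      obtain ⟨i, -, rfl⟩ := Finset.mem_image.mp hx
      first
      | exact ha _
      | exact hb _
      | exact hc _
  have hverts : (H.induce (A ∪ B ∪ C)).verts = A ∪ B ∪ C := Finset.inter_eq_right.mpr hsub
  refine ⟨H.induce (A ∪ B ∪ C), hH.2 H hHℋ _, ?_, fun i => a (Sum.inl i), fun i => b (Sum.inl i),
    fun s r => c (S s r), ?_, ?_, ?_, ia.comp Sum.inl_injective, ib.comp Sum.inl_injective,
    ?_, ?_⟩
  · rw [hverts, Finset.card_union_of_disjoint dABC, Finset.card_union_of_disjoint dAB, cA, cB, cC]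
    ring
  · intro x; rw [hverts]; exact Finset.mem_union_left _ (Finset.mem_union_left _ (mA x))
  · intro x; rw [hverts]; exact Finset.mem_union_left _ (Finset.mem_union_right _ (mB x))
  · intro s r; rw [hverts]; exact Finset.mem_union_right _ (mC s r)
  · intro s r r' h
    exact (Prod.mk.inj (ic _ _ _ _ h)).2
  · intro s x y r
    have h1 : ({a (Sum.inl x), b (Sum.inl y), c (S s r)} : Finset ℕ) ⊆ A ∪ B ∪ C := by
      intro z hz
      simp only [Finset.mem_insert, Finset.mem_singleton] at hz
      rcases hz with rfl | rfl | rfl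
      · exact Finset.mem_union_left _ (Finset.mem_union_left _ (mA x))
      · exact Finset.mem_union_left _ (Finset.mem_union_right _ (mB y))
      · exact Finset.mem_union_right _ (mC s r)
    have h2 : ({a (Sum.inl x), b (Sum.inl y), c (S s r)} : Finset ℕ) ∈
        (H.induce (A ∪ B ∪ C)).edges ↔
        ({a (Sum.inl x), b (Sum.inl y), c (S s r)} : Finset ℕ) ∈ H.edges := by
      simp only [ThreeGraph.induce, Finset.mem_filter]
      exact and_iff_left h1
    rw [h2, hE]
    simp [hS]

/-- Lower bound for every admissible number of pair classes. -/
theorem lt_of_psi (ℋ : Set ThreeGraph) (hH : Hereditary ℋ)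
    (hVC : ∀ k : ℕ, ∃ H ∈ ℋ, H.VC2AtLeast k) (ε₁ θ : ℝ) (ε₂ : ℕ → ℝ) (j T L : ℕ) (hj : 1 ≤ j)
    (hθ : 0 ≤ θ) (hθ1 : 132 * θ * (4 * (j : ℝ) + 2) ^ 3 ≤ 1) (h1 : ε₁ ≤ θ ^ 8)
    (h2 : ∀ x : ℕ, ε₂ x ≤ (1 / ((x : ℝ) + 1)) ^ 4) (hψ : psi ε₁ ε₂ T L ℋ) :
    (3 / 2 : ℝ) ^ j ≤ 2 * L := by
  by_contra! hL
  obtain ⟨n₀, hψ⟩ := hψ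
  obtain ⟨n, hn₀, hn, F, hF⟩ := exists_not_approximable j T L hj hL n₀
  obtain ⟨H, hHℋ, hcard, a, b, c, ha, hb, hc, ia, ib, ic, hE⟩ :=
    exists_pattern_graph ℋ hH hVC n (4 * j) F
  have hbig : n₀ ≤ H.verts.card := by rw [hcard]; nlinarith
  obtain ⟨t, ℓ, ht, htT, hℓ, hℓL, hgood⟩ := hψ H hHℋ hbig
  refine hF (Approximable.mono ht hℓ htT hℓL (approximable_of_goodDecomp H t ℓ n (4 * j) ht hℓ hn
    ε₁ (ε₂ ℓ) θ (1 / ((ℓ : ℝ) + 1)) hθ ?_ (by positivity) ?_ h1 (h2 ℓ) ?_ hgood hcard.le F a b c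
    ha hb hc ia ib ic hE))
  · push_cast; exact hθ1
  · rw [div_le_one (by positivity)]
    have : (0 : ℝ) ≤ ℓ := by positivity
    linarith
  · rw [mul_one_div, div_le_one (by positivity)]; linarith

/-- If regularity holds at all, then the number of pair classes needed is exponential. -/
theorem exponential_lower_bound (ℋ : Set ThreeGraph) (hH : Hereditary ℋ)
    (hVC : ∀ k : ℕ, ∃ H ∈ ℋ, H.VC2AtLeast k)
    (hreg : ∀ (ε₁ : ℝ) (ε₂ : ℕ → ℝ), 0 < ε₁ → ε₁ < 1 → InZeroOne ε₂ →
      ∃ L T : ℕ, 1 ≤ T ∧ psi ε₁ ε₂ T L ℋ) :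
    ∃ C : ℝ, 0 < C ∧ SmallEps fun ε₁ ε₂ =>
      (2 : ℝ) ^ (ε₁ ^ (-C)) ≤ (Lfun ℋ ε₁ ε₂ : ℝ) := by
  refine ⟨1 / 100, by norm_num, (1 / 10) ^ 100, by positivity, fun ε₁ hε hε1 =>
    ⟨fun x => (1 / ((x : ℝ) + 1)) ^ 4, fun x => ⟨by positivity, ?_⟩, fun ε₂ h01 hδ => ?_⟩⟩
  · refine pow_le_one₀ (by positivity) ?_
    rw [div_le_one (by positivity)]
    have : (0 : ℝ) ≤ x := by positivity
    linarith
  set r : ℝ := ε₁ ^ (-(1 / 100 : ℝ)) with hr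
  have hr0 : 0 < r := Real.rpow_pos_of_pos hε _
  have hr100 : r ^ 100 = ε₁⁻¹ := by
    rw [hr, ← Real.rpow_natCast, ← Real.rpow_mul hε.le, ← Real.rpow_neg_one]
    norm_num
  have hr10 : 10 ≤ r := by
    refine le_of_pow_le_pow_left₀ (n := 100) (by norm_num) hr0.le ?_
    rw [hr100]
    rw [le_inv_comm₀ (by positivity) hε]
    refine hε1.le.trans (le_of_eq ?_)
    rw [one_div, inv_pow]
  have hmem : Lfun ℋ ε₁ ε₂ ∈ {L : ℕ | ∃ T : ℕ, 1 ≤ T ∧ psi ε₁ ε₂ T L ℋ} := by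
    refine Nat.sInf_mem ?_
    obtain ⟨L, T, h⟩ := hreg ε₁ ε₂ hε (hε1.trans (by norm_num)) h01
    exact ⟨L, T, h⟩
  obtain ⟨T, -, hψ⟩ := hmem
  set L := Lfun ℋ ε₁ ε₂
  set j := ⌈2 * r + 8⌉₊ with hj
  have hj1 : 2 * r + 8 ≤ j := Nat.le_ceil _
  have hj2 : (j : ℝ) < 2 * r + 8 + 1 := Nat.ceil_lt_add_one (by positivity)
  have hj3 : 1 ≤ j := by
    have : (1 : ℝ) ≤ j := by linarith
    exact_mod_cast this
  have hq : 4 * (j : ℝ) + 2 ≤ 12 * r := by linarith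
  have hq0 : 0 < 4 * (j : ℝ) + 2 := by positivity
  have low := lt_of_psi ℋ hH hVC ε₁ (1 / (132 * (4 * (j : ℝ) + 2) ^ 3)) ε₂ j T L hj3
    (by positivity) (le_of_eq (by field_simp)) ?_ hδ hψ
  · have h1 : (2 : ℝ) * 2 ^ r ≤ (3 / 2 : ℝ) ^ j := by
      rw [← Real.rpow_natCast]
      calc (2 : ℝ) * 2 ^ r ≤ (3 / 2 : ℝ) ^ (8 : ℕ) * (9 / 4) ^ r := by
            gcongr
            · norm_num
            · norm_num
        _ = (3 / 2 : ℝ) ^ (2 * r + 8) := by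
            rw [Real.rpow_add (by norm_num), Real.rpow_mul (by norm_num), mul_comm]
            norm_num
        _ ≤ _ := Real.rpow_le_rpow_of_exponent_le (by norm_num) hj1
    linarith
  · have h1 : ε₁ = (1 / r) ^ 100 := by
      rw [div_pow, hr100]; simp
    have h3 : (1 / r) ^ 9 ≤ 1 / (132 * (4 * (j : ℝ) + 2) ^ 3) := by
      rw [div_pow, one_pow]
      refine one_div_le_one_div_of_le (by positivity) ?_
      calc 132 * (4 * (j : ℝ) + 2) ^ 3 ≤ 132 * (12 * r) ^ 3 := by gcongr
        _ = 228096 * r ^ 3 := by ring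
        _ ≤ 10 ^ 6 * r ^ 3 := by gcongr; norm_num
        _ ≤ r ^ 6 * r ^ 3 := by gcongr
        _ = r ^ 9 := by ring
    calc ε₁ = (1 / r) ^ 100 := h1
      _ ≤ (1 / r) ^ 72 := by
          refine pow_le_pow_of_le_one (by positivity) ?_ (by norm_num)
          rw [div_le_one hr0]; linarith
      _ = ((1 / r) ^ 9) ^ 8 := by rw [← pow_mul]
      _ ≤ _ := by gcongr

/-- The cell of `c` in the partition of `Ω` induced by the labelling `κ`. -/
noncomputable def cell {β γ : Type*} (Ω : Finset β) (κ : β → γ) (c : γ) : Finset β :=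
  Ω.filter fun ω => κ ω = c

/-- The average of `f` over the cell of `c`. -/
noncomputable def avgOn {β γ : Type*} (Ω : Finset β) (κ : β → γ) (f : β → ℝ) (c : γ) : ℝ :=
  (∑ ω ∈ cell Ω κ c, f ω) / (cell Ω κ c).card

/-- The energy of `f` with respect to the labelling `κ`. -/
noncomputable def energy {β γ : Type*} (Ω : Finset β) (κ : β → γ) (f : β → ℝ) : ℝ :=
  ∑ ω ∈ Ω, avgOn Ω κ f (κ ω) ^ 2

section Cells
variable {β γ γ' : Type*} (Ω : Finset β) (κ : β → γ) (f : β → ℝ)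

lemma card_cell_pos {ω : β} (h : ω ∈ Ω) : (0 : ℝ) < (cell Ω κ (κ ω)).card := by
  have : ω ∈ cell Ω κ (κ ω) := Finset.mem_filter.mpr ⟨h, rfl⟩
  exact_mod_cast Finset.card_pos.mpr ⟨ω, this⟩

lemma avgOn_nonneg (hf : ∀ ω ∈ Ω, 0 ≤ f ω) (c : γ) : 0 ≤ avgOn Ω κ f c :=
  div_nonneg (Finset.sum_nonneg fun ω hω => hf ω (Finset.mem_filter.mp hω).1) (by positivity)

lemma avgOn_le_one (hf : ∀ ω ∈ Ω, f ω ≤ 1) (c : γ) : avgOn Ω κ f c ≤ 1 := by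
  refine div_le_one_of_le₀ ?_ (by positivity)
  calc _ ≤ ∑ ω ∈ cell Ω κ c, (1 : ℝ) :=
        Finset.sum_le_sum fun ω hω => hf ω (Finset.mem_filter.mp hω).1
    _ = _ := by simp

lemma sum_avgOn_mul (g : γ → ℝ) :
    ∑ ω ∈ Ω, avgOn Ω κ f (κ ω) * g (κ ω) = ∑ ω ∈ Ω, f ω * g (κ ω) := by
  have h1 : ∀ ω ∈ Ω, avgOn Ω κ f (κ ω) * g (κ ω) =
      ∑ ω' ∈ Ω, if κ ω' = κ ω then f ω' * g (κ ω') * (1 / (cell Ω κ (κ ω')).card) else 0 := by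
    intro ω _
    rw [← Finset.sum_filter, avgOn, div_mul_eq_mul_div, Finset.sum_mul, Finset.sum_div]
    refine Finset.sum_congr rfl fun ω' hω' => ?_
    rw [(Finset.mem_filter.mp hω').2]; ring
  rw [Finset.sum_congr rfl h1, Finset.sum_comm]
  refine Finset.sum_congr rfl fun ω' hω' => ?_
  have h2 : ∀ ω, (if κ ω' = κ ω then f ω' * g (κ ω') * (1 / ((cell Ω κ (κ ω')).card : ℝ)) else 0) =
      if κ ω = κ ω' then f ω' * g (κ ω') * (1 / ((cell Ω κ (κ ω')).card : ℝ)) else 0 := by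
    intro ω; simp only [eq_comm]
  simp_rw [h2]
  rw [← Finset.sum_filter, Finset.sum_const, nsmul_eq_mul]
  have := card_cell_pos Ω κ hω'
  change ((cell Ω κ (κ ω')).card : ℝ) * _ = _
  field_simp

lemma energy_nonneg : 0 ≤ energy Ω κ f := Finset.sum_nonneg fun _ _ => sq_nonneg _

lemma energy_le_card (hf0 : ∀ ω ∈ Ω, 0 ≤ f ω) (hf1 : ∀ ω ∈ Ω, f ω ≤ 1) :
    energy Ω κ f ≤ Ω.card := by
  calc _ ≤ ∑ ω ∈ Ω, (1 : ℝ) := Finset.sum_le_sum fun ω _ =>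
        pow_le_one₀ (avgOn_nonneg Ω κ f hf0 _) (avgOn_le_one Ω κ f hf1 _)
    _ = _ := by simp

variable {κ f} {κ' : β → γ'} {r : γ' → γ}

lemma sum_sq_avgOn_sub (hr : ∀ ω ∈ Ω, κ ω = r (κ' ω)) :
    ∑ ω ∈ Ω, (avgOn Ω κ' f (κ' ω) - avgOn Ω κ f (κ ω)) ^ 2 = energy Ω κ' f - energy Ω κ f := by
  have h1 : ∑ ω ∈ Ω, avgOn Ω κ' f (κ' ω) * avgOn Ω κ f (κ ω) =
      ∑ ω ∈ Ω, f ω * avgOn Ω κ f (κ ω) := by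
    have := sum_avgOn_mul Ω κ' f (fun c => avgOn Ω κ f (r c))
    have e1 : ∑ ω ∈ Ω, avgOn Ω κ' f (κ' ω) * avgOn Ω κ f (κ ω) =
        ∑ ω ∈ Ω, avgOn Ω κ' f (κ' ω) * avgOn Ω κ f (r (κ' ω)) :=
      Finset.sum_congr rfl fun ω hω => by rw [hr ω hω]
    have e2 : ∑ ω ∈ Ω, f ω * avgOn Ω κ f (κ ω) = ∑ ω ∈ Ω, f ω * avgOn Ω κ f (r (κ' ω)) :=
      Finset.sum_congr rfl fun ω hω => by rw [hr ω hω]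
    rw [e1, e2]
    exact this
  have h2 := sum_avgOn_mul Ω κ f (fun c => avgOn Ω κ f c)
  unfold energy
  have : ∀ ω, (avgOn Ω κ' f (κ' ω) - avgOn Ω κ f (κ ω)) ^ 2 = avgOn Ω κ' f (κ' ω) ^ 2 -
      2 * (avgOn Ω κ' f (κ' ω) * avgOn Ω κ f (κ ω)) + avgOn Ω κ f (κ ω) ^ 2 := fun ω => by ring
  simp_rw [this, Finset.sum_add_distrib, Finset.sum_sub_distrib, ← Finset.mul_sum]
  rw [h1, ← h2]
  simp_rw [← sq]
  ring

lemma energy_mono (hr : ∀ ω ∈ Ω, κ ω = r (κ' ω)) : energy Ω κ f ≤ energy Ω κ' f := by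
  have := sum_sq_avgOn_sub Ω (f := f) hr
  have h : 0 ≤ ∑ ω ∈ Ω, (avgOn Ω κ' f (κ' ω) - avgOn Ω κ f (κ ω)) ^ 2 :=
    Finset.sum_nonneg fun _ _ => sq_nonneg _
  linarith

lemma sq_sum_le_energy_sub (hr : ∀ ω ∈ Ω, κ ω = r (κ' ω)) (G : γ' → ℝ) (hG : ∀ c, |G c| ≤ 1) :
    (∑ ω ∈ Ω, (f ω - avgOn Ω κ f (κ ω)) * G (κ' ω)) ^ 2 ≤
      Ω.card * (energy Ω κ' f - energy Ω κ f) := by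
  have h1 : ∑ ω ∈ Ω, (f ω - avgOn Ω κ f (κ ω)) * G (κ' ω) =
      ∑ ω ∈ Ω, G (κ' ω) * (avgOn Ω κ' f (κ' ω) - avgOn Ω κ f (κ ω)) := by
    simp_rw [sub_mul, mul_sub, Finset.sum_sub_distrib]
    rw [← sum_avgOn_mul Ω κ' f G]
    simp_rw [mul_comm]
  rw [h1, ← sum_sq_avgOn_sub Ω hr]
  refine (Finset.sum_mul_sq_le_sq_mul_sq _ _ _).trans ?_
  refine mul_le_mul_of_nonneg_right ?_ (Finset.sum_nonneg fun _ _ => sq_nonneg _)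
  calc _ ≤ ∑ ω ∈ Ω, (1 : ℝ) := Finset.sum_le_sum fun ω _ => by
        rw [← sq_abs]; exact pow_le_one₀ (abs_nonneg _) (hG _)
    _ = _ := by simp

/-- Few points lie in cells on which a nonnegative function has large average. -/
lemma card_avgOn_gt_le (Ω : Finset β) (κ : β → γ) (g : β → ℝ) (hg : ∀ ω ∈ Ω, 0 ≤ g ω)
    (s : ℝ) :
    s * ((Ω.filter fun ω => s < avgOn Ω κ g (κ ω)).card : ℝ) ≤ ∑ ω ∈ Ω, g ω := by
  have h1 := sum_avgOn_mul Ω κ g (fun _ => 1)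
  simp only [mul_one] at h1
  rw [← h1, mul_comm, ← nsmul_eq_mul, ← Finset.sum_const]
  calc _ ≤ ∑ ω ∈ Ω.filter fun ω => s < avgOn Ω κ g (κ ω), avgOn Ω κ g (κ ω) :=
        Finset.sum_le_sum fun ω hω => (Finset.mem_filter.mp hω).2.le
    _ ≤ _ := Finset.sum_le_sum_of_subset_of_nonneg (Finset.filter_subset _ _)
        fun ω _ _ => avgOn_nonneg Ω κ g hg _

end Cells

lemma exists_code (K : Type) [Fintype K] [Nonempty K] :
    ∃ (M : ℕ) (enc : K → ℕ) (dec : ℕ → K), (∀ k, enc k < M) ∧ ∀ k, dec (enc k) = k := by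
  refine ⟨Fintype.card K, fun k => (Fintype.equivFin K k).val,
    Function.invFun fun k => (Fintype.equivFin K k).val, fun k => Fin.isLt _, ?_⟩
  exact Function.leftInverse_invFun fun a b h => (Fintype.equivFin K).injective (Fin.ext h)

/-- The energy increment strategy, with sizes controlled uniformly. -/
theorem energy_iteration {E C : Type*} (size : E → C → ℕ → Prop)
    (hmono : ∀ e c m m', m ≤ m' → size e c m → size e c m') (R : E → C → C → Prop)
    (hrefl : ∀ e c, R e c c) (htrans : ∀ e c c' c'', R e c c' → R e c' c'' → R e c c'')
    (en : E → C → ℝ) (h0 : ∀ e c, 0 ≤ en e c) (h1 : ∀ e c, en e c ≤ 1) (good : E → C → Prop)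
    (δ : ℝ) (hδ : 0 < δ)
    (step : ∀ m, ∃ m', ∀ e c, size e c m → good e c ∨
      ∃ c', size e c' m' ∧ R e c c' ∧ en e c + δ ≤ en e c') (m : ℕ) :
    ∃ M, ∀ e c, size e c m → ∃ c', size e c' M ∧ R e c c' ∧ good e c' := by
  have main : ∀ k m : ℕ, ∃ M, ∀ e c, size e c m → 1 - en e c < k * δ →
      ∃ c', size e c' M ∧ R e c c' ∧ good e c' := by
    intro k
    induction k with
    | zero =>
      intro m
      refine ⟨0, fun e c _ h => ?_⟩
      have := h1 e c
      simp only [Nat.cast_zero, zero_mul] at h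
      linarith
    | succ k ih =>
      intro m
      obtain ⟨m', hm'⟩ := step m
      obtain ⟨M, hM⟩ := ih m'
      refine ⟨max m M, fun e c hc h => ?_⟩
      rcases hm' e c hc with hg | ⟨c', hs, hR, hen⟩
      · exact ⟨c, hmono e c _ _ (le_max_left _ _) hc, hrefl e c, hg⟩
      · obtain ⟨c'', hs', hR', hg⟩ := hM e c' hs (by push_cast at h; linarith)
        exact ⟨c'', hmono e c'' _ _ (le_max_right _ _) hs', htrans e _ _ _ hR hR', hg⟩
  obtain ⟨k, hk⟩ := exists_nat_gt (1 / δ)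
  obtain ⟨M, hM⟩ := main k m
  refine ⟨M, fun e c hc => hM e c hc ?_⟩
  rw [div_lt_iff₀ hδ] at hk
  have := h0 e c
  linarith

/-- The sign attached to a Boolean. -/
def sgn (b : Bool) : ℝ := if b then 1 else -1

lemma abs_sgn (b : Bool) : |sgn b| = 1 := by cases b <;> simp [sgn]

lemma exists_sgn_ge {β : Type*} (Ω : Finset β) (S g : β → ℝ) (hg : ∀ ω, |g ω| ≤ 1) :
    ∃ s : β → Bool, |∑ ω ∈ Ω, g ω * S ω| ≤ |∑ ω ∈ Ω, sgn (s ω) * S ω| := by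
  refine ⟨fun ω => decide (0 ≤ S ω), ?_⟩
  have h1 : ∀ ω, sgn (decide (0 ≤ S ω)) * S ω = |S ω| := by
    intro ω
    by_cases h : 0 ≤ S ω
    · simp [sgn, h, abs_of_nonneg h]
    · simp [sgn, h, abs_of_neg (not_le.mp h)]
  simp_rw [h1]
  refine le_trans ?_ (le_abs_self _)
  refine (Finset.abs_sum_le_sum_abs _ _).trans (Finset.sum_le_sum fun ω _ => ?_)
  rw [abs_mul]
  exact mul_le_of_le_one_left (abs_nonneg _) (hg ω)

lemma exists_sgn_comp_ge {β γ : Type*} (Ω : Finset β) (π : β → γ) (T : β → ℝ) (g : γ → ℝ)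
    (hg : ∀ c, |g c| ≤ 1) :
    ∃ s : γ → Bool, |∑ ω ∈ Ω, g (π ω) * T ω| ≤ |∑ ω ∈ Ω, sgn (s (π ω)) * T ω| := by
  obtain ⟨s, hs⟩ := exists_sgn_ge (Ω.image π) (fun c => ∑ ω ∈ Ω.filter fun ω => π ω = c, T ω) g hg
  have key : ∀ G : γ → ℝ, ∑ c ∈ Ω.image π, G c * ∑ ω ∈ Ω.filter (fun ω => π ω = c), T ω =
      ∑ ω ∈ Ω, G (π ω) * T ω := by
    intro G
    rw [← Finset.sum_fiberwise_of_maps_to (g := π) (t := Ω.image π)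
      (fun ω hω => Finset.mem_image_of_mem _ hω)]
    refine Finset.sum_congr rfl fun c _ => ?_
    rw [Finset.mul_sum]
    refine Finset.sum_congr rfl fun ω hω => ?_
    rw [(Finset.mem_filter.mp hω).2]
  refine ⟨s, ?_⟩
  rw [← key g, ← key fun c => sgn (s c)]
  exact hs

/-- The triple of labels that a labelling of pairs induces on a triple. -/
def pairLabels (q : ℕ → ℕ → ℕ) (ω : ℕ × ℕ × ℕ) : ℕ × ℕ × ℕ :=
  (q ω.1 ω.2.1, q ω.2.1 ω.2.2, q ω.1 ω.2.2)

/-- The ordered triples of elements of `V`. -/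
def triples (V : Finset ℕ) : Finset (ℕ × ℕ × ℕ) := V ×ˢ V ×ˢ V

lemma card_triples (V : Finset ℕ) : ((triples V).card : ℝ) = (V.card : ℝ) ^ 3 := by
  simp [triples, Finset.card_product]; ring

/-- A weak regularity lemma for functions of triples, tested against functions of pairs. -/
theorem weak_regularity_triples (m : ℕ) (τ : ℝ) (hτ : 0 < τ) : ∃ M : ℕ, ∀ (V : Finset ℕ)
    (f : ℕ × ℕ × ℕ → ℝ), (∀ ω, 0 ≤ f ω) → (∀ ω, f ω ≤ 1) → ∀ q : ℕ → ℕ → ℕ,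
    (∀ x y, q x y < m) → ∃ q' : ℕ → ℕ → ℕ, (∀ x y, q' x y < M) ∧
      (∃ r : ℕ → ℕ, ∀ x y, q x y = r (q' x y)) ∧
      ∀ a b c : ℕ × ℕ → ℝ, (∀ p, |a p| ≤ 1) → (∀ p, |b p| ≤ 1) → (∀ p, |c p| ≤ 1) →
        |∑ ω ∈ triples V, (f ω - avgOn (triples V) (pairLabels q') f (pairLabels q' ω)) *
          (a (ω.1, ω.2.1) * b ω.2 * c (ω.1, ω.2.2))| ≤ τ * (V.card : ℝ) ^ 3 := by
  have iter := energy_iteration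
    (E := Finset ℕ × {f : ℕ × ℕ × ℕ → ℝ // (∀ ω, 0 ≤ f ω) ∧ ∀ ω, f ω ≤ 1}) (C := ℕ → ℕ → ℕ)
    (fun _ q m => ∀ x y, q x y < m) (fun e q m m' h hq x y => (hq x y).trans_le h)
    (fun _ q q' => ∃ r : ℕ → ℕ, ∀ x y, q x y = r (q' x y))
    (fun _ q => ⟨id, fun _ _ => rfl⟩)
    (by
      rintro e q q' q'' ⟨r, hr⟩ ⟨r', hr'⟩
      exact ⟨r ∘ r', fun x y => by rw [hr, hr']; rfl⟩)
    (fun e q => energy (triples e.1) (pairLabels q) e.2.1 / (e.1.card : ℝ) ^ 3)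
    (fun e q => div_nonneg (energy_nonneg _ _ _) (by positivity))
    (fun e q => by
      refine div_le_one_of_le₀ ?_ (by positivity)
      rw [← card_triples]
      exact energy_le_card _ _ _ (fun ω _ => e.2.2.1 ω) (fun ω _ => e.2.2.2 ω))
    (fun e q => ∀ a b c : ℕ × ℕ → Bool,
      |∑ ω ∈ triples e.1,
        (e.2.1 ω - avgOn (triples e.1) (pairLabels q) e.2.1 (pairLabels q ω)) *
          (sgn (a (ω.1, ω.2.1)) * sgn (b ω.2) * sgn (c (ω.1, ω.2.2)))| ≤
            τ * (e.1.card : ℝ) ^ 3)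
    (τ ^ 2) (by positivity) ?_ m
  · obtain ⟨M, hM⟩ := iter
    refine ⟨M, fun V f hf0 hf1 q hq => ?_⟩
    obtain ⟨q', hq', hR, hgood⟩ := hM (V, ⟨f, hf0, hf1⟩) q hq
    refine ⟨q', hq', hR, fun a b c ha hb hc => ?_⟩
    set φ : ℕ × ℕ × ℕ → ℝ :=
      fun ω => f ω - avgOn (triples V) (pairLabels q') f (pairLabels q' ω)
    obtain ⟨a', ha'⟩ := exists_sgn_comp_ge (triples V) (fun ω => (ω.1, ω.2.1))
      (fun ω => φ ω * (b ω.2 * c (ω.1, ω.2.2))) a ha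
    obtain ⟨b', hb'⟩ := exists_sgn_comp_ge (triples V) (fun ω => ω.2)
      (fun ω => φ ω * (sgn (a' (ω.1, ω.2.1)) * c (ω.1, ω.2.2))) b hb
    obtain ⟨c', hc'⟩ := exists_sgn_comp_ge (triples V) (fun ω => (ω.1, ω.2.2))
      (fun ω => φ ω * (sgn (a' (ω.1, ω.2.1)) * sgn (b' ω.2))) c hc
    calc _ = |∑ ω ∈ triples V, a (ω.1, ω.2.1) * (φ ω * (b ω.2 * c (ω.1, ω.2.2)))| := by
          congr 1; exact Finset.sum_congr rfl fun ω _ => by ring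
      _ ≤ _ := ha'
      _ = |∑ ω ∈ triples V, b ω.2 * (φ ω * (sgn (a' (ω.1, ω.2.1)) * c (ω.1, ω.2.2)))| := by
          congr 1; exact Finset.sum_congr rfl fun ω _ => by ring
      _ ≤ _ := hb'
      _ = |∑ ω ∈ triples V, c (ω.1, ω.2.2) *
            (φ ω * (sgn (a' (ω.1, ω.2.1)) * sgn (b' ω.2)))| := by
          congr 1; exact Finset.sum_congr rfl fun ω _ => by ring
      _ ≤ _ := hc'
      _ = |∑ ω ∈ triples V, φ ω * (sgn (a' (ω.1, ω.2.1)) * sgn (b' ω.2) *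
            sgn (c' (ω.1, ω.2.2)))| := by
          congr 1; exact Finset.sum_congr rfl fun ω _ => by ring
      _ ≤ _ := hgood a' b' c'
  · intro m
    obtain ⟨M, enc, dec, hM, hdec⟩ := exists_code (Fin (m + 1) × Bool × Bool × Bool)
    refine ⟨M, fun e q hq => ?_⟩
    rw [or_iff_not_imp_left]
    intro hbad
    push Not at hbad
    obtain ⟨a, b, c, habc⟩ := hbad
    obtain ⟨q', hq'⟩ : ∃ q' : ℕ → ℕ → ℕ, ∀ x y, q' x y = enc
        (⟨q x y, (hq x y).trans (Nat.lt_succ_self m)⟩, a (x, y), b (x, y), c (x, y)) :=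
      ⟨_, fun _ _ => rfl⟩
    have hr : ∀ x y, q x y = (dec (q' x y)).1 := fun x y => by rw [hq', hdec]
    refine ⟨q', fun x y => by rw [hq']; exact hM _, ⟨fun n => (dec n).1, hr⟩, ?_⟩
    have hcs := sq_sum_le_energy_sub (triples e.1) (κ := pairLabels q) (κ' := pairLabels q')
      (f := e.2.1) (r := fun s => ((dec s.1).1, (dec s.2.1).1, (dec s.2.2).1))
      (fun ω _ => by simp only [pairLabels, hr])
      (fun s => sgn (dec s.1).2.1 * sgn (dec s.2.1).2.2.1 * sgn (dec s.2.2).2.2.2)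
      (fun s => by simp only [abs_mul, abs_sgn]; norm_num)
    have e1 : ∀ ω : ℕ × ℕ × ℕ, sgn (dec (pairLabels q' ω).1).2.1 *
        sgn (dec (pairLabels q' ω).2.1).2.2.1 * sgn (dec (pairLabels q' ω).2.2).2.2.2 =
        sgn (a (ω.1, ω.2.1)) * sgn (b ω.2) * sgn (c (ω.1, ω.2.2)) := by
      intro ω; simp only [pairLabels, hq', hdec]
    simp only [e1] at hcs
    have hV : 0 < (e.1.card : ℝ) := by
      rcases Finset.eq_empty_or_nonempty e.1 with h | h
      · rw [h] at habc; simp [triples] at habc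
      · exact_mod_cast Finset.card_pos.mpr h
    rw [card_triples] at hcs
    generalize (e.1.card : ℝ) = n at habc hcs hV ⊢
    have hsq : (τ * n ^ 3) ^ 2 < _ := pow_lt_pow_left₀ habc (by positivity) two_ne_zero
    rw [sq_abs] at hsq
    have hfin := hsq.trans_le hcs
    rw [div_add' _ _ _ (by positivity)]
    refine div_le_div_of_nonneg_right ?_ (by positivity)
    have h3 : 0 < n ^ 3 := by positivity
    have : n ^ 3 * (τ ^ 2 * n ^ 3) ≤ n ^ 3 *
        (energy (triples e.1) (pairLabels q') e.2.1 - energy (triples e.1) (pairLabels q) e.2.1) := by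
      linarith [hfin]
    have := le_of_mul_le_mul_left this h3
    linarith

/-- The density of the weight `e` between `X` and `Y`. -/
noncomputable def pairDens (X Y : Finset ℕ) (e : ℕ → ℕ → ℝ) : ℝ :=
  (∑ x ∈ X, ∑ y ∈ Y, e x y) / ((X.card : ℝ) * (Y.card : ℝ))

/-- The weight `e` is within `ε` of the constant `d` in the cut norm, relative to `X × Y`. -/
def CutReg (X Y : Finset ℕ) (e : ℕ → ℕ → ℝ) (d ε : ℝ) : Prop :=
  ∀ u v : ℕ → ℝ, (∀ x, |u x| ≤ 1) → (∀ y, |v y| ≤ 1) →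
    |∑ x ∈ X, ∑ y ∈ Y, (e x y - d) * (u x * v y)| ≤ ε * ((X.card : ℝ) * (Y.card : ℝ))

/-- The class with label `i` of the vertex labelling `p`. -/
def cls (V : Finset ℕ) (p : ℕ → ℕ) (i : ℕ) : Finset ℕ := V.filter fun x => p x = i

/-- The weight of the pairs of colour `α`. -/
noncomputable def col (q : ℕ → ℕ → ℕ) (α : ℕ) (x y : ℕ) : ℝ := if q x y = α then 1 else 0

lemma col_nonneg (q : ℕ → ℕ → ℕ) (α x y : ℕ) : 0 ≤ col q α x y := by
  unfold col; split_ifs <;> norm_num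

lemma col_le_one (q : ℕ → ℕ → ℕ) (α x y : ℕ) : col q α x y ≤ 1 := by
  unfold col; split_ifs <;> norm_num

/-- All colours are regular between the classes `i` and `j`. -/
def GoodPair (V : Finset ℕ) (p : ℕ → ℕ) (q : ℕ → ℕ → ℕ) (ℓ : ℕ) (ε : ℝ) (c : ℕ × ℕ) : Prop :=
  ∀ α < ℓ, CutReg (cls V p c.1) (cls V p c.2) (col q α)
    (pairDens (cls V p c.1) (cls V p c.2) (col q α)) ε

/-- The pair of labels of a pair of vertices. -/
def vertexLabels (p : ℕ → ℕ) (ω : ℕ × ℕ) : ℕ × ℕ := (p ω.1, p ω.2)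

lemma cell_vertexLabels (V : Finset ℕ) (p : ℕ → ℕ) (c : ℕ × ℕ) :
    cell (V ×ˢ V) (vertexLabels p) c = cls V p c.1 ×ˢ cls V p c.2 := by
  ext ω
  simp only [cell, cls, vertexLabels, Finset.mem_filter, Finset.mem_product, Prod.ext_iff]
  tauto

lemma filter_vertexLabels (V : Finset ℕ) (p : ℕ → ℕ) (c : ℕ × ℕ) :
    (V ×ˢ V).filter (fun ω => vertexLabels p ω = c) = cls V p c.1 ×ˢ cls V p c.2 := by
  ext ω
  simp only [cls, vertexLabels, Finset.mem_filter, Finset.mem_product, Prod.ext_iff]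
  tauto

lemma avgOn_vertexLabels (V : Finset ℕ) (p : ℕ → ℕ) (e : ℕ → ℕ → ℝ) (c : ℕ × ℕ) :
    avgOn (V ×ˢ V) (vertexLabels p) (fun ω => e ω.1 ω.2) c =
      pairDens (cls V p c.1) (cls V p c.2) e := by
  rw [avgOn, pairDens, cell_vertexLabels, Finset.sum_product, Finset.card_product]
  push_cast
  rfl

lemma exists_sgn_of_not_cutReg {X Y : Finset ℕ} {e : ℕ → ℕ → ℝ} {d ε : ℝ}
    (h : ¬ CutReg X Y e d ε) : ∃ u v : ℕ → Bool, ε * ((X.card : ℝ) * (Y.card : ℝ)) <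
      ∑ ω ∈ X ×ˢ Y, (e ω.1 ω.2 - d) * (sgn (u ω.1) * sgn (v ω.2)) := by
  unfold CutReg at h
  push Not at h
  obtain ⟨u, v, hu, hv, huv⟩ := h
  obtain ⟨u', hu'⟩ := exists_sgn_comp_ge (X ×ˢ Y) Prod.fst
    (fun ω => (e ω.1 ω.2 - d) * v ω.2) u hu
  obtain ⟨v', hv'⟩ := exists_sgn_comp_ge (X ×ˢ Y) Prod.snd
    (fun ω => (e ω.1 ω.2 - d) * sgn (u' ω.1)) v hv
  have key : ε * ((X.card : ℝ) * (Y.card : ℝ)) <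
      |∑ ω ∈ X ×ˢ Y, (e ω.1 ω.2 - d) * (sgn (u' ω.1) * sgn (v' ω.2))| :=
    calc _ < _ := huv
      _ = |∑ ω ∈ X ×ˢ Y, u ω.1 * ((e ω.1 ω.2 - d) * v ω.2)| := by
          rw [Finset.sum_product]
          congr 1
          exact Finset.sum_congr rfl fun x _ => Finset.sum_congr rfl fun y _ => by ring
      _ ≤ _ := hu'
      _ = |∑ ω ∈ X ×ˢ Y, v ω.2 * ((e ω.1 ω.2 - d) * sgn (u' ω.1))| := by
          congr 1; exact Finset.sum_congr rfl fun ω _ => by ring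
      _ ≤ _ := hv'
      _ = _ := by congr 1; exact Finset.sum_congr rfl fun ω _ => by ring
  rcases lt_abs.mp key with h | h
  · exact ⟨u', v', h⟩
  · refine ⟨fun x => !u' x, v', h.trans_eq ?_⟩
    rw [← Finset.sum_neg_distrib]
    refine Finset.sum_congr rfl fun ω _ => ?_
    have : sgn (!u' ω.1) = - sgn (u' ω.1) := by cases u' ω.1 <;> simp [sgn]
    rw [this]; ring

/-- Szemerédi's regularity lemma for a colouring of the pairs. -/
theorem graph_regularity (ℓ t₀ : ℕ) (ε η : ℝ) (hε : 0 < ε) (hη : 0 < η) :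
    ∃ T : ℕ, ∀ (V : Finset ℕ) (q : ℕ → ℕ → ℕ) (p₀ : ℕ → ℕ), (∀ x, p₀ x < t₀) →
      ∃ p : ℕ → ℕ, (∀ x, p x < T) ∧ (∃ r : ℕ → ℕ, ∀ x, p₀ x = r (p x)) ∧
        (((V ×ˢ V).filter fun ω => ¬ GoodPair V p q ℓ ε (vertexLabels p ω)).card : ℝ) ≤
          η * (V.card : ℝ) ^ 2 := by
  set μ : ℝ := ε * η / (ℓ + 1) with hμ
  have hμ0 : 0 < μ := by positivity
  have iter := energy_iteration (E := Finset ℕ × (ℕ → ℕ → ℕ)) (C := ℕ → ℕ)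
    (fun _ p m => ∀ x, p x < m) (fun e p m m' h hp x => (hp x).trans_le h)
    (fun _ p p' => ∃ r : ℕ → ℕ, ∀ x, p x = r (p' x)) (fun _ p => ⟨id, fun _ => rfl⟩)
    (by
      rintro e p p' p'' ⟨r, hr⟩ ⟨r', hr'⟩
      exact ⟨r ∘ r', fun x => by rw [hr, hr']; rfl⟩)
    (fun e p => (∑ α ∈ Finset.range ℓ, energy (e.1 ×ˢ e.1) (vertexLabels p)
      fun ω => col e.2 α ω.1 ω.2) / (ℓ * (e.1.card : ℝ) ^ 2))
    (fun e p => div_nonneg (Finset.sum_nonneg fun _ _ => energy_nonneg _ _ _) (by positivity))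
    (fun e p => by
      refine div_le_one_of_le₀ ?_ (by positivity)
      calc _ ≤ ∑ α ∈ Finset.range ℓ, ((e.1 ×ˢ e.1).card : ℝ) :=
            Finset.sum_le_sum fun α _ => energy_le_card _ _ _ (fun ω _ => col_nonneg _ _ _ _)
              (fun ω _ => col_le_one _ _ _ _)
        _ = _ := by simp [Finset.card_product, sq])
    (fun e p => ∀ α < ℓ, ∀ (B : ℕ × ℕ → Bool) (u v : ℕ × ℕ → ℕ → Bool),
      |∑ ω ∈ e.1 ×ˢ e.1, (col e.2 α ω.1 ω.2 - avgOn (e.1 ×ˢ e.1) (vertexLabels p)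
          (fun ω => col e.2 α ω.1 ω.2) (vertexLabels p ω)) *
        ((if B (vertexLabels p ω) then 1 else 0) *
          (sgn (u (vertexLabels p ω) ω.1) * sgn (v (vertexLabels p ω) ω.2)))| ≤
            μ * (e.1.card : ℝ) ^ 2)
    (μ ^ 2 / (ℓ + 1)) (by positivity) ?_ t₀
  · obtain ⟨T, hT⟩ := iter
    refine ⟨T, fun V q p₀ hp₀ => ?_⟩
    obtain ⟨p, hp, hR, hgood⟩ := hT (V, q) p₀ hp₀
    refine ⟨p, hp, hR, ?_⟩
    simp only at hgood
    set bad : ℕ → ℕ × ℕ → Prop := fun α c => ¬ CutReg (cls V p c.1) (cls V p c.2) (col q α)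
      (pairDens (cls V p c.1) (cls V p c.2) (col q α)) ε with hbad
    have hα : ∀ α < ℓ, (((V ×ˢ V).filter fun ω => bad α (vertexLabels p ω)).card : ℝ) ≤
        μ / ε * (V.card : ℝ) ^ 2 := by
      intro α hα
      have hex : ∀ c : ℕ × ℕ, ∃ u v : ℕ → Bool, bad α c →
          ε * (((cls V p c.1).card : ℝ) * ((cls V p c.2).card : ℝ)) <
          ∑ ω ∈ cls V p c.1 ×ˢ cls V p c.2, (col q α ω.1 ω.2 -
            pairDens (cls V p c.1) (cls V p c.2) (col q α)) * (sgn (u ω.1) * sgn (v ω.2)) := by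
        intro c
        by_cases hc : bad α c
        · obtain ⟨u, v, h⟩ := exists_sgn_of_not_cutReg hc
          exact ⟨u, v, fun _ => h⟩
        · exact ⟨fun _ => true, fun _ => true, fun h => absurd h hc⟩
      choose u v huv using hex
      have hg := (le_abs_self _).trans (hgood α hα (fun c => decide (bad α c)) u v)
      have hlow : ε * (((V ×ˢ V).filter fun ω => bad α (vertexLabels p ω)).card : ℝ) ≤
          ∑ ω ∈ V ×ˢ V, (col q α ω.1 ω.2 - avgOn (V ×ˢ V) (vertexLabels p)
            (fun ω => col q α ω.1 ω.2) (vertexLabels p ω)) *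
          ((if decide (bad α (vertexLabels p ω)) then 1 else 0) *
            (sgn (u (vertexLabels p ω) ω.1) * sgn (v (vertexLabels p ω) ω.2))) := by
        have e1 : ε * (((V ×ˢ V).filter fun ω => bad α (vertexLabels p ω)).card : ℝ) =
            ∑ ω ∈ V ×ˢ V, if bad α (vertexLabels p ω) then ε else 0 := by
          rw [← Finset.sum_filter, Finset.sum_const, nsmul_eq_mul, mul_comm]
        rw [e1]
        have hm : ∀ ω ∈ V ×ˢ V, vertexLabels p ω ∈ (V ×ˢ V).image (vertexLabels p) :=
          fun ω hω => Finset.mem_image_of_mem _ hω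
        rw [← Finset.sum_fiberwise_of_maps_to hm, ← Finset.sum_fiberwise_of_maps_to hm]
        refine Finset.sum_le_sum fun c _ => ?_
        have e2 : ∑ ω ∈ (V ×ˢ V).filter (fun ω => vertexLabels p ω = c),
            (if bad α (vertexLabels p ω) then ε else 0) =
            if bad α c then ε * (((cls V p c.1).card : ℝ) * ((cls V p c.2).card : ℝ)) else 0 := by
          rw [Finset.sum_congr rfl (g := fun _ => if bad α c then ε else 0) fun ω hω => by
            rw [(Finset.mem_filter.mp hω).2]]
          rw [Finset.sum_const, nsmul_eq_mul]
          rw [filter_vertexLabels, Finset.card_product]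
          push_cast
          split_ifs <;> ring
        rw [e2]
        rw [Finset.sum_congr rfl (g := fun ω : ℕ × ℕ => (col q α ω.1 ω.2 -
            pairDens (cls V p c.1) (cls V p c.2) (col q α)) *
            ((if bad α c then 1 else 0) * (sgn (u c ω.1) * sgn (v c ω.2)))) fun ω hω => by
          rw [(Finset.mem_filter.mp hω).2, avgOn_vertexLabels]; simp only [decide_eq_true_eq]]
        rw [filter_vertexLabels]
        by_cases hc : bad α c
        · simp only [hc, if_true, one_mul]
          exact (huv c hc).le
        · simp [hc]
      have hle := hlow.trans hg
      rw [div_mul_eq_mul_div, le_div_iff₀ hε]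
      linarith
    calc _ ≤ (((Finset.range ℓ).biUnion fun α =>
          (V ×ˢ V).filter fun ω => bad α (vertexLabels p ω)).card : ℝ) := by
          refine Nat.cast_le.mpr (Finset.card_le_card fun ω hω => ?_)
          obtain ⟨h1, h2⟩ := Finset.mem_filter.mp hω
          unfold GoodPair at h2
          push Not at h2
          obtain ⟨α, hα, h⟩ := h2
          exact Finset.mem_biUnion.mpr ⟨α, Finset.mem_range.mpr hα, Finset.mem_filter.mpr ⟨h1, h⟩⟩
      _ ≤ ∑ α ∈ Finset.range ℓ, (((V ×ˢ V).filter fun ω =>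
            bad α (vertexLabels p ω)).card : ℝ) := by
          exact_mod_cast Finset.card_biUnion_le
      _ ≤ ∑ α ∈ Finset.range ℓ, μ / ε * (V.card : ℝ) ^ 2 :=
          Finset.sum_le_sum fun α h => hα α (Finset.mem_range.mp h)
      _ = (ℓ / (ℓ + 1)) * (η * (V.card : ℝ) ^ 2) := by
          rw [Finset.sum_const, nsmul_eq_mul, Finset.card_range, hμ]
          field_simp
      _ ≤ _ := by
          refine mul_le_of_le_one_left (by positivity) ?_
          rw [div_le_one (by positivity)]
          linarith
  · intro m
    obtain ⟨M, enc, dec, hM, hdec⟩ := exists_code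
      (Fin (m + 1) × (Fin (m + 1) × Fin (m + 1) → Bool) × (Fin (m + 1) × Fin (m + 1) → Bool))
    refine ⟨M, fun e p hp => ?_⟩
    rw [or_iff_not_imp_left]
    intro hbad
    push Not at hbad
    obtain ⟨α, hα, B, u, v, habc⟩ := hbad
    have hp' : ∀ x, p x < m + 1 := fun x => (hp x).trans (Nat.lt_succ_self m)
    obtain ⟨p', hp''⟩ : ∃ p' : ℕ → ℕ, ∀ x, p' x = enc
        (⟨p x, hp' x⟩, fun c => u (c.1, c.2) x, fun c => v (c.1, c.2) x) :=
      ⟨_, fun _ => rfl⟩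
    have hr : ∀ x, p x = (dec (p' x)).1 := fun x => by rw [hp'', hdec]
    refine ⟨p', fun x => by rw [hp'']; exact hM _, ⟨fun n => (dec n).1, hr⟩, ?_⟩
    have hr2 : ∀ ω ∈ e.1 ×ˢ e.1, vertexLabels p ω =
        (fun s : ℕ × ℕ => (((dec s.1).1 : ℕ), ((dec s.2).1 : ℕ))) (vertexLabels p' ω) :=
      fun ω _ => by simp only [vertexLabels, hr]
    have hcs := sq_sum_le_energy_sub (e.1 ×ˢ e.1) (κ := vertexLabels p) (κ' := vertexLabels p')
      (f := fun ω => col e.2 α ω.1 ω.2)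
      (r := fun s : ℕ × ℕ => (((dec s.1).1 : ℕ), ((dec s.2).1 : ℕ))) hr2
      (fun s => (if B ((dec s.1).1, (dec s.2).1) then 1 else 0) *
        (sgn ((dec s.1).2.1 ((dec s.1).1, (dec s.2).1)) *
          sgn ((dec s.2).2.2 ((dec s.1).1, (dec s.2).1))))
      (fun s => by
        simp only [abs_mul, abs_sgn]
        split_ifs <;> norm_num)
    have e1 : ∀ ω : ℕ × ℕ, (fun s : ℕ × ℕ => (if B ((dec s.1).1, (dec s.2).1) then 1 else 0) *
        (sgn ((dec s.1).2.1 ((dec s.1).1, (dec s.2).1)) *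
          sgn ((dec s.2).2.2 ((dec s.1).1, (dec s.2).1)))) (vertexLabels p' ω) =
        ((if B (vertexLabels p ω) then 1 else 0) *
          (sgn (u (vertexLabels p ω) ω.1) * sgn (v (vertexLabels p ω) ω.2)) : ℝ) := by
      intro ω
      change _ = (if B (p ω.1, p ω.2) then 1 else 0) *
        (sgn (u (p ω.1, p ω.2) ω.1) * sgn (v (p ω.1, p ω.2) ω.2))
      simp only [vertexLabels, hp'', hdec]
    simp only [e1] at hcs
    have hV : 0 < (e.1.card : ℝ) := by
      rcases Finset.eq_empty_or_nonempty e.1 with h | h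
      · rw [h] at habc; simp at habc
      · exact_mod_cast Finset.card_pos.mpr h
    have hsum : energy (e.1 ×ˢ e.1) (vertexLabels p') (fun ω => col e.2 α ω.1 ω.2) -
        energy (e.1 ×ˢ e.1) (vertexLabels p) (fun ω => col e.2 α ω.1 ω.2) ≤
        ∑ β ∈ Finset.range ℓ, (energy (e.1 ×ˢ e.1) (vertexLabels p')
          (fun ω => col e.2 β ω.1 ω.2) -
        energy (e.1 ×ˢ e.1) (vertexLabels p) (fun ω => col e.2 β ω.1 ω.2)) :=
      Finset.single_le_sum (f := fun β => energy (e.1 ×ˢ e.1) (vertexLabels p')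
          (fun ω => col e.2 β ω.1 ω.2) -
        energy (e.1 ×ˢ e.1) (vertexLabels p) (fun ω => col e.2 β ω.1 ω.2))
        (fun β _ => sub_nonneg.mpr (energy_mono (r := fun s : ℕ × ℕ => (((dec s.1).1 : ℕ), ((dec s.2).1 : ℕ))) _ hr2)) (Finset.mem_range.mpr hα)
    rw [Finset.sum_sub_distrib] at hsum
    have hc : ((e.1 ×ˢ e.1).card : ℝ) = (e.1.card : ℝ) ^ 2 := by
      rw [Finset.card_product]; push_cast; ring
    rw [hc] at hcs
    have hℓ : (0 : ℝ) < ℓ := by exact_mod_cast (Nat.zero_le α).trans_lt hα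
    generalize (e.1.card : ℝ) = n at habc hcs hV ⊢
    have hsq : (μ * n ^ 2) ^ 2 < _ := pow_lt_pow_left₀ habc (by positivity) two_ne_zero
    rw [sq_abs] at hsq
    have hfin := hsq.trans_le hcs
    rw [div_add' _ _ _ (by positivity)]
    refine div_le_div_of_nonneg_right ?_ (by positivity)
    have h3 : 0 < n ^ 2 := by positivity
    have h4 : μ ^ 2 / (ℓ + 1) * (ℓ * n ^ 2) ≤ μ ^ 2 * n ^ 2 := by
      have : μ ^ 2 / (ℓ + 1) * (ℓ * n ^ 2) = (ℓ / (ℓ + 1)) * (μ ^ 2 * n ^ 2) := by ring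
      rw [this]
      refine mul_le_of_le_one_left (by positivity) ?_
      rw [div_le_one (by positivity)]
      linarith
    have h5 := le_of_mul_le_mul_left
      ((by ring : n ^ 2 * (μ ^ 2 * n ^ 2) = (μ * n ^ 2) ^ 2).trans_le hfin.le) h3
    linarith

lemma abs_le_one_of_mem_unit {a : ℝ} (h0 : 0 ≤ a) (h1 : a ≤ 1) : |a| ≤ 1 :=
  abs_le.mpr ⟨by linarith, h1⟩

lemma mul_mem_unit {a b : ℝ} (ha : 0 ≤ a ∧ a ≤ 1) (hb : 0 ≤ b ∧ b ≤ 1) :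
    0 ≤ a * b ∧ a * b ≤ 1 :=
  ⟨mul_nonneg ha.1 hb.1, mul_le_one₀ ha.2 hb.1 hb.2⟩

lemma abs_mul_le_one {a b : ℝ} (ha : |a| ≤ 1) (hb : |b| ≤ 1) : |a * b| ≤ 1 := by
  rw [abs_mul]; exact mul_le_one₀ ha (abs_nonneg _) hb

lemma CutReg.sum_le {X Y : Finset ℕ} {e : ℕ → ℕ → ℝ} {d ε : ℝ} (h : CutReg X Y e d ε)
    (u v : ℕ → ℝ) (hu : ∀ x, 0 ≤ u x ∧ u x ≤ 1) (hv : ∀ y, 0 ≤ v y ∧ v y ≤ 1) :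
    ∑ x ∈ X, ∑ y ∈ Y, e x y * (u x * v y) ≤
      d * (∑ x ∈ X, ∑ y ∈ Y, u x * v y) + ε * ((X.card : ℝ) * (Y.card : ℝ)) := by
  have := (le_abs_self _).trans (h u v (fun x => abs_le_one_of_mem_unit (hu x).1 (hu x).2)
    fun y => abs_le_one_of_mem_unit (hv y).1 (hv y).2)
  simp_rw [sub_mul, Finset.sum_sub_distrib, ← Finset.mul_sum] at this
  simp_rw [← Finset.mul_sum] at this ⊢
  linarith

/-- Cut regularity controls four-cycles. -/
lemma CutReg.fourCycleSum_le {X Y : Finset ℕ} {e : ℕ → ℕ → ℝ} {d ε : ℝ} (h : CutReg X Y e d ε)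
    (he : ∀ x y, 0 ≤ e x y ∧ e x y ≤ 1) (hd : 0 ≤ d ∧ d ≤ 1) :
    fourCycleSum X Y (fun x y => e x y - d) ≤ ε * (X.card : ℝ) ^ 2 * (Y.card : ℝ) ^ 2 := by
  have hg : ∀ x y, |e x y - d| ≤ 1 := fun x y =>
    abs_le.mpr ⟨by linarith [(he x y).1, hd.2], by linarith [(he x y).2, hd.1]⟩
  have e1 : fourCycleSum X Y (fun x y => e x y - d) = ∑ x₁ ∈ X, ∑ y₁ ∈ Y, ∑ x ∈ X, ∑ y ∈ Y,
      (e x y - d) * ((e x y₁ - d) * ((e x₁ y - d) * (e x₁ y₁ - d))) := by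
    unfold fourCycleSum
    rw [Finset.sum_comm]
    refine Finset.sum_congr rfl fun x₁ _ => ?_
    rw [Finset.sum_comm' (t' := Y) (s' := fun _ => X) (by simp)]
    rw [Finset.sum_congr rfl fun y _ => Finset.sum_comm, Finset.sum_comm]
    refine Finset.sum_congr rfl fun y₁ _ => ?_
    rw [Finset.sum_comm]
    refine Finset.sum_congr rfl fun x _ => Finset.sum_congr rfl fun y _ => by ring
  rw [e1]
  calc _ ≤ ∑ x₁ ∈ X, ∑ y₁ ∈ Y, ε * ((X.card : ℝ) * (Y.card : ℝ)) :=
        Finset.sum_le_sum fun x₁ _ => Finset.sum_le_sum fun y₁ _ => (le_abs_self _).trans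
          (h (fun x => e x y₁ - d) (fun y => (e x₁ y - d) * (e x₁ y₁ - d)) (fun x => hg _ _)
            fun y => abs_mul_le_one (hg _ _) (hg _ _))
    _ = _ := by simp only [Finset.sum_const, nsmul_eq_mul]; ring

section Triads
variable {X Y Z : Finset ℕ} {e₁ e₂ e₃ : ℕ → ℕ → ℝ} {d₁ d₂ d₃ ε : ℝ}

/-- Weighted triangle counting, upper bound. -/
lemma sum_triangle_le (he₂ : ∀ x y, 0 ≤ e₂ x y ∧ e₂ x y ≤ 1)
    (he₃ : ∀ x y, 0 ≤ e₃ x y ∧ e₃ x y ≤ 1) (hd₁ : 0 ≤ d₁ ∧ d₁ ≤ 1) (hd₂ : 0 ≤ d₂ ∧ d₂ ≤ 1)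
    (hε : 0 ≤ ε) (h₁ : CutReg X Y e₁ d₁ ε) (h₂ : CutReg Y Z e₂ d₂ ε) (h₃ : CutReg X Z e₃ d₃ ε)
    (a b c : ℕ → ℝ) (ha : ∀ x, 0 ≤ a x ∧ a x ≤ 1) (hb : ∀ x, 0 ≤ b x ∧ b x ≤ 1)
    (hc : ∀ x, 0 ≤ c x ∧ c x ≤ 1) :
    ∑ x ∈ X, ∑ y ∈ Y, ∑ z ∈ Z, e₁ x y * e₂ y z * e₃ x z * (a x * b y * c z) ≤
      d₁ * d₂ * d₃ * ((∑ x ∈ X, a x) * (∑ y ∈ Y, b y) * ∑ z ∈ Z, c z) +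
        3 * ε * ((X.card : ℝ) * Y.card * Z.card) := by
  have s₁ : ∑ x ∈ X, ∑ y ∈ Y, ∑ z ∈ Z, e₁ x y * e₂ y z * e₃ x z * (a x * b y * c z) ≤
      d₁ * (∑ x ∈ X, ∑ y ∈ Y, ∑ z ∈ Z, e₂ y z * e₃ x z * (a x * b y * c z)) +
        ε * ((X.card : ℝ) * Y.card * Z.card) := by
    have c1 : ∑ x ∈ X, ∑ y ∈ Y, ∑ z ∈ Z, e₁ x y * e₂ y z * e₃ x z * (a x * b y * c z) =
        ∑ z ∈ Z, ∑ x ∈ X, ∑ y ∈ Y, e₁ x y * ((e₃ x z * (a x * c z)) * (e₂ y z * b y)) := by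
      rw [Finset.sum_congr rfl fun x _ => Finset.sum_comm, Finset.sum_comm]
      exact Finset.sum_congr rfl fun z _ => Finset.sum_congr rfl fun x _ =>
        Finset.sum_congr rfl fun y _ => by ring
    have c2 : ∑ x ∈ X, ∑ y ∈ Y, ∑ z ∈ Z, e₂ y z * e₃ x z * (a x * b y * c z) =
        ∑ z ∈ Z, ∑ x ∈ X, ∑ y ∈ Y, (e₃ x z * (a x * c z)) * (e₂ y z * b y) := by
      rw [Finset.sum_congr rfl fun x _ => Finset.sum_comm, Finset.sum_comm]
      exact Finset.sum_congr rfl fun z _ => Finset.sum_congr rfl fun x _ =>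
        Finset.sum_congr rfl fun y _ => by ring
    rw [c1, c2, Finset.mul_sum]
    calc _ ≤ ∑ z ∈ Z, (d₁ * (∑ x ∈ X, ∑ y ∈ Y, (e₃ x z * (a x * c z)) * (e₂ y z * b y)) +
          ε * ((X.card : ℝ) * Y.card)) := Finset.sum_le_sum fun z _ => h₁.sum_le _ _
            (fun x => mul_mem_unit (he₃ _ _) (mul_mem_unit (ha _) (hc _)))
            (fun y => mul_mem_unit (he₂ _ _) (hb _))
      _ = _ := by rw [Finset.sum_add_distrib, Finset.sum_const, nsmul_eq_mul]; ring
  have s₂ : ∑ x ∈ X, ∑ y ∈ Y, ∑ z ∈ Z, e₂ y z * e₃ x z * (a x * b y * c z) ≤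
      d₂ * (∑ x ∈ X, ∑ y ∈ Y, ∑ z ∈ Z, e₃ x z * (a x * b y * c z)) +
        ε * ((X.card : ℝ) * Y.card * Z.card) := by
    have c1 : ∀ x, ∑ y ∈ Y, ∑ z ∈ Z, e₂ y z * e₃ x z * (a x * b y * c z) =
        ∑ y ∈ Y, ∑ z ∈ Z, e₂ y z * (b y * (e₃ x z * (a x * c z))) := fun x =>
      Finset.sum_congr rfl fun y _ => Finset.sum_congr rfl fun z _ => by ring
    have c2 : ∀ x, ∑ y ∈ Y, ∑ z ∈ Z, e₃ x z * (a x * b y * c z) =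
        ∑ y ∈ Y, ∑ z ∈ Z, (b y * (e₃ x z * (a x * c z))) := fun x =>
      Finset.sum_congr rfl fun y _ => Finset.sum_congr rfl fun z _ => by ring
    simp_rw [c1, c2]
    rw [Finset.mul_sum]
    calc _ ≤ ∑ x ∈ X, (d₂ * (∑ y ∈ Y, ∑ z ∈ Z, (b y * (e₃ x z * (a x * c z)))) +
          ε * ((Y.card : ℝ) * Z.card)) := Finset.sum_le_sum fun x _ => h₂.sum_le _ _
            (fun y => hb _) (fun z => mul_mem_unit (he₃ _ _) (mul_mem_unit (ha _) (hc _)))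
      _ = _ := by rw [Finset.sum_add_distrib, Finset.sum_const, nsmul_eq_mul]; ring
  have s₃ : ∑ x ∈ X, ∑ y ∈ Y, ∑ z ∈ Z, e₃ x z * (a x * b y * c z) ≤
      d₃ * ((∑ x ∈ X, a x) * (∑ y ∈ Y, b y) * ∑ z ∈ Z, c z) +
        ε * ((X.card : ℝ) * Y.card * Z.card) := by
    have c1 : ∑ x ∈ X, ∑ y ∈ Y, ∑ z ∈ Z, e₃ x z * (a x * b y * c z) =
        ∑ y ∈ Y, ∑ x ∈ X, ∑ z ∈ Z, e₃ x z * ((a x * b y) * c z) := Finset.sum_comm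
    have c2 : (∑ x ∈ X, a x) * (∑ y ∈ Y, b y) * ∑ z ∈ Z, c z =
        ∑ y ∈ Y, ∑ x ∈ X, ∑ z ∈ Z, (a x * b y) * c z := by
      rw [Finset.sum_mul_sum, Finset.sum_comm]
      simp_rw [Finset.sum_mul, Finset.mul_sum]
    rw [c1, c2, Finset.mul_sum]
    calc _ ≤ ∑ y ∈ Y, (d₃ * (∑ x ∈ X, ∑ z ∈ Z, (a x * b y) * c z) +
          ε * ((X.card : ℝ) * Z.card)) := Finset.sum_le_sum fun y _ => h₃.sum_le _ _
            (fun x => mul_mem_unit (ha _) (hb _)) (fun z => hc _)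
      _ = _ := by rw [Finset.sum_add_distrib, Finset.sum_const, nsmul_eq_mul]; ring
  set N : ℝ := (X.card : ℝ) * Y.card * Z.card
  have hN : 0 ≤ ε * N := by positivity
  set S := (∑ x ∈ X, a x) * (∑ y ∈ Y, b y) * ∑ z ∈ Z, c z
  calc _ ≤ d₁ * (d₂ * (d₃ * S + ε * N) + ε * N) + ε * N := by
        refine s₁.trans (add_le_add_left ?_ _)
        refine mul_le_mul_of_nonneg_left (s₂.trans (add_le_add_left ?_ _)) hd₁.1
        exact mul_le_mul_of_nonneg_left s₃ hd₂.1
    _ = d₁ * d₂ * d₃ * S + (d₁ * d₂ * (ε * N) + d₁ * (ε * N) + ε * N) := by ring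
    _ ≤ d₁ * d₂ * d₃ * S + (ε * N + ε * N + ε * N) := by
        have := mul_mem_unit hd₁ hd₂
        have q1 := mul_le_of_le_one_left hN this.2
        have q2 := mul_le_of_le_one_left hN hd₁.2
        linarith
    _ = _ := by ring

/-- The indicator of the pairs whose codegree into `X` is at least twice its typical value. -/
noncomputable def largeCodeg (X : Finset ℕ) (e₁ e₃ : ℕ → ℕ → ℝ) (c : ℝ) (y z : ℕ) : ℝ :=
  if 2 * c * X.card < ∑ x ∈ X, e₁ x y * e₃ x z then 1 else 0

lemma largeCodeg_mem_unit (X : Finset ℕ) (e₁ e₃ : ℕ → ℕ → ℝ) (c : ℝ) (y z : ℕ) :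
    0 ≤ largeCodeg X e₁ e₃ c y z ∧ largeCodeg X e₁ e₃ c y z ≤ 1 := by
  unfold largeCodeg; split_ifs <;> norm_num

/-- Few pairs have large codegree. -/
lemma sum_largeCodeg_le (he₃ : ∀ x y, 0 ≤ e₃ x y ∧ e₃ x y ≤ 1) (hd₁ : 0 ≤ d₁ ∧ d₁ ≤ 1)
    (hε : 0 ≤ ε) (h₁ : CutReg X Y e₁ d₁ ε) (h₃ : CutReg X Z e₃ d₃ ε) :
    d₁ * d₃ * X.card * (∑ y ∈ Y, ∑ z ∈ Z, largeCodeg X e₁ e₃ (d₁ * d₃) y z) ≤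
        2 * ε * ((X.card : ℝ) * Y.card * Z.card) := by
  set χ : ℕ → ℕ → ℝ := largeCodeg X e₁ e₃ (d₁ * d₃) with hχ
  have hχ01 : ∀ y z, 0 ≤ χ y z ∧ χ y z ≤ 1 := largeCodeg_mem_unit X e₁ e₃ (d₁ * d₃)
  set B : ℝ := ∑ y ∈ Y, ∑ z ∈ Z, χ y z with hBχ
  have low : 2 * (d₁ * d₃) * X.card * B ≤ ∑ y ∈ Y, ∑ z ∈ Z, χ y z * ∑ x ∈ X, e₁ x y * e₃ x z := by
    rw [hBχ, Finset.mul_sum]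
    refine Finset.sum_le_sum fun y _ => ?_
    rw [Finset.mul_sum]
    refine Finset.sum_le_sum fun z _ => ?_
    rw [mul_comm, hχ, largeCodeg]
    split_ifs with h
    · rw [one_mul, one_mul]; exact h.le
    · simp
  have s₁ : ∑ y ∈ Y, ∑ z ∈ Z, χ y z * ∑ x ∈ X, e₁ x y * e₃ x z ≤
      d₁ * (∑ y ∈ Y, ∑ z ∈ Z, χ y z * ∑ x ∈ X, e₃ x z) +
        ε * ((X.card : ℝ) * Y.card * Z.card) := by
    have c1 : ∑ y ∈ Y, ∑ z ∈ Z, χ y z * ∑ x ∈ X, e₁ x y * e₃ x z =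
        ∑ z ∈ Z, ∑ x ∈ X, ∑ y ∈ Y, e₁ x y * (e₃ x z * χ y z) := by
      rw [Finset.sum_comm]
      refine Finset.sum_congr rfl fun z _ => ?_
      simp_rw [Finset.mul_sum]
      rw [Finset.sum_comm]
      exact Finset.sum_congr rfl fun x _ => Finset.sum_congr rfl fun y _ => by ring
    have c2 : ∑ y ∈ Y, ∑ z ∈ Z, χ y z * ∑ x ∈ X, e₃ x z =
        ∑ z ∈ Z, ∑ x ∈ X, ∑ y ∈ Y, e₃ x z * χ y z := by
      rw [Finset.sum_comm]
      refine Finset.sum_congr rfl fun z _ => ?_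
      simp_rw [Finset.mul_sum]
      rw [Finset.sum_comm]
      exact Finset.sum_congr rfl fun x _ => Finset.sum_congr rfl fun y _ => by ring
    rw [c1, c2, Finset.mul_sum]
    calc _ ≤ ∑ z ∈ Z, (d₁ * (∑ x ∈ X, ∑ y ∈ Y, e₃ x z * χ y z) +
          ε * ((X.card : ℝ) * Y.card)) := Finset.sum_le_sum fun z _ => h₁.sum_le _ _
            (fun x => he₃ _ _) (fun y => hχ01 _ _)
      _ = _ := by rw [Finset.sum_add_distrib, Finset.sum_const, nsmul_eq_mul]; ring
  have s₂ : ∑ y ∈ Y, ∑ z ∈ Z, χ y z * ∑ x ∈ X, e₃ x z ≤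
      d₃ * (X.card * B) + ε * ((X.card : ℝ) * Y.card * Z.card) := by
    have c1 : ∀ y, ∑ z ∈ Z, χ y z * ∑ x ∈ X, e₃ x z =
        ∑ x ∈ X, ∑ z ∈ Z, e₃ x z * (1 * χ y z) := by
      intro y
      simp_rw [Finset.mul_sum]
      rw [Finset.sum_comm]
      exact Finset.sum_congr rfl fun x _ => Finset.sum_congr rfl fun y _ => by ring
    have c2 : X.card * B = ∑ y ∈ Y, ∑ x ∈ X, ∑ z ∈ Z, 1 * χ y z := by
      simp_rw [Finset.sum_const, nsmul_eq_mul, one_mul, ← Finset.mul_sum]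
      rw [hBχ]
    simp_rw [c1]
    rw [c2, Finset.mul_sum]
    calc _ ≤ ∑ y ∈ Y, (d₃ * (∑ x ∈ X, ∑ z ∈ Z, 1 * χ y z) +
          ε * ((X.card : ℝ) * Z.card)) := Finset.sum_le_sum fun y _ => h₃.sum_le _ _
            (fun x => by norm_num) (fun z => hχ01 _ _)
      _ = _ := by rw [Finset.sum_add_distrib, Finset.sum_const, nsmul_eq_mul]; ring
  have s₃ := mul_le_mul_of_nonneg_left s₂ hd₁.1
  have hN : 0 ≤ ε * ((X.card : ℝ) * Y.card * Z.card) := by positivity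
  have s₄ := mul_le_of_le_one_left hN hd₁.2
  linarith

end Triads

lemma CutReg.swap {X Y : Finset ℕ} {e : ℕ → ℕ → ℝ} {d ε : ℝ} (h : CutReg X Y e d ε) :
    CutReg Y X (fun y x => e x y) d ε := by
  intro u v hu hv
  rw [Finset.sum_comm, mul_comm (Y.card : ℝ)]
  refine le_of_eq_of_le ?_ (h v u hv hu)
  congr 1
  exact Finset.sum_congr rfl fun x _ => Finset.sum_congr rfl fun y _ => by ring

lemma octSum_eq (X Y Z : Finset ℕ) (F : ℕ → ℕ → ℕ → ℝ) :
    octSum X Y Z F = ∑ u₁ ∈ X, ∑ w₁ ∈ Y, ∑ z₁ ∈ Z, ∑ u ∈ X, ∑ w ∈ Y, ∑ z ∈ Z,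
      F u w z * (F u w z₁ * F u w₁ z * F u w₁ z₁ * F u₁ w z * F u₁ w z₁ * F u₁ w₁ z *
        F u₁ w₁ z₁) := by
  unfold octSum
  simp_rw [← Finset.sum_product']
  refine Finset.sum_nbij'
    (fun a : ℕ × ℕ × ℕ × ℕ × ℕ × ℕ =>
      (a.2.1, a.2.2.2.1, a.2.2.2.2.2, a.1, a.2.2.1, a.2.2.2.2.1))
    (fun b : ℕ × ℕ × ℕ × ℕ × ℕ × ℕ =>
      (b.2.2.2.1, b.1, b.2.2.2.2.1, b.2.1, b.2.2.2.2.2, b.2.2.1)) ?_ ?_ ?_ ?_ ?_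
  · rintro a ha; simp only [Finset.mem_product] at ha ⊢; tauto
  · rintro a ha; simp only [Finset.mem_product] at ha ⊢; tauto
  · rintro a -; rfl
  · rintro a -; rfl
  · rintro a -; dsimp only; ring

section Triads
variable {X Y Z : Finset ℕ} {e₁ e₂ e₃ : ℕ → ℕ → ℝ} {d₁ d₂ d₃ ε : ℝ}

/-- The part of the octahedron sum in which one factor is replaced by a function with small
correlation with products of functions of pairs. -/
lemma sum_octSum_uniform_le {F φ : ℕ → ℕ → ℕ → ℝ} {τ : ℝ}
    (he₁ : ∀ x y, 0 ≤ e₁ x y ∧ e₁ x y ≤ 1) (he₂ : ∀ x y, 0 ≤ e₂ x y ∧ e₂ x y ≤ 1)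
    (he₃ : ∀ x y, 0 ≤ e₃ x y ∧ e₃ x y ≤ 1) (hF : ∀ x y z, |F x y z| ≤ 1)
    (hφ : ∀ a b c : ℕ → ℕ → ℝ, (∀ x y, |a x y| ≤ 1) → (∀ x y, |b x y| ≤ 1) →
      (∀ x y, |c x y| ≤ 1) →
      |∑ x ∈ X, ∑ y ∈ Y, ∑ z ∈ Z, φ x y z * (a x y * b y z * c x z)| ≤ τ) :
    ∑ u₁ ∈ X, ∑ w₁ ∈ Y, ∑ z₁ ∈ Z, ∑ u ∈ X, ∑ w ∈ Y, ∑ z ∈ Z,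
      φ u w z * (e₁ u w * e₂ w z * e₃ u z) * (F u w z₁ * F u w₁ z * F u w₁ z₁ * F u₁ w z *
        F u₁ w z₁ * F u₁ w₁ z * F u₁ w₁ z₁) ≤ ((X.card : ℝ) * Y.card * Z.card) * τ := by
  calc _ ≤ ∑ u₁ ∈ X, ∑ w₁ ∈ Y, ∑ z₁ ∈ Z, τ := by
        refine Finset.sum_le_sum fun u₁ _ => Finset.sum_le_sum fun w₁ _ =>
          Finset.sum_le_sum fun z₁ _ => (le_abs_self _).trans
            (le_of_eq_of_le ?_ (hφ (fun u w => e₁ u w * (F u w z₁ * F u w₁ z₁ * F u₁ w₁ z₁))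
              (fun w z => e₂ w z * (F u₁ w z * F u₁ w z₁ * F u₁ w₁ z))
              (fun u z => e₃ u z * F u w₁ z) ?_ ?_ ?_))
        · congr 1
          exact Finset.sum_congr rfl fun u _ => Finset.sum_congr rfl fun w _ =>
            Finset.sum_congr rfl fun z _ => by ring
        · exact fun u w => abs_mul_le_one (abs_le_one_of_mem_unit (he₁ _ _).1 (he₁ _ _).2)
            (abs_mul_le_one (abs_mul_le_one (hF _ _ _) (hF _ _ _)) (hF _ _ _))
        · exact fun u w => abs_mul_le_one (abs_le_one_of_mem_unit (he₂ _ _).1 (he₂ _ _).2)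
            (abs_mul_le_one (abs_mul_le_one (hF _ _ _) (hF _ _ _)) (hF _ _ _))
        · exact fun u w => abs_mul_le_one (abs_le_one_of_mem_unit (he₃ _ _).1 (he₃ _ _).2)
            (hF _ _ _)
    _ = _ := by simp only [Finset.sum_const, nsmul_eq_mul]; ring

/-- The number of extensions of a triangle to an octahedron. -/
lemma sum_extension_le (he₁ : ∀ x y, 0 ≤ e₁ x y ∧ e₁ x y ≤ 1)
    (he₂ : ∀ x y, 0 ≤ e₂ x y ∧ e₂ x y ≤ 1)
    (he₃ : ∀ x y, 0 ≤ e₃ x y ∧ e₃ x y ≤ 1) (hd₁ : 0 ≤ d₁ ∧ d₁ ≤ 1) (hd₂ : 0 ≤ d₂ ∧ d₂ ≤ 1)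
    (hd₃ : 0 ≤ d₃ ∧ d₃ ≤ 1)
    (hε : 0 ≤ ε) (h₁ : CutReg X Y e₁ d₁ ε) (h₂ : CutReg Y Z e₂ d₂ ε) (h₃ : CutReg X Z e₃ d₃ ε)
    (u w z : ℕ) :
    ∑ u₁ ∈ X, ∑ w₁ ∈ Y, ∑ z₁ ∈ Z, e₁ u₁ w₁ * e₂ w₁ z₁ * e₃ u₁ z₁ *
      ((e₁ u₁ w * e₃ u₁ z) * (e₁ u w₁ * e₂ w₁ z) * (e₂ w z₁ * e₃ u z₁)) ≤
    (8 * (d₁ * d₂ * d₃) ^ 3 + 3 * ε) * ((X.card : ℝ) * Y.card * Z.card) +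
      (largeCodeg X e₁ e₃ (d₁ * d₃) w z +
        largeCodeg Y (fun y x => e₁ x y) e₂ (d₁ * d₂) u z +
        largeCodeg Z (fun z y => e₂ y z) (fun z x => e₃ x z) (d₂ * d₃) w u) *
          ((X.card : ℝ) * Y.card * Z.card) := by
  set N : ℝ := (X.card : ℝ) * Y.card * Z.card with hN
  have hN0 : 0 ≤ N := by positivity
  have l₁ := largeCodeg_mem_unit X e₁ e₃ (d₁ * d₃) w z
  have l₂ := largeCodeg_mem_unit Y (fun y x => e₁ x y) e₂ (d₁ * d₂) u z
  have l₃ := largeCodeg_mem_unit Z (fun z y => e₂ y z) (fun z x => e₃ x z) (d₂ * d₃) w u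
  have hD : 0 ≤ (d₁ * d₂ * d₃) ^ 3 := by
    have := mul_nonneg (mul_nonneg hd₁.1 hd₂.1) hd₃.1
    positivity
  have hM : 0 ≤ (8 * (d₁ * d₂ * d₃) ^ 3 + 3 * ε) * N := by positivity
  by_cases hb : largeCodeg X e₁ e₃ (d₁ * d₃) w z = 0 ∧
      largeCodeg Y (fun y x => e₁ x y) e₂ (d₁ * d₂) u z = 0 ∧
      largeCodeg Z (fun z y => e₂ y z) (fun z x => e₃ x z) (d₂ * d₃) w u = 0
  · have tri := sum_triangle_le he₂ he₃ hd₁ hd₂ hε h₁ h₂ h₃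
      (fun x => e₁ x w * e₃ x z) (fun y => e₁ u y * e₂ y z) (fun t => e₂ w t * e₃ u t)
      (fun x => mul_mem_unit (he₁ _ _) (he₃ _ _)) (fun x => mul_mem_unit (he₁ _ _) (he₂ _ _))
      (fun x => mul_mem_unit (he₂ _ _) (he₃ _ _))
    rw [hb.1, hb.2.1, hb.2.2]
    have hz : ∀ {c s : ℝ}, (if c < s then (1 : ℝ) else 0) = 0 → s ≤ c := by
      intro c s h
      by_contra hlt
      rw [if_pos (not_le.mp hlt)] at h
      exact one_ne_zero h
    have k₁ := hz hb.1
    have k₂ := hz hb.2.1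
    have k₃ := hz hb.2.2
    refine tri.trans ?_
    have p₂ : 0 ≤ ∑ y ∈ Y, e₁ u y * e₂ y z :=
      Finset.sum_nonneg fun _ _ => mul_nonneg (he₁ _ _).1 (he₂ _ _).1
    have p₃ : 0 ≤ ∑ t ∈ Z, e₂ w t * e₃ u t :=
      Finset.sum_nonneg fun _ _ => mul_nonneg (he₂ _ _).1 (he₃ _ _).1
    have c₁ := mul_nonneg hd₁.1 hd₃.1
    have c₂ := mul_nonneg hd₁.1 hd₂.1
    have prod := mul_le_mul (mul_le_mul k₁ k₂ p₂ (by positivity)) k₃ p₃ (by positivity)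
    have := mul_le_mul_of_nonneg_left prod (mul_nonneg (mul_nonneg hd₁.1 hd₂.1) hd₃.1)
    rw [hN]
    linarith
  · have triv : ∑ u₁ ∈ X, ∑ w₁ ∈ Y, ∑ z₁ ∈ Z, e₁ u₁ w₁ * e₂ w₁ z₁ * e₃ u₁ z₁ *
        ((e₁ u₁ w * e₃ u₁ z) * (e₁ u w₁ * e₂ w₁ z) * (e₂ w z₁ * e₃ u z₁)) ≤ N := by
      calc _ ≤ ∑ u₁ ∈ X, ∑ w₁ ∈ Y, ∑ z₁ ∈ Z, (1 : ℝ) :=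
            Finset.sum_le_sum fun u₁ _ => Finset.sum_le_sum fun w₁ _ =>
              Finset.sum_le_sum fun z₁ _ => (mul_mem_unit
                (mul_mem_unit (mul_mem_unit (he₁ _ _) (he₂ _ _)) (he₃ _ _))
                (mul_mem_unit (mul_mem_unit (mul_mem_unit (he₁ _ _) (he₃ _ _))
                  (mul_mem_unit (he₁ _ _) (he₂ _ _))) (mul_mem_unit (he₂ _ _) (he₃ _ _)))).2
        _ = N := by simp only [Finset.sum_const, nsmul_eq_mul]; ring
    have one : ∀ {P : Prop}, (if P then (1 : ℝ) else 0) ≠ 0 → (if P then (1 : ℝ) else 0) = 1 := by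
      intro P h
      split_ifs with hP
      · rfl
      · rw [if_neg hP] at h; exact absurd rfl h
    have : 1 ≤ largeCodeg X e₁ e₃ (d₁ * d₃) w z +
        largeCodeg Y (fun y x => e₁ x y) e₂ (d₁ * d₂) u z +
        largeCodeg Z (fun z y => e₂ y z) (fun z x => e₃ x z) (d₂ * d₃) w u := by
      by_contra hlt
      refine hb ⟨?_, ?_, ?_⟩
      · by_contra h; have := one h; unfold largeCodeg at *; linarith
      · by_contra h; have := one h; unfold largeCodeg at *; linarith
      · by_contra h; have := one h; unfold largeCodeg at *; linarith
    have := mul_le_mul_of_nonneg_right this hN0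
    linarith

end Triads

section Triads
variable {X Y Z : Finset ℕ} {e₁ e₂ e₃ : ℕ → ℕ → ℝ} {d₁ d₂ d₃ ε : ℝ}

lemma sum_abs_mul_le_of_sum_sq_le {ι : Type*} (s : Finset ι) (ψ w : ι → ℝ) {κ : ℝ} (hκ : 0 < κ)
    (hw : ∀ i ∈ s, 0 ≤ w i) (h : ∑ i ∈ s, ψ i ^ 2 * w i ≤ κ ^ 2 * ∑ i ∈ s, w i) :
    ∑ i ∈ s, |ψ i| * w i ≤ κ * ∑ i ∈ s, w i := by
  have key : 2 * κ * ∑ i ∈ s, |ψ i| * w i ≤ ∑ i ∈ s, ψ i ^ 2 * w i + κ ^ 2 * ∑ i ∈ s, w i := by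
    rw [Finset.mul_sum, Finset.mul_sum, ← Finset.sum_add_distrib]
    refine Finset.sum_le_sum fun i hi => ?_
    have := mul_nonneg (sq_nonneg (|ψ i| - κ)) (hw i hi)
    rw [← sq_abs (ψ i)]
    linarith
  have : κ * (∑ i ∈ s, |ψ i| * w i) ≤ κ * (κ * ∑ i ∈ s, w i) := by linarith
  exact le_of_mul_le_mul_left this hκ

lemma abs_octahedron_rest_le {F : ℕ → ℕ → ℕ → ℝ}
    (he₁ : ∀ x y, 0 ≤ e₁ x y ∧ e₁ x y ≤ 1) (he₂ : ∀ x y, 0 ≤ e₂ x y ∧ e₂ x y ≤ 1)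
    (he₃ : ∀ x y, 0 ≤ e₃ x y ∧ e₃ x y ≤ 1)
    (hF : ∀ x y z, |F x y z| ≤ e₁ x y * e₂ y z * e₃ x z) (u w z u₁ w₁ z₁ : ℕ) :
    |F u w z₁ * F u w₁ z * F u w₁ z₁ * F u₁ w z * F u₁ w z₁ * F u₁ w₁ z * F u₁ w₁ z₁| ≤
      e₁ u₁ w₁ * e₂ w₁ z₁ * e₃ u₁ z₁ *
        ((e₁ u₁ w * e₃ u₁ z) * (e₁ u w₁ * e₂ w₁ z) * (e₂ w z₁ * e₃ u z₁)) := by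
  have r₁ : ∀ x y z, |F x y z| ≤ e₂ y z * e₃ x z := fun x y z => (hF x y z).trans (by
    have := mul_le_mul_of_nonneg_right (mul_le_of_le_one_left (he₂ y z).1 (he₁ x y).2) (he₃ x z).1
    linarith)
  have r₂ : ∀ x y z, |F x y z| ≤ e₁ x y * e₂ y z := fun x y z => (hF x y z).trans
    (mul_le_of_le_one_right (mul_mem_unit (he₁ _ _) (he₂ _ _)).1 (he₃ _ _).2)
  have r₃ : ∀ x y z, |F x y z| ≤ e₁ x y * e₃ x z := fun x y z => (hF x y z).trans
    (mul_le_mul_of_nonneg_right (mul_le_of_le_one_right (he₁ x y).1 (he₂ y z).2) (he₃ x z).1)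
  have t₁ : ∀ x y z, |F x y z| ≤ e₁ x y := fun x y z => (r₂ x y z).trans
    (mul_le_of_le_one_right (he₁ _ _).1 (he₂ _ _).2)
  have t₂ : ∀ x y z, |F x y z| ≤ e₂ y z := fun x y z => (r₁ x y z).trans
    (mul_le_of_le_one_right (he₂ _ _).1 (he₃ _ _).2)
  have t₃ : ∀ x y z, |F x y z| ≤ e₃ x z := fun x y z => (r₃ x y z).trans
    (mul_le_of_le_one_left (he₃ _ _).1 (he₁ _ _).2)
  have one : ∀ x y z, |F x y z| ≤ 1 := fun x y z => (t₁ x y z).trans (he₁ _ _).2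
  have n : ∀ x y z, 0 ≤ |F x y z| := fun x y z => abs_nonneg _
  have m₁ := (mul_mem_unit (he₂ w z₁) (he₃ u z₁)).1
  have m₂ := (mul_mem_unit (he₁ u w₁) (he₂ w₁ z)).1
  have m₃ := (mul_mem_unit (he₁ u₁ w) (he₃ u₁ z)).1
  simp only [abs_mul]
  have q₁ := mul_le_mul (r₁ u w z₁) (r₂ u w₁ z) (n _ _ _) m₁
  have q₂ := mul_le_mul q₁ (t₂ u w₁ z₁) (n _ _ _) (mul_nonneg m₁ m₂)
  have q₃ := mul_le_mul q₂ (r₃ u₁ w z) (n _ _ _) (mul_nonneg (mul_nonneg m₁ m₂) (he₂ _ _).1)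
  have m₄ := mul_nonneg (mul_nonneg (mul_nonneg m₁ m₂) (he₂ w₁ z₁).1) m₃
  have q₄ := mul_le_mul q₃ (t₃ u₁ w z₁) (n _ _ _) m₄
  have m₅ := mul_nonneg m₄ (he₃ u₁ z₁).1
  have q₅ := mul_le_mul q₄ (t₁ u₁ w₁ z) (n _ _ _) m₅
  have m₆ := mul_nonneg m₅ (he₁ u₁ w₁).1
  have q₆ := mul_le_mul q₅ (one u₁ w₁ z₁) (n _ _ _) m₆
  exact q₆.trans_eq (by ring)

/-- The part of the octahedron sum in which one factor is replaced by a function which is small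
on average on triangles. -/
lemma sum_octSum_small_le {F ψ : ℕ → ℕ → ℕ → ℝ} {κ : ℝ} (hκ : 0 < κ)
    (he₁ : ∀ x y, 0 ≤ e₁ x y ∧ e₁ x y ≤ 1)
    (he₂ : ∀ x y, 0 ≤ e₂ x y ∧ e₂ x y ≤ 1) (he₃ : ∀ x y, 0 ≤ e₃ x y ∧ e₃ x y ≤ 1)
    (hd₁ : 0 < d₁ ∧ d₁ ≤ 1) (hd₂ : 0 < d₂ ∧ d₂ ≤ 1) (hd₃ : 0 < d₃ ∧ d₃ ≤ 1)
    (hε : 0 ≤ ε) (h₁ : CutReg X Y e₁ d₁ ε) (h₂ : CutReg Y Z e₂ d₂ ε) (h₃ : CutReg X Z e₃ d₃ ε)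
    (hF : ∀ x y z, |F x y z| ≤ e₁ x y * e₂ y z * e₃ x z) (hψ : ∀ x y z, |ψ x y z| ≤ 1)
    (hψ2 : ∑ x ∈ X, ∑ y ∈ Y, ∑ z ∈ Z, ψ x y z ^ 2 * (e₁ x y * e₂ y z * e₃ x z) ≤
      κ ^ 2 * ∑ x ∈ X, ∑ y ∈ Y, ∑ z ∈ Z, e₁ x y * e₂ y z * e₃ x z) :
    d₁ * d₂ * d₃ * ∑ u₁ ∈ X, ∑ w₁ ∈ Y, ∑ z₁ ∈ Z, ∑ u ∈ X, ∑ w ∈ Y, ∑ z ∈ Z,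
      ψ u w z * (e₁ u w * e₂ w z * e₃ u z) * (F u w z₁ * F u w₁ z * F u w₁ z₁ * F u₁ w z *
        F u₁ w z₁ * F u₁ w₁ z * F u₁ w₁ z₁) ≤
    (d₁ * d₂ * d₃ * ((8 * (d₁ * d₂ * d₃) ^ 3 + 3 * ε) * (κ * (d₁ * d₂ * d₃ + 3 * ε))) + 6 * ε) *
      ((X.card : ℝ) * Y.card * Z.card) ^ 2 := by
  set N : ℝ := (X.card : ℝ) * Y.card * Z.card with hN
  set D : ℝ := d₁ * d₂ * d₃ with hD
  have hD0 : 0 < D := mul_pos (mul_pos hd₁.1 hd₂.1) hd₃.1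
  have hN0 : 0 ≤ N := by positivity
  set W : ℕ → ℕ → ℕ → ℝ := fun u w z => |ψ u w z| * (e₁ u w * e₂ w z * e₃ u z) with hW
  have T01 : ∀ u w z, 0 ≤ e₁ u w * e₂ w z * e₃ u z ∧ e₁ u w * e₂ w z * e₃ u z ≤ 1 :=
    fun u w z => mul_mem_unit (mul_mem_unit (he₁ _ _) (he₂ _ _)) (he₃ _ _)
  have W01 : ∀ u w z, 0 ≤ W u w z ∧ W u w z ≤ 1 := fun u w z =>
    mul_mem_unit ⟨abs_nonneg _, hψ _ _ _⟩ (T01 u w z)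
  have hT : ∑ x ∈ X, ∑ y ∈ Y, ∑ z ∈ Z, e₁ x y * e₂ y z * e₃ x z ≤ (D + 3 * ε) * N := by
    have := sum_triangle_le he₂ he₃ ⟨hd₁.1.le, hd₁.2⟩ ⟨hd₂.1.le, hd₂.2⟩ hε h₁ h₂ h₃
      (fun _ => 1) (fun _ => 1) (fun _ => 1) (by norm_num) (by norm_num) (by norm_num)
    simp only [mul_one, Finset.sum_const, nsmul_eq_mul] at this
    linarith
  have hWsum : ∑ x ∈ X, ∑ y ∈ Y, ∑ z ∈ Z, W x y z ≤ κ * ((D + 3 * ε) * N) := by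
    refine le_trans ?_ (mul_le_mul_of_nonneg_left hT hκ.le)
    simp_rw [← Finset.sum_product'] at hψ2 ⊢
    exact sum_abs_mul_le_of_sum_sq_le (X ×ˢ Y ×ˢ Z) (fun a => ψ a.1 a.2.1 a.2.2)
      (fun a => e₁ a.1 a.2.1 * e₂ a.2.1 a.2.2 * e₃ a.1 a.2.2) hκ
      (fun a _ => (T01 _ _ _).1) hψ2
  set ext : ℕ → ℕ → ℕ → ℕ → ℕ → ℕ → ℝ := fun u w z u₁ w₁ z₁ =>
      e₁ u₁ w₁ * e₂ w₁ z₁ * e₃ u₁ z₁ *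
        ((e₁ u₁ w * e₃ u₁ z) * (e₁ u w₁ * e₂ w₁ z) * (e₂ w z₁ * e₃ u z₁)) with hext
  set K : ℝ := 8 * D ^ 3 + 3 * ε with hK
  have hK0 : 0 ≤ K := by positivity
  set b₁ := largeCodeg X e₁ e₃ (d₁ * d₃) with hb₁
  set b₂ := largeCodeg Y (fun y x => e₁ x y) e₂ (d₁ * d₂) with hb₂
  set b₃ := largeCodeg Z (fun z y => e₂ y z) (fun z x => e₃ x z) (d₂ * d₃) with hb₃
  have s₁ : ∑ u₁ ∈ X, ∑ w₁ ∈ Y, ∑ z₁ ∈ Z, ∑ u ∈ X, ∑ w ∈ Y, ∑ z ∈ Z,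
      ψ u w z * (e₁ u w * e₂ w z * e₃ u z) * (F u w z₁ * F u w₁ z * F u w₁ z₁ * F u₁ w z *
        F u₁ w z₁ * F u₁ w₁ z * F u₁ w₁ z₁) ≤
      ∑ u ∈ X, ∑ w ∈ Y, ∑ z ∈ Z, W u w z *
        ∑ u₁ ∈ X, ∑ w₁ ∈ Y, ∑ z₁ ∈ Z, ext u w z u₁ w₁ z₁ := by
    calc _ ≤ ∑ u₁ ∈ X, ∑ w₁ ∈ Y, ∑ z₁ ∈ Z, ∑ u ∈ X, ∑ w ∈ Y, ∑ z ∈ Z,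
          W u w z * ext u w z u₁ w₁ z₁ := by
          refine Finset.sum_le_sum fun u₁ _ => Finset.sum_le_sum fun w₁ _ =>
            Finset.sum_le_sum fun z₁ _ => Finset.sum_le_sum fun u _ => Finset.sum_le_sum fun w _ =>
            Finset.sum_le_sum fun z _ => (le_abs_self _).trans ?_
          rw [abs_mul, abs_mul (ψ u w z), abs_of_nonneg (T01 u w z).1]
          exact mul_le_mul_of_nonneg_left (abs_octahedron_rest_le he₁ he₂ he₃ hF u w z u₁ w₁ z₁)
            (W01 u w z).1
      _ = _ := by
          simp_rw [Finset.mul_sum]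
          simp_rw [← Finset.sum_product']
          refine Finset.sum_nbij'
            (fun a : ℕ × ℕ × ℕ × ℕ × ℕ × ℕ =>
              (a.2.2.2.1, a.2.2.2.2.1, a.2.2.2.2.2, a.1, a.2.1, a.2.2.1))
            (fun a : ℕ × ℕ × ℕ × ℕ × ℕ × ℕ =>
              (a.2.2.2.1, a.2.2.2.2.1, a.2.2.2.2.2, a.1, a.2.1, a.2.2.1)) ?_ ?_ ?_ ?_ ?_
          · rintro a ha; simp only [Finset.mem_product] at ha ⊢; tauto
          · rintro a ha; simp only [Finset.mem_product] at ha ⊢; tauto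
          · rintro a -; rfl
          · rintro a -; rfl
          · rintro a -; rfl
  have s₂ : ∑ u ∈ X, ∑ w ∈ Y, ∑ z ∈ Z, W u w z *
        ∑ u₁ ∈ X, ∑ w₁ ∈ Y, ∑ z₁ ∈ Z, ext u w z u₁ w₁ z₁ ≤
      ∑ u ∈ X, ∑ w ∈ Y, ∑ z ∈ Z, (K * N * W u w z + N * (b₁ w z + b₂ u z + b₃ w u)) := by
    refine Finset.sum_le_sum fun u _ => Finset.sum_le_sum fun w _ => Finset.sum_le_sum fun z _ => ?_
    have e := mul_le_mul_of_nonneg_left (sum_extension_le he₁ he₂ he₃ ⟨hd₁.1.le, hd₁.2⟩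
      ⟨hd₂.1.le, hd₂.2⟩ ⟨hd₃.1.le, hd₃.2⟩ hε h₁ h₂ h₃ u w z) (W01 u w z).1
    refine e.trans ?_
    have nb : 0 ≤ (b₁ w z + b₂ u z + b₃ w u) * N := mul_nonneg (add_nonneg (add_nonneg
      (largeCodeg_mem_unit _ _ _ _ _ _).1 (largeCodeg_mem_unit _ _ _ _ _ _).1)
      (largeCodeg_mem_unit _ _ _ _ _ _).1) hN0
    have := mul_le_of_le_one_left nb (W01 u w z).2
    rw [mul_add]
    linarith
  have s₃ : ∑ u ∈ X, ∑ w ∈ Y, ∑ z ∈ Z, (K * N * W u w z + N * (b₁ w z + b₂ u z + b₃ w u)) =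
      K * N * (∑ u ∈ X, ∑ w ∈ Y, ∑ z ∈ Z, W u w z) +
        N * (X.card * (∑ w ∈ Y, ∑ z ∈ Z, b₁ w z) + Y.card * (∑ u ∈ X, ∑ z ∈ Z, b₂ u z) +
          Z.card * (∑ w ∈ Y, ∑ u ∈ X, b₃ w u)) := by
    rw [Finset.sum_comm (s := Y) (t := X) (f := b₃)]
    simp only [Finset.sum_add_distrib, ← Finset.mul_sum, Finset.sum_const, nsmul_eq_mul]
  have c₁ := sum_largeCodeg_le he₃ ⟨hd₁.1.le, hd₁.2⟩ hε h₁ h₃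
  have c₂ := sum_largeCodeg_le he₂ ⟨hd₁.1.le, hd₁.2⟩ hε h₁.swap h₂
  have c₃ := sum_largeCodeg_le (e₃ := fun z x => e₃ x z) (fun z x => he₃ x z)
    ⟨hd₂.1.le, hd₂.2⟩ hε h₂.swap h₃.swap
  rw [show 2 * ε * ((Y.card : ℝ) * X.card * Z.card) = 2 * ε * N by rw [hN]; ring] at c₂
  rw [show 2 * ε * ((Z.card : ℝ) * Y.card * X.card) = 2 * ε * N by rw [hN]; ring] at c₃
  set B₁ := ∑ w ∈ Y, ∑ z ∈ Z, b₁ w z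
  set B₂ := ∑ u ∈ X, ∑ z ∈ Z, b₂ u z
  set B₃ := ∑ w ∈ Y, ∑ u ∈ X, b₃ w u
  have hεN : 0 ≤ 2 * ε * N := by positivity
  have g₁ : D * (X.card * B₁) ≤ 2 * ε * N := by
    refine le_trans (le_of_eq_of_le ?_ (mul_le_mul_of_nonneg_left c₁ hd₂.1.le))
      (mul_le_of_le_one_left hεN hd₂.2)
    rw [hD]; ring
  have g₂ : D * (Y.card * B₂) ≤ 2 * ε * N := by
    refine le_trans (le_of_eq_of_le ?_ (mul_le_mul_of_nonneg_left c₂ hd₃.1.le)) (mul_le_of_le_one_left hεN hd₃.2)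
    rw [hD]; ring
  have g₃ : D * (Z.card * B₃) ≤ 2 * ε * N := by
    refine le_trans (le_of_eq_of_le ?_ (mul_le_mul_of_nonneg_left c₃ hd₁.1.le)) (mul_le_of_le_one_left hεN hd₁.2)
    rw [hD]; ring
  have f₁ := mul_le_mul_of_nonneg_left (s₁.trans (s₂.trans_eq s₃)) hD0.le
  have f₂ := mul_le_mul_of_nonneg_left hWsum (mul_nonneg hD0.le (mul_nonneg hK0 hN0))
  have f₃ := mul_le_mul_of_nonneg_left (add_le_add (add_le_add g₁ g₂) g₃) hN0
  refine f₁.trans ?_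
  linarith

/-- Counting octahedra in a triad, for a function which splits as the sum of a function with small
correlation with products of functions of pairs and a function which is small on average. -/
theorem octSum_le {F φ ψ : ℕ → ℕ → ℕ → ℝ} {ε₁ τ : ℝ} (hε₁ : 0 < ε₁) (hε₁' : ε₁ ≤ 1)
    (he₁ : ∀ x y, 0 ≤ e₁ x y ∧ e₁ x y ≤ 1)
    (he₂ : ∀ x y, 0 ≤ e₂ x y ∧ e₂ x y ≤ 1) (he₃ : ∀ x y, 0 ≤ e₃ x y ∧ e₃ x y ≤ 1)
    (hd₁ : 0 < d₁ ∧ d₁ ≤ 1) (hd₂ : 0 < d₂ ∧ d₂ ≤ 1) (hd₃ : 0 < d₃ ∧ d₃ ≤ 1)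
    (hε : 0 ≤ ε) (h₁ : CutReg X Y e₁ d₁ ε) (h₂ : CutReg Y Z e₂ d₂ ε) (h₃ : CutReg X Z e₃ d₃ ε)
    (hF : ∀ x y z, F x y z = (φ x y z + ψ x y z) * (e₁ x y * e₂ y z * e₃ x z))
    (hφψ : ∀ x y z, |φ x y z + ψ x y z| ≤ 1) (hψ : ∀ x y z, |ψ x y z| ≤ 1)
    (hφ : ∀ a b c : ℕ → ℕ → ℝ, (∀ x y, |a x y| ≤ 1) → (∀ x y, |b x y| ≤ 1) →
      (∀ x y, |c x y| ≤ 1) →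
      |∑ x ∈ X, ∑ y ∈ Y, ∑ z ∈ Z, φ x y z * (a x y * b y z * c x z)| ≤ τ)
    (hψ2 : ∑ x ∈ X, ∑ y ∈ Y, ∑ z ∈ Z, ψ x y z ^ 2 * (e₁ x y * e₂ y z * e₃ x z) ≤
      (ε₁ / 54) ^ 2 * ∑ x ∈ X, ∑ y ∈ Y, ∑ z ∈ Z, e₁ x y * e₂ y z * e₃ x z)
    (hετ : 18 * ε ≤ ε₁ * (d₁ * d₂ * d₃) ^ 5)
    (hτ : 3 * τ ≤ ε₁ * (d₁ * d₂ * d₃) ^ 4 * ((X.card : ℝ) * Y.card * Z.card)) :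
    octSum X Y Z F ≤ ε₁ * d₁ ^ 4 * d₂ ^ 4 * d₃ ^ 4 *
      (X.card : ℝ) ^ 2 * (Y.card : ℝ) ^ 2 * (Z.card : ℝ) ^ 2 := by
  have T01 : ∀ u w z, 0 ≤ e₁ u w * e₂ w z * e₃ u z ∧ e₁ u w * e₂ w z * e₃ u z ≤ 1 :=
    fun u w z => mul_mem_unit (mul_mem_unit (he₁ _ _) (he₂ _ _)) (he₃ _ _)
  have hFT : ∀ x y z, |F x y z| ≤ e₁ x y * e₂ y z * e₃ x z := fun x y z => by
    rw [hF, abs_mul, abs_of_nonneg (T01 x y z).1]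
    exact mul_le_of_le_one_left (T01 x y z).1 (hφψ x y z)
  have a₁ := sum_octSum_uniform_le he₁ he₂ he₃ (fun x y z => (hFT x y z).trans (T01 x y z).2) hφ
  have a₂ := sum_octSum_small_le (by positivity) he₁ he₂ he₃ hd₁ hd₂ hd₃ hε h₁ h₂ h₃ hFT hψ hψ2
  have split : octSum X Y Z F =
      (∑ u₁ ∈ X, ∑ w₁ ∈ Y, ∑ z₁ ∈ Z, ∑ u ∈ X, ∑ w ∈ Y, ∑ z ∈ Z,
        φ u w z * (e₁ u w * e₂ w z * e₃ u z) * (F u w z₁ * F u w₁ z * F u w₁ z₁ * F u₁ w z *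
          F u₁ w z₁ * F u₁ w₁ z * F u₁ w₁ z₁)) +
      ∑ u₁ ∈ X, ∑ w₁ ∈ Y, ∑ z₁ ∈ Z, ∑ u ∈ X, ∑ w ∈ Y, ∑ z ∈ Z,
        ψ u w z * (e₁ u w * e₂ w z * e₃ u z) * (F u w z₁ * F u w₁ z * F u w₁ z₁ * F u₁ w z *
          F u₁ w z₁ * F u₁ w₁ z * F u₁ w₁ z₁) := by
    rw [octSum_eq]
    simp_rw [← Finset.sum_add_distrib]
    refine Finset.sum_congr rfl fun u₁ _ => Finset.sum_congr rfl fun w₁ _ =>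
      Finset.sum_congr rfl fun z₁ _ => Finset.sum_congr rfl fun u _ =>
      Finset.sum_congr rfl fun w _ => Finset.sum_congr rfl fun z _ => ?_
    rw [← add_mul, ← add_mul, ← hF]
  rw [split]
  set A₁ := ∑ u₁ ∈ X, ∑ w₁ ∈ Y, ∑ z₁ ∈ Z, ∑ u ∈ X, ∑ w ∈ Y, ∑ z ∈ Z,
        φ u w z * (e₁ u w * e₂ w z * e₃ u z) * (F u w z₁ * F u w₁ z * F u w₁ z₁ * F u₁ w z *
          F u₁ w z₁ * F u₁ w₁ z * F u₁ w₁ z₁)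
  set A₂ := ∑ u₁ ∈ X, ∑ w₁ ∈ Y, ∑ z₁ ∈ Z, ∑ u ∈ X, ∑ w ∈ Y, ∑ z ∈ Z,
        ψ u w z * (e₁ u w * e₂ w z * e₃ u z) * (F u w z₁ * F u w₁ z * F u w₁ z₁ * F u₁ w z *
          F u₁ w z₁ * F u₁ w₁ z * F u₁ w₁ z₁)
  have goal_eq : ε₁ * d₁ ^ 4 * d₂ ^ 4 * d₃ ^ 4 *
      (X.card : ℝ) ^ 2 * (Y.card : ℝ) ^ 2 * (Z.card : ℝ) ^ 2 =
      ε₁ * (d₁ * d₂ * d₃) ^ 4 * ((X.card : ℝ) * Y.card * Z.card) ^ 2 := by ring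
  rw [goal_eq]
  have hN0 : 0 ≤ (X.card : ℝ) * Y.card * Z.card := by positivity
  have hD0 : 0 < d₁ * d₂ * d₃ := mul_pos (mul_pos hd₁.1 hd₂.1) hd₃.1
  have hD1 : d₁ * d₂ * d₃ ≤ 1 := (mul_mem_unit (mul_mem_unit ⟨hd₁.1.le, hd₁.2⟩
    ⟨hd₂.1.le, hd₂.2⟩) ⟨hd₃.1.le, hd₃.2⟩).2
  generalize (X.card : ℝ) * Y.card * Z.card = N at *
  generalize d₁ * d₂ * d₃ = D at *
  have b₁ : A₁ ≤ ε₁ * D ^ 4 * N ^ 2 / 3 := by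
    have := mul_le_mul_of_nonneg_left hτ hN0
    linarith
  have b₂ : D * A₂ ≤ D * (2 * (ε₁ * D ^ 4 * N ^ 2) / 3) := by
    refine a₂.trans ?_
    have hεD3 : 18 * ε ≤ D ^ 3 := hετ.trans
      (by nlinarith [pow_pos hD0 5, pow_pos hD0 3, pow_le_one₀ (n := 2) hD0.le hD1])
    have hεD : 18 * ε ≤ D := hεD3.trans
      (by nlinarith [pow_le_one₀ (n := 2) hD0.le hD1])
    have k₁ : 8 * D ^ 3 + 3 * ε ≤ 9 * D ^ 3 := by linarith [pow_pos hD0 3]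
    have k₂ : D + 3 * ε ≤ 2 * D := by linarith
    have k₃ : (8 * D ^ 3 + 3 * ε) * (ε₁ / 54 * (D + 3 * ε)) ≤
        9 * D ^ 3 * (ε₁ / 54 * (2 * D)) := by gcongr
    have k₄ : D * ((8 * D ^ 3 + 3 * ε) * (ε₁ / 54 * (D + 3 * ε))) + 6 * ε ≤
        2 * (ε₁ * D ^ 5) / 3 := by
      have := mul_le_mul_of_nonneg_left k₃ hD0.le
      linarith
    have := mul_le_mul_of_nonneg_right k₄ (sq_nonneg N)
    linarith
  have b₃ := le_of_mul_le_mul_left b₂ hD0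
  linarith

end Triads

lemma card_low_density_le (V : Finset ℕ) (p : ℕ → ℕ) (q : ℕ → ℕ → ℕ) (ℓ : ℕ)
    (hq : ∀ x y, q x y < ℓ) {d₀ : ℝ} (hd₀ : 0 ≤ d₀) :
    (((V ×ˢ V).filter fun ω => pairDens (cls V p (p ω.1)) (cls V p (p ω.2))
      (col q (q ω.1 ω.2)) < d₀).card : ℝ) ≤ d₀ * ℓ * (V.card : ℝ) ^ 2 := by
  set g : ℕ → ℕ × ℕ → ℝ := fun α c =>
    if pairDens (cls V p c.1) (cls V p c.2) (col q α) < d₀ then 1 else 0 with hg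
  have hg0 : ∀ α c, 0 ≤ g α c := by intro α c; rw [hg]; dsimp only; split_ifs <;> norm_num
  have h1 : (((V ×ˢ V).filter fun ω => pairDens (cls V p (p ω.1)) (cls V p (p ω.2))
      (col q (q ω.1 ω.2)) < d₀).card : ℝ) ≤
      ∑ ω ∈ V ×ˢ V, ∑ α ∈ Finset.range ℓ, col q α ω.1 ω.2 * g α (vertexLabels p ω) := by
    rw [Finset.card_filter]
    push_cast
    refine Finset.sum_le_sum fun ω _ => ?_
    refine le_trans (le_of_eq ?_) (Finset.single_le_sum
      (f := fun α => col q α ω.1 ω.2 * g α (vertexLabels p ω))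
      (fun α _ => mul_nonneg (col_nonneg _ _ _ _) (hg0 _ _))
      (Finset.mem_range.mpr (hq ω.1 ω.2)))
    rw [show col q (q ω.1 ω.2) ω.1 ω.2 = 1 from if_pos rfl, one_mul]
    rfl
  refine h1.trans ?_
  rw [Finset.sum_comm]
  calc _ ≤ ∑ α ∈ Finset.range ℓ, ∑ ω ∈ V ×ˢ V, d₀ := by
        refine Finset.sum_le_sum fun α _ => ?_
        have := sum_avgOn_mul (V ×ˢ V) (vertexLabels p) (fun ω => col q α ω.1 ω.2) (g α)
        rw [← this]
        refine Finset.sum_le_sum fun ω _ => ?_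
        rw [avgOn_vertexLabels V p (col q α), hg]
        dsimp only
        split_ifs with h
        · rw [mul_one]; exact h.le
        · rw [mul_zero]; exact hd₀
    _ = _ := by
        simp only [Finset.sum_const, nsmul_eq_mul, Finset.card_range, Finset.card_product]
        push_cast; ring

lemma card_small_class_le (V : Finset ℕ) (p : ℕ → ℕ) (t : ℕ) (hp : ∀ x, p x < t) {s : ℝ}
    (hs : 0 ≤ s) : ((V.filter fun x => ((cls V p (p x)).card : ℝ) < s).card : ℝ) ≤ t * s := by
  rw [Finset.card_eq_sum_card_fiberwise (f := p) (t := Finset.range t)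
    (fun x _ => by simpa using hp x)]
  push_cast
  calc _ ≤ ∑ i ∈ Finset.range t, s := by
        refine Finset.sum_le_sum fun i _ => ?_
        rcases Finset.eq_empty_or_nonempty
          ((V.filter fun x => ((cls V p (p x)).card : ℝ) < s).filter fun x => p x = i) with h | h
        · rw [h]; simpa using hs
        · obtain ⟨x, hx⟩ := h
          rw [Finset.mem_filter, Finset.mem_filter] at hx
          have : (((V.filter fun x => ((cls V p (p x)).card : ℝ) < s).filter fun x => p x = i).card
              : ℝ) ≤ (cls V p (p x)).card := by
            refine Nat.cast_le.mpr (Finset.card_le_card fun y hy => ?_)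
            rw [Finset.mem_filter, Finset.mem_filter] at hy
            exact Finset.mem_filter.mpr ⟨hy.1.1, by rw [hy.2, hx.2]⟩
          exact this.trans hx.1.2.le
    _ = _ := by simp

/-- A pair which is not suitable as an edge of a regular triad. -/
def BadPair (V : Finset ℕ) (p : ℕ → ℕ) (q : ℕ → ℕ → ℕ) (ℓ : ℕ) (ε d₀ s : ℝ) (ω : ℕ × ℕ) : Prop :=
  ¬ GoodPair V p q ℓ ε (vertexLabels p ω) ∨
    pairDens (cls V p (p ω.1)) (cls V p (p ω.2)) (col q (q ω.1 ω.2)) < d₀ ∨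
    ((cls V p (p ω.1)).card : ℝ) < s ∨ ((cls V p (p ω.2)).card : ℝ) < s

lemma card_badPair_le (V : Finset ℕ) (p : ℕ → ℕ) (q : ℕ → ℕ → ℕ) (t ℓ : ℕ) (ht : 0 < t)
    (hℓ : 0 < ℓ) (hp : ∀ x, p x < t) (hq : ∀ x y, q x y < ℓ) {ε ε₁ : ℝ} (hε₁ : 0 < ε₁)
    (hgood : (((V ×ˢ V).filter fun ω => ¬ GoodPair V p q ℓ ε (vertexLabels p ω)).card : ℝ) ≤
      ε₁ / 20 * (V.card : ℝ) ^ 2) :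
    (((V ×ˢ V).filter (BadPair V p q ℓ ε (ε₁ / (20 * ℓ)) (ε₁ / (10 * t) * V.card))).card : ℝ) ≤
      3 / 10 * ε₁ * (V.card : ℝ) ^ 2 := by
  have hs : 0 ≤ ε₁ / (10 * t) * V.card := by positivity
  have h2 := card_low_density_le V p q ℓ hq (d₀ := ε₁ / (20 * ℓ)) (by positivity)
  have h3 := card_small_class_le V p t hp hs
  set s := ε₁ / (10 * t) * V.card with hsdef
  set S := V.filter fun x => ((cls V p (p x)).card : ℝ) < s with hS
  set A := (V ×ˢ V).filter fun ω => ¬ GoodPair V p q ℓ ε (vertexLabels p ω)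
  set B := (V ×ˢ V).filter fun ω => pairDens (cls V p (p ω.1)) (cls V p (p ω.2))
      (col q (q ω.1 ω.2)) < ε₁ / (20 * ℓ)
  have sub : (V ×ˢ V).filter (BadPair V p q ℓ ε (ε₁ / (20 * ℓ)) s) ⊆
      A ∪ B ∪ (S ×ˢ V) ∪ (V ×ˢ S) := by
    intro ω hω
    rw [Finset.mem_filter] at hω
    have hV := Finset.mem_product.mp hω.1
    simp only [Finset.mem_union]
    rcases hω.2 with h | h | h | h
    · exact Or.inl (Or.inl (Or.inl (Finset.mem_filter.mpr ⟨hω.1, h⟩)))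
    · exact Or.inl (Or.inl (Or.inr (Finset.mem_filter.mpr ⟨hω.1, h⟩)))
    · exact Or.inl (Or.inr (Finset.mem_product.mpr ⟨Finset.mem_filter.mpr ⟨hV.1, h⟩, hV.2⟩))
    · exact Or.inr (Finset.mem_product.mpr ⟨hV.1, Finset.mem_filter.mpr ⟨hV.2, h⟩⟩)
  have c1 : (((V ×ˢ V).filter (BadPair V p q ℓ ε (ε₁ / (20 * ℓ)) s)).card : ℝ) ≤
      A.card + B.card + S.card * V.card + V.card * S.card := by
    have := (Finset.card_le_card sub).trans ((Finset.card_union_le _ _).trans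
      (Nat.add_le_add_right ((Finset.card_union_le _ _).trans
        (Nat.add_le_add_right (Finset.card_union_le _ _) _)) _))
    rw [Finset.card_product, Finset.card_product] at this
    exact_mod_cast this
  have e2 : ε₁ / (20 * ℓ) * ℓ * (V.card : ℝ) ^ 2 = ε₁ / 20 * (V.card : ℝ) ^ 2 := by
    have : (ℓ : ℝ) ≠ 0 := by positivity
    field_simp
  have e3 : t * s = ε₁ / 10 * V.card := by
    have : (t : ℝ) ≠ 0 := by positivity
    rw [hsdef]; field_simp
  rw [e2] at h2
  rw [e3] at h3
  have := mul_le_mul_of_nonneg_right h3 (Nat.cast_nonneg (α := ℝ) V.card)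
  linarith

/-- The number of triples with a pair of a given kind. -/
lemma card_triples_filter_le (V : Finset ℕ) (P : ℕ × ℕ → Prop) (Q : ℕ × ℕ × ℕ → Prop) {b c : ℝ}
    (hP : (((V ×ˢ V).filter P).card : ℝ) ≤ b * (V.card : ℝ) ^ 2)
    (hQ : (((triples V).filter Q).card : ℝ) ≤ c * (V.card : ℝ) ^ 3) :
    (((triples V).filter fun ω => P (ω.1, ω.2.1) ∨ P ω.2 ∨ P (ω.1, ω.2.2) ∨ Q ω).card : ℝ) ≤
      (3 * b + c) * (V.card : ℝ) ^ 3 := by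
  set B := (V ×ˢ V).filter P with hB
  have mem : ∀ {x y}, x ∈ V → y ∈ V → P (x, y) → (x, y) ∈ B := fun hx hy h =>
    Finset.mem_filter.mpr ⟨Finset.mem_product.mpr ⟨hx, hy⟩, h⟩
  have sub : ((triples V).filter fun ω => P (ω.1, ω.2.1) ∨ P ω.2 ∨ P (ω.1, ω.2.2) ∨ Q ω) ⊆
      ((B ×ˢ V).image fun a => (a.1.1, a.1.2, a.2)) ∪ (V ×ˢ B) ∪
        ((B ×ˢ V).image fun a => (a.1.1, a.2, a.1.2)) ∪ (triples V).filter Q := by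
    rintro ⟨x, y, z⟩ hω
    rw [Finset.mem_filter] at hω
    have hV := hω.1
    simp only [triples, Finset.mem_product] at hV
    simp only [Finset.mem_union]
    rcases hω.2 with h | h | h | h
    · exact Or.inl (Or.inl (Or.inl (Finset.mem_image.mpr ⟨((x, y), z),
        Finset.mem_product.mpr ⟨mem hV.1 hV.2.1 h, hV.2.2⟩, rfl⟩)))
    · exact Or.inl (Or.inl (Or.inr (Finset.mem_product.mpr ⟨hV.1, mem hV.2.1 hV.2.2 h⟩)))
    · exact Or.inl (Or.inr (Finset.mem_image.mpr ⟨((x, z), y),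
        Finset.mem_product.mpr ⟨mem hV.1 hV.2.2 h, hV.2.1⟩, rfl⟩))
    · exact Or.inr (Finset.mem_filter.mpr ⟨hω.1, h⟩)
  have c1 : (((triples V).filter fun ω => P (ω.1, ω.2.1) ∨ P ω.2 ∨ P (ω.1, ω.2.2) ∨ Q ω).card : ℝ) ≤
      B.card * V.card + V.card * B.card + B.card * V.card + ((triples V).filter Q).card := by
    have := (Finset.card_le_card sub).trans ((Finset.card_union_le _ _).trans
      (Nat.add_le_add_right ((Finset.card_union_le _ _).trans
        (Nat.add_le_add ((Finset.card_union_le _ _).trans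
          (Nat.add_le_add_right Finset.card_image_le _)) Finset.card_image_le)) _))
    rw [Finset.card_product, Finset.card_product] at this
    exact_mod_cast this
  have := mul_le_mul_of_nonneg_right hP (Nat.cast_nonneg (α := ℝ) V.card)
  linarith

/-- The decomposition of `V` given by a labelling of the vertices and a labelling of the pairs. -/
noncomputable def decompOf (V : Finset ℕ) (t ℓ : ℕ) (p : ℕ → ℕ) (q : ℕ → ℕ → ℕ)
    (hp : ∀ x, p x < t) (hq : ∀ x y, q x y < ℓ) : Decomp V (Fin t) (Fin ℓ) where
  part i := cls V p i
  part_sub i := Finset.filter_subset _ _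
  part_disj i j hij := by
    refine Finset.disjoint_left.mpr fun x hx hx' => hij (Fin.ext ?_)
    rw [← (Finset.mem_filter.mp hx).2, (Finset.mem_filter.mp hx').2]
  part_cover x hx := ⟨⟨p x, hp x⟩, Finset.mem_filter.mpr ⟨hx, rfl⟩⟩
  pairs i j α := (cls V p i ×ˢ cls V p j).filter fun ω => q ω.1 ω.2 = α
  pairs_sub i j α := Finset.filter_subset _ _
  pairs_disj i j α β hαβ := by
    refine Finset.disjoint_left.mpr fun x hx hx' => hαβ (Fin.ext ?_)
    rw [← (Finset.mem_filter.mp hx).2, (Finset.mem_filter.mp hx').2]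
  pairs_cover i j ω hω := ⟨⟨q ω.1 ω.2, hq _ _⟩, Finset.mem_filter.mpr ⟨hω, rfl⟩⟩

/-- The labels of the vertices and of the pairs of a triple. -/
def triadLabels (p : ℕ → ℕ) (q : ℕ → ℕ → ℕ) (ω : ℕ × ℕ × ℕ) : (ℕ × ℕ × ℕ) × ℕ × ℕ × ℕ :=
  ((p ω.1, p ω.2.1, p ω.2.2), pairLabels q ω)

/-- The indicator function of a set of triples. -/
noncomputable def ind (R : Finset (ℕ × ℕ × ℕ)) (ω : ℕ × ℕ × ℕ) : ℝ := if ω ∈ R then 1 else 0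

lemma ind_mem_unit (R : Finset (ℕ × ℕ × ℕ)) (ω : ℕ × ℕ × ℕ) : 0 ≤ ind R ω ∧ ind R ω ≤ 1 := by
  unfold ind; split_ifs <;> norm_num

/-- The bigraph of a colour between two classes. -/
noncomputable def colBG (V : Finset ℕ) (p : ℕ → ℕ) (q : ℕ → ℕ → ℕ) (i j α : ℕ) : Bigraph :=
  ⟨cls V p i, cls V p j, (cls V p i ×ˢ cls V p j).filter fun ω => q ω.1 ω.2 = α,
    Finset.filter_subset _ _⟩

lemma density_colBG (V : Finset ℕ) (p : ℕ → ℕ) (q : ℕ → ℕ → ℕ) (i j α : ℕ) :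
    (colBG V p q i j α).density = pairDens (cls V p i) (cls V p j) (col q α) := by
  unfold Bigraph.density pairDens colBG
  congr 1
  rw [Finset.card_filter, Finset.sum_product]
  push_cast
  rfl

lemma pairDens_mem_unit (X Y : Finset ℕ) (e : ℕ → ℕ → ℝ) (he : ∀ x y, 0 ≤ e x y ∧ e x y ≤ 1) :
    0 ≤ pairDens X Y e ∧ pairDens X Y e ≤ 1 := by
  unfold pairDens
  refine ⟨div_nonneg (Finset.sum_nonneg fun x _ => Finset.sum_nonneg fun y _ => (he x y).1)
    (by positivity), div_le_one_of_le₀ ?_ (by positivity)⟩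
  calc _ ≤ ∑ x ∈ X, ∑ y ∈ Y, (1 : ℝ) :=
        Finset.sum_le_sum fun x _ => Finset.sum_le_sum fun y _ => (he x y).2
    _ = _ := by simp

lemma dev2_colBG {V : Finset ℕ} {p : ℕ → ℕ} {q : ℕ → ℕ → ℕ} {i j α : ℕ} {ε ε₂ : ℝ}
    (h : CutReg (cls V p i) (cls V p j) (col q α)
      (pairDens (cls V p i) (cls V p j) (col q α)) ε) (hε : ε ≤ ε₂) (hε₂ : 0 ≤ ε₂) :
    (colBG V p q i j α).dev2 ε₂ (pairDens (cls V p i) (cls V p j) (col q α)) := by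
  refine ⟨by rw [density_colBG, sub_self, abs_zero]; exact hε₂, ?_⟩
  have hc : ∀ x y, 0 ≤ col q α x y ∧ col q α x y ≤ 1 := fun x y =>
    ⟨col_nonneg _ _ _ _, col_le_one _ _ _ _⟩
  have h1 := h.fourCycleSum_le hc (pairDens_mem_unit _ _ _ hc)
  have hg : ∀ x ∈ cls V p i, ∀ y ∈ cls V p j, (colBG V p q i j α).gfun x y =
      col q α x y - pairDens (cls V p i) (cls V p j) (col q α) := by
    intro x hx y hy
    unfold Bigraph.gfun col
    rw [density_colBG]
    have : (x, y) ∈ (colBG V p q i j α).edges ↔ q x y = α := by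
      unfold colBG
      simp only [Finset.mem_filter, Finset.mem_product]
      tauto
    by_cases hα : q x y = α
    · rw [if_pos (this.mpr hα), if_pos hα]; rfl
    · rw [if_neg (fun h => hα (this.mp h)), if_neg hα, zero_sub]; rfl
  have h2 : (colBG V p q i j α).devSum = fourCycleSum (cls V p i) (cls V p j)
      fun x y => col q α x y - pairDens (cls V p i) (cls V p j) (col q α) := by
    unfold Bigraph.devSum fourCycleSum
    refine Finset.sum_congr rfl fun x₀ h₀ => Finset.sum_congr rfl fun x₁ h₁ =>
      Finset.sum_congr rfl fun y₀ k₀ => Finset.sum_congr rfl fun y₁ k₁ => ?_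
    rw [hg _ h₀ _ k₀, hg _ h₀ _ k₁, hg _ h₁ _ k₀, hg _ h₁ _ k₁]
  rw [h2]
  refine h1.trans ?_
  change _ ≤ ε₂ * ((cls V p i).card : ℝ) ^ 2 * ((cls V p j).card : ℝ) ^ 2
  gcongr

section Triad
variable (V : Finset ℕ) (p : ℕ → ℕ) (q : ℕ → ℕ → ℕ)

/-- The triad with the given vertex and pair labels. -/
noncomputable def triadAt (c : (ℕ × ℕ × ℕ) × ℕ × ℕ × ℕ) : Triad :=
  ⟨cls V p c.1.1, cls V p c.1.2.1, cls V p c.1.2.2,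
    (cls V p c.1.1 ×ˢ cls V p c.1.2.1).filter fun ω => q ω.1 ω.2 = c.2.1,
    (cls V p c.1.2.1 ×ˢ cls V p c.1.2.2).filter fun ω => q ω.1 ω.2 = c.2.2.1,
    (cls V p c.1.1 ×ˢ cls V p c.1.2.2).filter fun ω => q ω.1 ω.2 = c.2.2.2,
    Finset.filter_subset _ _, Finset.filter_subset _ _, Finset.filter_subset _ _⟩

lemma K3_triadAt (c : (ℕ × ℕ × ℕ) × ℕ × ℕ × ℕ) :
    (triadAt V p q c).K3 = cell (triples V) (triadLabels p q) c := by
  ext ω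
  obtain ⟨⟨i, j, k⟩, α, γ, β⟩ := c
  simp only [Triad.K3, triadAt, cell, triples, triadLabels, pairLabels, cls, Finset.mem_filter,
    Finset.mem_product, Prod.mk.injEq]
  tauto

lemma relDensity_triadAt (R : Finset (ℕ × ℕ × ℕ)) (c : (ℕ × ℕ × ℕ) × ℕ × ℕ × ℕ) :
    relDensity R (triadAt V p q c) = avgOn (triples V) (triadLabels p q) (ind R) c := by
  unfold relDensity avgOn ind
  rw [K3_triadAt]
  congr 1
  rw [Finset.sum_ite_mem, Finset.sum_const, nsmul_eq_mul, mul_one, Finset.inter_comm]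

lemma sum_triadAt (c : (ℕ × ℕ × ℕ) × ℕ × ℕ × ℕ) (g : ℕ → ℕ → ℕ → ℝ) :
    ∑ x ∈ cls V p c.1.1, ∑ y ∈ cls V p c.1.2.1, ∑ z ∈ cls V p c.1.2.2,
      g x y z * (col q c.2.1 x y * col q c.2.2.1 y z * col q c.2.2.2 x z) =
    ∑ ω ∈ cell (triples V) (triadLabels p q) c, g ω.1 ω.2.1 ω.2.2 := by
  rw [← K3_triadAt, Triad.K3, Finset.sum_filter, Finset.sum_product]
  refine Finset.sum_congr rfl fun x hx => ?_
  rw [Finset.sum_product]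
  refine Finset.sum_congr rfl fun y hy => Finset.sum_congr rfl fun z hz => ?_
  change x ∈ cls V p c.1.1 at hx
  change y ∈ cls V p c.1.2.1 at hy
  change z ∈ cls V p c.1.2.2 at hz
  simp only [triadAt, Finset.mem_filter, Finset.mem_product, hx, hy, hz, true_and, and_true, col]
  by_cases h1 : q x y = c.2.1 <;> by_cases h2 : q y z = c.2.2.1 <;>
    by_cases h3 : q x z = c.2.2.2 <;> simp [h1, h2, h3]

lemma hFun_triadAt (R : Finset (ℕ × ℕ × ℕ)) (c : (ℕ × ℕ × ℕ) × ℕ × ℕ × ℕ) (x y z : ℕ)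
    (hx : x ∈ cls V p c.1.1) (hy : y ∈ cls V p c.1.2.1) (hz : z ∈ cls V p c.1.2.2) :
    hFun R (triadAt V p q c) x y z =
      (ind R (x, y, z) - avgOn (triples V) (triadLabels p q) (ind R) c) *
        (col q c.2.1 x y * col q c.2.2.1 y z * col q c.2.2.2 x z) := by
  unfold hFun
  rw [relDensity_triadAt]
  have hK : (x, y, z) ∈ (triadAt V p q c).K3 ↔
      q x y = c.2.1 ∧ q y z = c.2.2.1 ∧ q x z = c.2.2.2 := by
    simp only [Triad.K3, triadAt, Finset.mem_filter, Finset.mem_product]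
    tauto
  by_cases h : q x y = c.2.1 ∧ q y z = c.2.2.1 ∧ q x z = c.2.2.2
  · rw [if_pos (hK.mpr h)]
    simp only [col, h, if_true, mul_one, ind]
    split_ifs <;> ring
  · rw [if_neg (fun h' => h (hK.mp h'))]
    have : col q c.2.1 x y * col q c.2.2.1 y z * col q c.2.2.2 x z = 0 := by
      unfold col
      by_cases h1 : q x y = c.2.1 <;> by_cases h2 : q y z = c.2.2.1 <;>
        by_cases h3 : q x z = c.2.2.2 <;> simp [h1, h2, h3]
      exact h ⟨h1, h2, h3⟩
    rw [this, mul_zero]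

lemma octSum_congr {X Y Z : Finset ℕ} {F G : ℕ → ℕ → ℕ → ℝ}
    (h : ∀ x ∈ X, ∀ y ∈ Y, ∀ z ∈ Z, F x y z = G x y z) : octSum X Y Z F = octSum X Y Z G := by
  unfold octSum
  refine Finset.sum_congr rfl fun u₀ a₀ => Finset.sum_congr rfl fun u₁ a₁ =>
    Finset.sum_congr rfl fun w₀ b₀ => Finset.sum_congr rfl fun w₁ b₁ =>
    Finset.sum_congr rfl fun z₀ c₀ => Finset.sum_congr rfl fun z₁ c₁ => ?_
  rw [h _ a₀ _ b₀ _ c₀, h _ a₀ _ b₀ _ c₁, h _ a₀ _ b₁ _ c₀, h _ a₀ _ b₁ _ c₁,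
    h _ a₁ _ b₀ _ c₀, h _ a₁ _ b₀ _ c₁, h _ a₁ _ b₁ _ c₀, h _ a₁ _ b₁ _ c₁]

end Triad

lemma col_mem_unit (q : ℕ → ℕ → ℕ) (α x y : ℕ) : 0 ≤ col q α x y ∧ col q α x y ≤ 1 :=
  ⟨col_nonneg _ _ _ _, col_le_one _ _ _ _⟩

/-- Testing against functions of pairs may be localized to a box. -/
lemma abs_sum_box_le {V X Y Z : Finset ℕ} (hX : X ⊆ V) (hY : Y ⊆ V) (hZ : Z ⊆ V)
    {g : ℕ × ℕ × ℕ → ℝ} {τ : ℝ}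
    (h : ∀ a b c : ℕ × ℕ → ℝ, (∀ p, |a p| ≤ 1) → (∀ p, |b p| ≤ 1) → (∀ p, |c p| ≤ 1) →
      |∑ ω ∈ triples V, g ω * (a (ω.1, ω.2.1) * b ω.2 * c (ω.1, ω.2.2))| ≤ τ)
    (a b c : ℕ → ℕ → ℝ) (ha : ∀ x y, |a x y| ≤ 1) (hb : ∀ x y, |b x y| ≤ 1)
    (hc : ∀ x y, |c x y| ≤ 1) :
    |∑ x ∈ X, ∑ y ∈ Y, ∑ z ∈ Z, g (x, y, z) * (a x y * b y z * c x z)| ≤ τ := by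
  have loc : ∀ (e : ℕ → ℕ → ℝ) (A B : Finset ℕ), (∀ x y, |e x y| ≤ 1) → ∀ r : ℕ × ℕ,
      |if r ∈ A ×ˢ B then e r.1 r.2 else 0| ≤ 1 := by
    intro e A B he r
    split_ifs
    · exact he _ _
    · simp
  refine le_of_eq_of_le ?_ (h (fun r => if r ∈ X ×ˢ Y then a r.1 r.2 else 0)
    (fun r => if r ∈ Y ×ˢ Z then b r.1 r.2 else 0) (fun r => if r ∈ X ×ˢ Z then c r.1 r.2 else 0)
    (loc a X Y ha) (loc b Y Z hb) (loc c X Z hc))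
  congr 1
  have sub : X ×ˢ Y ×ˢ Z ⊆ triples V :=
    Finset.product_subset_product hX (Finset.product_subset_product hY hZ)
  rw [← Finset.sum_subset sub]
  · rw [Finset.sum_product]
    refine Finset.sum_congr rfl fun x hx => ?_
    rw [Finset.sum_product]
    refine Finset.sum_congr rfl fun y hy => Finset.sum_congr rfl fun z hz => ?_
    simp only [Finset.mem_product, hx, hy, hz, and_self, if_true]
  · rintro ⟨x, y, z⟩ - hω
    have : ¬ (((x, y) ∈ X ×ˢ Y) ∧ ((y, z) ∈ Y ×ˢ Z)) := by
      simp only [Finset.mem_product] at hω ⊢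
      tauto
    by_cases h1 : (x, y) ∈ X ×ˢ Y
    · have h2 : ¬ ((y, z) ∈ Y ×ˢ Z) := fun h2 => this ⟨h1, h2⟩
      simp only [if_neg h2, mul_zero, zero_mul]
    · simp only [if_neg h1, mul_zero, zero_mul]

lemma bXY_triadAt (V : Finset ℕ) (p : ℕ → ℕ) (q : ℕ → ℕ → ℕ) (c : (ℕ × ℕ × ℕ) × ℕ × ℕ × ℕ) :
    (triadAt V p q c).bXY = colBG V p q c.1.1 c.1.2.1 c.2.1 := rfl

lemma bYZ_triadAt (V : Finset ℕ) (p : ℕ → ℕ) (q : ℕ → ℕ → ℕ) (c : (ℕ × ℕ × ℕ) × ℕ × ℕ × ℕ) :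
    (triadAt V p q c).bYZ = colBG V p q c.1.2.1 c.1.2.2 c.2.2.1 := rfl

lemma bXZ_triadAt (V : Finset ℕ) (p : ℕ → ℕ) (q : ℕ → ℕ → ℕ) (c : (ℕ × ℕ × ℕ) × ℕ × ℕ × ℕ) :
    (triadAt V p q c).bXZ = colBG V p q c.1.1 c.1.2.2 c.2.2.2 := rfl

lemma devSum3_eq_octSum (R : Finset (ℕ × ℕ × ℕ)) (G : Triad) :
    devSum3 R G = octSum G.X G.Y G.Z (hFun R G) := rfl

lemma mem_cell {β γ : Type*} {Ω : Finset β} {κ : β → γ} {c : γ} {ω : β} :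
    ω ∈ cell Ω κ c ↔ ω ∈ Ω ∧ κ ω = c := Finset.mem_filter

theorem dev23_triadAt (V : Finset ℕ) (p : ℕ → ℕ) (q : ℕ → ℕ → ℕ) (R : Finset (ℕ × ℕ × ℕ))
    (c : (ℕ × ℕ × ℕ) × ℕ × ℕ × ℕ) (f' : ℕ × ℕ × ℕ → ℝ) {ε ε₁ ε₂ d₀ s τ : ℝ}
    (hf' : ∀ ω, 0 ≤ f' ω ∧ f' ω ≤ 1) (hε₁ : 0 < ε₁) (hε₁' : ε₁ ≤ 1) (hε : 0 ≤ ε) (hε₂ : ε ≤ ε₂)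
    (hd₀ : 0 < d₀) (hs : 0 ≤ s)
    (h₁ : CutReg (cls V p c.1.1) (cls V p c.1.2.1) (col q c.2.1)
      (pairDens (cls V p c.1.1) (cls V p c.1.2.1) (col q c.2.1)) ε)
    (h₂ : CutReg (cls V p c.1.2.1) (cls V p c.1.2.2) (col q c.2.2.1)
      (pairDens (cls V p c.1.2.1) (cls V p c.1.2.2) (col q c.2.2.1)) ε)
    (h₃ : CutReg (cls V p c.1.1) (cls V p c.1.2.2) (col q c.2.2.2)
      (pairDens (cls V p c.1.1) (cls V p c.1.2.2) (col q c.2.2.2)) ε)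
    (k₁ : d₀ ≤ pairDens (cls V p c.1.1) (cls V p c.1.2.1) (col q c.2.1))
    (k₂ : d₀ ≤ pairDens (cls V p c.1.2.1) (cls V p c.1.2.2) (col q c.2.2.1))
    (k₃ : d₀ ≤ pairDens (cls V p c.1.1) (cls V p c.1.2.2) (col q c.2.2.2))
    (s₁ : s ≤ (cls V p c.1.1).card) (s₂ : s ≤ (cls V p c.1.2.1).card)
    (s₃ : s ≤ (cls V p c.1.2.2).card)
    (hweak : ∀ a b c : ℕ × ℕ → ℝ, (∀ p, |a p| ≤ 1) → (∀ p, |b p| ≤ 1) → (∀ p, |c p| ≤ 1) →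
      |∑ ω ∈ triples V, (ind R ω - f' ω) * (a (ω.1, ω.2.1) * b ω.2 * c (ω.1, ω.2.2))| ≤ τ)
    (hψ : ∑ ω ∈ cell (triples V) (triadLabels p q) c,
      (f' ω - avgOn (triples V) (triadLabels p q) (ind R) c) ^ 2 ≤
        (ε₁ / 54) ^ 2 * (cell (triples V) (triadLabels p q) c).card)
    (hετ : 18 * ε ≤ ε₁ * d₀ ^ 15) (hτ : 3 * τ ≤ ε₁ * d₀ ^ 12 * s ^ 3) :
    dev23 R (triadAt V p q c) ε₁ ε₂ := by
  have hε₂0 : 0 ≤ ε₂ := hε.trans hε₂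
  suffices hs3 : devSum3 R (triadAt V p q c) ≤ ε₁ *
      pairDens (cls V p c.1.1) (cls V p c.1.2.1) (col q c.2.1) ^ 4 *
      pairDens (cls V p c.1.2.1) (cls V p c.1.2.2) (col q c.2.2.1) ^ 4 *
      pairDens (cls V p c.1.1) (cls V p c.1.2.2) (col q c.2.2.2) ^ 4 *
      ((cls V p c.1.1).card : ℝ) ^ 2 * ((cls V p c.1.2.1).card : ℝ) ^ 2 *
      ((cls V p c.1.2.2).card : ℝ) ^ 2 from
    ⟨_, _, _, hd₀.trans_le k₁, hd₀.trans_le k₂, hd₀.trans_le k₃,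
      by rw [bXY_triadAt]; exact dev2_colBG h₁ hε₂ hε₂0,
      by rw [bXZ_triadAt]; exact dev2_colBG h₃ hε₂ hε₂0,
      by rw [bYZ_triadAt]; exact dev2_colBG h₂ hε₂ hε₂0, hs3⟩
  set δ := avgOn (triples V) (triadLabels p q) (ind R) c with hδ
  have hδ01 : 0 ≤ δ ∧ δ ≤ 1 := ⟨avgOn_nonneg _ _ _ (fun ω _ => (ind_mem_unit R ω).1) _,
    avgOn_le_one _ _ _ (fun ω _ => (ind_mem_unit R ω).2) _⟩
  have u₁ := (pairDens_mem_unit (cls V p c.1.1) (cls V p c.1.2.1) _ (col_mem_unit q c.2.1)).2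
  have u₂ := (pairDens_mem_unit (cls V p c.1.2.1) (cls V p c.1.2.2) _ (col_mem_unit q c.2.2.1)).2
  have u₃ := (pairDens_mem_unit (cls V p c.1.1) (cls V p c.1.2.2) _ (col_mem_unit q c.2.2.2)).2
  have e : devSum3 R (triadAt V p q c) = octSum (cls V p c.1.1) (cls V p c.1.2.1)
      (cls V p c.1.2.2) (fun x y z => ((ind R (x, y, z) - f' (x, y, z)) + (f' (x, y, z) - δ)) *
        (col q c.2.1 x y * col q c.2.2.1 y z * col q c.2.2.2 x z)) := by
    rw [devSum3_eq_octSum]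
    refine octSum_congr fun x hx y hy z hz => ?_
    rw [hFun_triadAt V p q R c x y z hx hy hz, ← hδ]
    ring
  rw [e]
  have hD : d₀ ^ 3 ≤ pairDens (cls V p c.1.1) (cls V p c.1.2.1) (col q c.2.1) *
      pairDens (cls V p c.1.2.1) (cls V p c.1.2.2) (col q c.2.2.1) *
      pairDens (cls V p c.1.1) (cls V p c.1.2.2) (col q c.2.2.2) := by
    have := mul_le_mul (mul_le_mul k₁ k₂ hd₀.le (hd₀.le.trans k₁)) k₃ hd₀.le
      (mul_nonneg (hd₀.le.trans k₁) (hd₀.le.trans k₂))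
    linarith
  have hN : s ^ 3 ≤ ((cls V p c.1.1).card : ℝ) * (cls V p c.1.2.1).card *
      (cls V p c.1.2.2).card := by
    have := mul_le_mul (mul_le_mul s₁ s₂ hs (hs.trans s₁)) s₃ hs
      (mul_nonneg (hs.trans s₁) (hs.trans s₂))
    linarith
  have hφ := abs_sum_box_le (Finset.filter_subset (fun x => p x = c.1.1) V)
    (Finset.filter_subset (fun x => p x = c.1.2.1) V)
    (Finset.filter_subset (fun x => p x = c.1.2.2) V) (g := fun ω => ind R ω - f' ω) hweak
  have hB := octSum_le (φ := fun x y z => ind R (x, y, z) - f' (x, y, z))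
    (ψ := fun x y z => f' (x, y, z) - δ) (F := fun x y z =>
      ((ind R (x, y, z) - f' (x, y, z)) + (f' (x, y, z) - δ)) *
        (col q c.2.1 x y * col q c.2.2.1 y z * col q c.2.2.2 x z)) (τ := τ) hε₁ hε₁'
    (col_mem_unit q _) (col_mem_unit q _)
    (col_mem_unit q _) ⟨hd₀.trans_le k₁, u₁⟩ ⟨hd₀.trans_le k₂, u₂⟩ ⟨hd₀.trans_le k₃, u₃⟩ hε
    h₁ h₂ h₃ (fun _ _ _ => rfl)
  refine hB ?_ ?_ hφ ?_ ?_ ?_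
  · intro x y z
    have := ind_mem_unit R (x, y, z)
    exact abs_le.mpr ⟨by linarith, by linarith⟩
  · intro x y z
    have := hf' (x, y, z)
    exact abs_le.mpr ⟨by linarith, by linarith⟩
  · have t₁ := sum_triadAt V p q c (fun x y z => (f' (x, y, z) - δ) ^ 2)
    have t₂ := sum_triadAt V p q c (fun x y z => 1)
    simp only [one_mul, Finset.sum_const, nsmul_eq_mul, mul_one] at t₂
    rw [t₁, t₂]
    exact hψ
  · refine hετ.trans (mul_le_mul_of_nonneg_left ?_ hε₁.le)
    rw [show d₀ ^ 15 = (d₀ ^ 3) ^ 5 by ring]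
    exact pow_le_pow_left₀ (by positivity) hD 5
  · refine hτ.trans ?_
    rw [mul_assoc, mul_assoc]
    refine mul_le_mul_of_nonneg_left ?_ hε₁.le
    rw [show d₀ ^ 12 = (d₀ ^ 3) ^ 4 by ring]
    exact mul_le_mul (pow_le_pow_left₀ (by positivity) hD 4) hN (by positivity)
      (pow_nonneg (le_trans (by positivity) hD) 4)

lemma Decomp.isReg_of_card_le {V : Finset ℕ} {ι κ : Type} (P : Decomp V ι κ) {ε₁ ε₂ : ℝ}
    (S : Finset (ℕ × ℕ)) (hS : ∀ ω ∈ S, ω ∈ V ×ˢ V ∧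
      ∃ i j α, ω ∈ P.pairs i j α ∧ (P.pairBG i j α).dev2self ε₂)
    (h : (1 - ε₁) * (V.card : ℝ) ^ 2 ≤ S.card) : P.isReg ε₁ ε₂ :=
  h.trans (Nat.cast_le.mpr (Finset.card_le_card fun ω hω => Finset.mem_filter.mpr (hS ω hω)))

lemma Decomp.regWrt_of_card_le {V : Finset ℕ} {ι κ : Type} (P : Decomp V ι κ)
    (R : Finset (ℕ × ℕ × ℕ)) {ε₁ ε₂ : ℝ} (S : Finset (ℕ × ℕ × ℕ))
    (hS : ∀ ω ∈ S, ω ∈ V ×ˢ V ×ˢ V ∧ ∃ i j k α β γ, ω ∈ (P.triadOf i j k α β γ).K3 ∧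
      dev23 R (P.triadOf i j k α β γ) ε₁ ε₂)
    (h : (1 - ε₁) * (V.card : ℝ) ^ 3 ≤ S.card) : P.regWrt R ε₁ ε₂ :=
  h.trans (Nat.cast_le.mpr (Finset.card_le_card fun ω hω => Finset.mem_filter.mpr (hS ω hω)))

/-- A labelling which is regular at the level of pairs, and which captures almost all the energy of
a finer weakly regular labelling, induces a regular decomposition. -/
theorem goodDecomp_of_labels (H : ThreeGraph) (t ℓ : ℕ) (ht : 0 < t) (hℓ : 0 < ℓ) (p : ℕ → ℕ)
    (q q' : ℕ → ℕ → ℕ) (hp : ∀ x, p x < t) (hq : ∀ x y, q x y < ℓ) {ε ε₁ ε₂ τ : ℝ}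
    (hε₁ : 0 < ε₁) (hε₁' : ε₁ ≤ 1) (hε : 0 ≤ ε) (hε₂ : ε ≤ ε₂)
    (hετ : 18 * ε ≤ ε₁ * (ε₁ / (20 * ℓ)) ^ 15)
    (hτ : 3 * τ ≤ ε₁ * (ε₁ / (20 * ℓ)) ^ 12 * (ε₁ / (10 * t)) ^ 3)
    (hgood : (((H.verts ×ˢ H.verts).filter fun ω =>
      ¬ GoodPair H.verts p q ℓ ε (vertexLabels p ω)).card : ℝ) ≤
        ε₁ / 20 * (H.verts.card : ℝ) ^ 2)
    (hweak : ∀ a b c : ℕ × ℕ → ℝ, (∀ p, |a p| ≤ 1) → (∀ p, |b p| ≤ 1) → (∀ p, |c p| ≤ 1) →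
      |∑ ω ∈ triples H.verts, (ind H.obar ω -
        avgOn (triples H.verts) (pairLabels q') (ind H.obar) (pairLabels q' ω)) *
          (a (ω.1, ω.2.1) * b ω.2 * c (ω.1, ω.2.2))| ≤ τ * (H.verts.card : ℝ) ^ 3)
    (r : ℕ × ℕ × ℕ → (ℕ × ℕ × ℕ) × ℕ × ℕ × ℕ) (hr : ∀ ω, triadLabels p q ω = r (pairLabels q' ω))
    (hen : energy (triples H.verts) (pairLabels q') (ind H.obar) ≤
      energy (triples H.verts) (triadLabels p q) (ind H.obar) +
        (ε₁ / 54) ^ 2 * (ε₁ / 10) * (H.verts.card : ℝ) ^ 3) :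
    GoodDecomp H t ℓ ε₁ ε₂ := by
  set V := H.verts with hV
  have hε₂0 : 0 ≤ ε₂ := hε.trans hε₂
  refine ⟨decompOf V t ℓ p q hp hq, ?_, ?_⟩
  · have split := Finset.card_filter_add_card_filter_not (s := V ×ˢ V)
      (fun ω => GoodPair V p q ℓ ε (vertexLabels p ω))
    have split' : (((V ×ˢ V).filter fun ω => GoodPair V p q ℓ ε (vertexLabels p ω)).card : ℝ) +
        ((V ×ˢ V).filter fun ω => ¬ GoodPair V p q ℓ ε (vertexLabels p ω)).card =
        (V.card : ℝ) ^ 2 := by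
      rw [sq, ← Nat.cast_mul, ← Finset.card_product]
      exact_mod_cast split
    refine Decomp.isReg_of_card_le _
      ((V ×ˢ V).filter fun ω => GoodPair V p q ℓ ε (vertexLabels p ω)) ?_ ?_
    · rintro ⟨x, y⟩ hω
      rw [Finset.mem_filter] at hω
      obtain ⟨hω, hg⟩ := hω
      have hxy := Finset.mem_product.mp hω
      refine ⟨hω, ⟨p x, hp x⟩, ⟨p y, hp y⟩, ⟨q x y, hq x y⟩, ?_, ?_⟩
      · exact Finset.mem_filter.mpr ⟨Finset.mem_product.mpr
          ⟨Finset.mem_filter.mpr ⟨hxy.1, rfl⟩, Finset.mem_filter.mpr ⟨hxy.2, rfl⟩⟩, rfl⟩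
      · have := dev2_colBG (hg (q x y) (hq x y)) hε₂ hε₂0
        change (colBG V p q (p x) (p y) (q x y)).dev2 ε₂ (colBG V p q (p x) (p y) (q x y)).density
        rw [density_colBG]
        exact this
    · have hV2 : 0 ≤ ε₁ * (V.card : ℝ) ^ 2 := by positivity
      linarith
  · set f' : ℕ × ℕ × ℕ → ℝ := fun ω =>
      avgOn (triples V) (pairLabels q') (ind H.obar) (pairLabels q' ω) with hf'
    have hf01 : ∀ ω, 0 ≤ f' ω ∧ f' ω ≤ 1 := fun ω =>
      ⟨avgOn_nonneg _ _ _ (fun ω _ => (ind_mem_unit _ ω).1) _,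
        avgOn_le_one _ _ _ (fun ω _ => (ind_mem_unit _ ω).2) _⟩
    set S := triadLabels p q with hS
    set g : ℕ × ℕ × ℕ → ℝ := fun ω => (f' ω - avgOn (triples V) S (ind H.obar) (S ω)) ^ 2 with hg
    have gsum : ∑ ω ∈ triples V, g ω ≤ (ε₁ / 54) ^ 2 * (ε₁ / 10) * (V.card : ℝ) ^ 3 := by
      have := sum_sq_avgOn_sub (triples V) (f := ind H.obar) (κ := S) (κ' := pairLabels q')
        (r := r) fun ω _ => hr ω
      rw [hg]
      linarith
    have few := card_avgOn_gt_le (triples V) S g (fun ω _ => sq_nonneg _) ((ε₁ / 54) ^ 2)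
    have few' : (((triples V).filter fun ω =>
        (ε₁ / 54) ^ 2 < avgOn (triples V) S g (S ω)).card : ℝ) ≤ ε₁ / 10 * (V.card : ℝ) ^ 3 := by
      refine le_of_mul_le_mul_left ?_ (by positivity : (0 : ℝ) < (ε₁ / 54) ^ 2)
      linarith
    set s : ℝ := ε₁ / (10 * t) * V.card with hs
    have hs0 : 0 ≤ s := by positivity
    set d₀ : ℝ := ε₁ / (20 * ℓ) with hd
    have hd0 : 0 < d₀ := by positivity
    have bad := card_triples_filter_le V (BadPair V p q ℓ ε d₀ s)
      (fun ω => (ε₁ / 54) ^ 2 < avgOn (triples V) S g (S ω))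
      (card_badPair_le V p q t ℓ ht hℓ hp hq hε₁ hgood) few'
    set Q : ℕ × ℕ × ℕ → Prop := fun ω => BadPair V p q ℓ ε d₀ s (ω.1, ω.2.1) ∨
      BadPair V p q ℓ ε d₀ s ω.2 ∨ BadPair V p q ℓ ε d₀ s (ω.1, ω.2.2) ∨
        (ε₁ / 54) ^ 2 < avgOn (triples V) S g (S ω) with hQ
    have split := Finset.card_filter_add_card_filter_not (s := triples V) Q
    have split' : (((triples V).filter Q).card : ℝ) + ((triples V).filter fun ω => ¬ Q ω).card =
        (V.card : ℝ) ^ 3 := by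
      rw [← card_triples]
      exact_mod_cast split
    refine Decomp.regWrt_of_card_le _ _ ((triples V).filter fun ω => ¬ Q ω) ?_ ?_
    · rintro ⟨x, y, z⟩ hω
      rw [Finset.mem_filter] at hω
      obtain ⟨hω, hnQ⟩ := hω
      refine ⟨hω, ⟨p x, hp x⟩, ⟨p y, hp y⟩, ⟨p z, hp z⟩, ⟨q x y, hq x y⟩, ⟨q x z, hq x z⟩,
        ⟨q y z, hq y z⟩, ?_⟩
      change (x, y, z) ∈ (triadAt V p q (S (x, y, z))).K3 ∧
        dev23 H.obar (triadAt V p q (S (x, y, z))) ε₁ ε₂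
      refine ⟨by rw [K3_triadAt]; exact mem_cell.mpr ⟨hω, rfl⟩, ?_⟩
      rw [hQ] at hnQ
      unfold BadPair at hnQ
      push Not at hnQ
      obtain ⟨⟨a₁, a₂, a₃, a₄⟩, ⟨b₁, b₂, b₃, b₄⟩, ⟨c₁, c₂, c₃, c₄⟩, hav⟩ := hnQ
      refine dev23_triadAt V p q H.obar (S (x, y, z)) f' hf01 hε₁ hε₁' hε hε₂ hd0 hs0
        (a₁ _ (hq x y)) (b₁ _ (hq y z)) (c₁ _ (hq x z)) a₂ b₂ c₂ a₃ a₄ b₄ hweak ?_ hετ ?_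
      · have hpos := card_cell_pos (triples V) S hω
        have := (div_le_iff₀ hpos).mp hav
        refine le_of_eq_of_le (Finset.sum_congr rfl fun ω' hω' => ?_) this
        rw [hg]
        dsimp only
        have hS' : S ω' = S (x, y, z) := (mem_cell.mp hω').2
        rw [hS']
      · have := mul_le_mul_of_nonneg_right hτ (by positivity : (0 : ℝ) ≤ (V.card : ℝ) ^ 3)
        rw [hs]
        linarith
    · have hV3 : 0 ≤ ε₁ * (V.card : ℝ) ^ 3 := by positivity
      linarith

/-- A labelling with `t` vertex labels and `ℓ` pair labels, almost all of whose pairs of vertex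
classes are `ε ℓ`-regular in every colour. -/
structure RegularLabelling (V : Finset ℕ) (ε : ℕ → ℝ) (η : ℝ) (t ℓ : ℕ) (p : ℕ → ℕ)
    (q : ℕ → ℕ → ℕ) : Prop where
  t_pos : 0 < t
  ℓ_pos : 0 < ℓ
  p_lt : ∀ x, p x < t
  q_lt : ∀ x y, q x y < ℓ
  few_bad : (((V ×ˢ V).filter fun ω => ¬ GoodPair V p q ℓ (ε ℓ) (vertexLabels p ω)).card : ℝ) ≤
    η * (V.card : ℝ) ^ 2

lemma exists_regularLabelling (ε : ℕ → ℝ) (η : ℝ) (hη : 0 < η) (ℓ : ℕ) (hℓ : 0 < ℓ)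
    (hε : 0 < ε ℓ) : ∃ T : ℕ, ∀ (V : Finset ℕ) (q : ℕ → ℕ → ℕ), (∀ x y, q x y < ℓ) →
      ∃ p, RegularLabelling V ε η T ℓ p q := by
  obtain ⟨T, hT⟩ := graph_regularity ℓ 1 (ε ℓ) η hε hη
  refine ⟨T + 1, fun V q hq => ?_⟩
  obtain ⟨p, hp, -, hbad⟩ := hT V q (fun _ => 0) fun _ => Nat.one_pos
  exact ⟨p, ⟨Nat.succ_pos _, hℓ, fun x => (hp x).trans (Nat.lt_succ_self _), hq, hbad⟩⟩

/-- A bounded common refinement of a labelling of the vertices and of the pairs which is weakly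
regular for a function of triples. -/
lemma exists_weakly_regular_refinement (m : ℕ) (τ : ℝ) (hτ : 0 < τ) : ∃ M : ℕ,
    ∀ (V : Finset ℕ) (f : ℕ × ℕ × ℕ → ℝ), (∀ ω, 0 ≤ f ω) → (∀ ω, f ω ≤ 1) →
    ∀ (p : ℕ → ℕ) (q : ℕ → ℕ → ℕ), (∀ x, p x < m) → (∀ x y, q x y < m) →
    ∃ q' : ℕ → ℕ → ℕ, (∀ x y, q' x y < M) ∧
      (∃ r : ℕ × ℕ × ℕ → (ℕ × ℕ × ℕ) × ℕ × ℕ × ℕ, ∀ ω, triadLabels p q ω = r (pairLabels q' ω)) ∧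
      ∀ a b c : ℕ × ℕ → ℝ, (∀ p, |a p| ≤ 1) → (∀ p, |b p| ≤ 1) → (∀ p, |c p| ≤ 1) →
        |∑ ω ∈ triples V, (f ω - avgOn (triples V) (pairLabels q') f (pairLabels q' ω)) *
          (a (ω.1, ω.2.1) * b ω.2 * c (ω.1, ω.2.2))| ≤ τ * (V.card : ℝ) ^ 3 := by
  rcases Nat.eq_zero_or_pos m with rfl | hm
  · exact ⟨0, fun V f _ _ p q hp _ => absurd (hp 0) (Nat.not_lt_zero _)⟩
  have : Nonempty (Fin m × Fin m × Fin m) := ⟨⟨0, hm⟩, ⟨0, hm⟩, ⟨0, hm⟩⟩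
  obtain ⟨K, enc, dec, henc, hdec⟩ := exists_code (Fin m × Fin m × Fin m)
  obtain ⟨M, hM⟩ := weak_regularity_triples K τ hτ
  refine ⟨M, fun V f hf0 hf1 p q hp hq => ?_⟩
  obtain ⟨q', hq', ⟨r, hr⟩, hweak⟩ := hM V f hf0 hf1
    (fun x y => enc (⟨p x, hp x⟩, ⟨p y, hp y⟩, ⟨q x y, hq x y⟩)) fun x y => henc _
  have key : ∀ x y, dec (r (q' x y)) = (⟨p x, hp x⟩, ⟨p y, hp y⟩, ⟨q x y, hq x y⟩) := by
    intro x y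
    rw [← hr, hdec]
  refine ⟨q', hq', ⟨fun c => (((dec (r c.1)).1, (dec (r c.1)).2.1, (dec (r c.2.1)).2.1),
    (dec (r c.1)).2.2, (dec (r c.2.1)).2.2, (dec (r c.2.2)).2.2), ?_⟩, hweak⟩
  rintro ⟨x, y, z⟩
  simp only [pairLabels, key, triadLabels]

/-- Energy of the triad labels of a 3-graph, normalized. -/
noncomputable def triadEnergy (H : ThreeGraph) (p : ℕ → ℕ) (q : ℕ → ℕ → ℕ) : ℝ :=
  energy (triples H.verts) (triadLabels p q) (ind H.obar) / (H.verts.card : ℝ) ^ 3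

lemma triadEnergy_nonneg (H : ThreeGraph) (p : ℕ → ℕ) (q : ℕ → ℕ → ℕ) : 0 ≤ triadEnergy H p q :=
  div_nonneg (energy_nonneg _ _ _) (by positivity)

lemma triadEnergy_le_one (H : ThreeGraph) (p : ℕ → ℕ) (q : ℕ → ℕ → ℕ) : triadEnergy H p q ≤ 1 := by
  refine div_le_one_of_le₀ ?_ (by positivity)
  rw [← card_triples]
  exact energy_le_card _ _ _ (fun ω _ => (ind_mem_unit _ ω).1) (fun ω _ => (ind_mem_unit _ ω).2)

/-- The regularity lemma for 3-graphs, with respect to the given accuracy functions. -/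
theorem exists_goodDecomp (ε₁ : ℝ) (ε₂ : ℕ → ℝ) (hε₁ : 0 < ε₁) (hε₁' : ε₁ ≤ 1)
    (hε₂ : ∀ ℓ, 0 < ε₂ ℓ) : ∃ M : ℕ, ∀ H : ThreeGraph,
      ∃ t ℓ : ℕ, 1 ≤ t ∧ t ≤ M ∧ 1 ≤ ℓ ∧ ℓ ≤ M ∧ GoodDecomp H t ℓ ε₁ (ε₂ ℓ) := by
  set ε : ℕ → ℝ := fun ℓ => min (ε₂ ℓ) (ε₁ * (ε₁ / (20 * ℓ)) ^ 15 / 18) with hε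
  have hεpos : ∀ ℓ : ℕ, 0 < ℓ → 0 < ε ℓ := by
    intro ℓ hℓ
    have : (0 : ℝ) < ℓ := Nat.cast_pos.mpr hℓ
    exact lt_min (hε₂ ℓ) (by positivity)
  have iter := energy_iteration (E := ThreeGraph) (C := ℕ × ℕ × (ℕ → ℕ) × (ℕ → ℕ → ℕ))
    (fun H c m => RegularLabelling H.verts ε (ε₁ / 20) c.1 c.2.1 c.2.2.1 c.2.2.2 ∧
      c.1 ≤ m ∧ c.2.1 ≤ m)
    (fun H c m m' hmm h => ⟨h.1, h.2.1.trans hmm, h.2.2.trans hmm⟩) (fun _ _ _ => True)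
    (fun _ _ => trivial) (fun _ _ _ _ _ _ => trivial)
    (fun H c => triadEnergy H c.2.2.1 c.2.2.2) (fun H c => triadEnergy_nonneg _ _ _)
    (fun H c => triadEnergy_le_one _ _ _) (fun H c => GoodDecomp H c.1 c.2.1 ε₁ (ε₂ c.2.1))
    ((ε₁ / 54) ^ 2 * (ε₁ / 10)) (by positivity)
  have step : ∀ m : ℕ, ∃ m', ∀ (H : ThreeGraph) (c : ℕ × ℕ × (ℕ → ℕ) × (ℕ → ℕ → ℕ)),
      RegularLabelling H.verts ε (ε₁ / 20) c.1 c.2.1 c.2.2.1 c.2.2.2 ∧ c.1 ≤ m ∧ c.2.1 ≤ m →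
      GoodDecomp H c.1 c.2.1 ε₁ (ε₂ c.2.1) ∨ ∃ c' : ℕ × ℕ × (ℕ → ℕ) × (ℕ → ℕ → ℕ),
        (RegularLabelling H.verts ε (ε₁ / 20) c'.1 c'.2.1 c'.2.2.1 c'.2.2.2 ∧
          c'.1 ≤ m' ∧ c'.2.1 ≤ m') ∧ True ∧
        triadEnergy H c.2.2.1 c.2.2.2 + (ε₁ / 54) ^ 2 * (ε₁ / 10) ≤
          triadEnergy H c'.2.2.1 c'.2.2.2 := by
    intro m
    set τ : ℝ := ε₁ * (ε₁ / (20 * (m + 1))) ^ 12 * (ε₁ / (10 * (m + 1))) ^ 3 / 3 with hτ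
    obtain ⟨M, hM⟩ := exists_weakly_regular_refinement m τ (by positivity)
    obtain ⟨T, hT⟩ := exists_regularLabelling ε (ε₁ / 20) (by positivity) (M + 1)
      (Nat.succ_pos _) (hεpos _ (Nat.succ_pos _))
    refine ⟨max T (M + 1), ?_⟩
    rintro H ⟨t, ℓ, p, q⟩ ⟨h, htm, hℓm⟩
    dsimp only at h htm hℓm ⊢
    have ht : (0 : ℝ) < t := Nat.cast_pos.mpr h.t_pos
    have hℓ : (0 : ℝ) < ℓ := Nat.cast_pos.mpr h.ℓ_pos
    have htm' : (t : ℝ) ≤ m + 1 := by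
      have : (t : ℝ) ≤ m := Nat.cast_le.mpr htm
      linarith
    have hℓm' : (ℓ : ℝ) ≤ m + 1 := by
      have : (ℓ : ℝ) ≤ m := Nat.cast_le.mpr hℓm
      linarith
    obtain ⟨q', hq', ⟨r, hr⟩, hweak⟩ := hM H.verts (ind H.obar) (fun ω => (ind_mem_unit _ ω).1)
      (fun ω => (ind_mem_unit _ ω).2) p q (fun x => (h.p_lt x).trans_le htm)
      (fun x y => (h.q_lt x y).trans_le hℓm)
    by_cases hen : energy (triples H.verts) (pairLabels q') (ind H.obar) ≤
        energy (triples H.verts) (triadLabels p q) (ind H.obar) +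
          (ε₁ / 54) ^ 2 * (ε₁ / 10) * (H.verts.card : ℝ) ^ 3
    · refine Or.inl (goodDecomp_of_labels H t ℓ h.t_pos h.ℓ_pos p q q' h.p_lt h.q_lt hε₁ hε₁'
        (hεpos ℓ h.ℓ_pos).le (min_le_left _ _) ?_ ?_ h.few_bad hweak r hr hen)
      · have : ε ℓ ≤ ε₁ * (ε₁ / (20 * ℓ)) ^ 15 / 18 := min_le_right _ _
        linarith
      · have : 3 * τ = ε₁ * (ε₁ / (20 * (m + 1))) ^ 12 * (ε₁ / (10 * (m + 1))) ^ 3 := by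
          rw [hτ]; ring
        rw [this]
        gcongr
    · obtain ⟨p', hp'⟩ := hT H.verts q' fun x y => (hq' x y).trans (Nat.lt_succ_self _)
      refine Or.inr ⟨(T, M + 1, p', q'), ⟨hp', le_max_left _ _, le_max_right _ _⟩, trivial, ?_⟩
      push Not at hen
      have mono : energy (triples H.verts) (pairLabels q') (ind H.obar) ≤
          energy (triples H.verts) (triadLabels p' q') (ind H.obar) :=
        energy_mono _ (r := Prod.snd) fun _ _ => rfl
      have hV : 0 < (H.verts.card : ℝ) ^ 3 := by
        rcases Nat.eq_zero_or_pos H.verts.card with h0 | h0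
        · exfalso
          have le := energy_le_card (triples H.verts) (pairLabels q') (ind H.obar)
            (fun ω _ => (ind_mem_unit _ ω).1) (fun ω _ => (ind_mem_unit _ ω).2)
          have ge := energy_nonneg (triples H.verts) (triadLabels p q) (ind H.obar)
          rw [card_triples, h0] at le
          rw [h0] at hen
          norm_num at le hen
          linarith
        · have : (0 : ℝ) < H.verts.card := Nat.cast_pos.mpr h0
          positivity
      unfold triadEnergy
      rw [div_add' _ _ _ hV.ne']
      gcongr
      exact hen.le.trans mono
  obtain ⟨T₀, hT₀⟩ := exists_regularLabelling ε (ε₁ / 20) (by positivity) 1 Nat.one_pos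
    (hεpos 1 Nat.one_pos)
  obtain ⟨M, hM⟩ := iter step (max T₀ 1)
  refine ⟨M, fun H => ?_⟩
  obtain ⟨p, hp⟩ := hT₀ H.verts (fun _ _ => 0) fun _ _ => Nat.one_pos
  obtain ⟨c, ⟨hc, hct, hcℓ⟩, -, hgood⟩ := hM H (T₀, 1, p, fun _ _ => 0)
    ⟨hp, le_max_left _ _, le_max_right _ _⟩
  exact ⟨c.1, c.2.1, hc.t_pos, hct, hc.ℓ_pos, hcℓ, hgood⟩

lemma exists_psi (ℋ : Set ThreeGraph) (ε₁ : ℝ) (ε₂ : ℕ → ℝ) (hε₁ : 0 < ε₁) (hε₁' : ε₁ < 1)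
    (hε₂ : InZeroOne ε₂) : ∃ L T : ℕ, 1 ≤ T ∧ psi ε₁ ε₂ T L ℋ := by
  obtain ⟨M, hM⟩ := exists_goodDecomp ε₁ ε₂ hε₁ hε₁'.le fun ℓ => (hε₂ ℓ).1
  refine ⟨M, M + 1, Nat.succ_le_succ (Nat.zero_le _), 0, fun H _ _ => ?_⟩
  obtain ⟨t, ℓ, ht, htM, hℓ, hℓM, hg⟩ := hM H
  exact ⟨t, ℓ, ht, htM.trans (Nat.le_succ _), hℓ, hℓM, hg⟩

/-- Corollary 6.4: exponential lower bound under infinite `VC₂`-dimension. -/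
theorem stmt_19 (ℋ : Set ThreeGraph) (hH : Hereditary ℋ)
    (hVC : ∀ k : ℕ, ∃ H ∈ ℋ, H.VC2AtLeast k) :
    ∃ C : ℝ, 0 < C ∧ SmallEps fun ε₁ ε₂ =>
      (2 : ℝ) ^ (ε₁ ^ (-C)) ≤ (Lfun ℋ ε₁ ε₂ : ℝ) := by
  exact exponential_lower_bound ℋ hH hVC (exists_psi ℋ)
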